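/- arXiv:2304.06616 — 5 statements merged into one kernel-verified Lean document; each statement's English description precedes it below -/
import Mathlib

section
/- Let X₁ and X₂ be Polish metric spaces, p ∈ [1,∞), μᵢ ∈ 𝒫_p(Xᵢ) (i = 1,2), 1 < q ≤ 2, and let c: X₁ × X₂ → [0,∞) be a continuous cost satisfying condition (A_{L,C}) for some L, C ≥ 0. Let ε_k > 0 with ε_k → 0, define F_k(π) = ∫ c dπ + ε_k D_q(π, μ₁⊗μ₂) for π ∈ Π(μ₁,μ₂) and F_k(π) = +∞ otherwise, and F(π) = ∫ c dπ for π ∈ Π(μ₁,μ₂) and F(π) = +∞ otherwise. Then {F_k} Γ-converges to F with respect to the narrow topology: (i) for every sequence π_k converging narrowly to π one has F(π) ≤ liminf_{k→∞} F_k(π_k), and (ii) for every π there exists a sequence π_k converging narrowly to π with limsup_{k→∞} F_k(π_k) ≤ F(π). -/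
open MeasureTheory Filter Topology
open scoped ENNReal Classical

noncomputable section

/-- `π` is a coupling of `μ` and `ν`. -/
def IsCoupling {X Y : Type*} [MeasurableSpace X] [MeasurableSpace Y]
    (π : Measure (X × Y)) (μ : Measure X) (ν : Measure Y) : Prop :=
  π.map Prod.fst = μ ∧ π.map Prod.snd = ν

/-- Tsallis relative entropy `D_q(μ, ν) = (1/(q-1)) ∫ ((dμ/dν)^q - dμ/dν) dν` if `μ ≪ ν`,
and `∞` otherwise; with values in `[0, ∞]`. -/
def tsallisDiv {X : Type*} [MeasurableSpace X] (q : ℝ) (μ ν : Measure X) : ℝ≥0∞ :=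
  if μ ≪ ν then
    (∫⁻ x, μ.rnDeriv ν x ^ q ∂ν - ∫⁻ x, μ.rnDeriv ν x ∂ν) / ENNReal.ofReal (q - 1)
  else ⊤

/-- `p`-Wasserstein distance. -/
def Wp {X : Type*} [MeasurableSpace X] [PseudoEMetricSpace X] (p : ℝ)
    (μ ν : Measure X) : ℝ≥0∞ :=
  ⨅ (γ : Measure (X × X)) (_ : IsCoupling γ μ ν),
    (∫⁻ z, edist z.1 z.2 ^ p ∂γ) ^ (1 / p)

/-- `p`-Wasserstein distance between measures on a product space, with respect to the metric
`d((x₁,x₂),(y₁,y₂)) = (d₁(x₁,y₁)^p + d₂(x₂,y₂)^p)^{1/p}`. -/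
def WpProd {X₁ X₂ : Type*} [MeasurableSpace X₁] [MeasurableSpace X₂]
    [PseudoEMetricSpace X₁] [PseudoEMetricSpace X₂] (p : ℝ)
    (π π' : Measure (X₁ × X₂)) : ℝ≥0∞ :=
  ⨅ (γ : Measure ((X₁ × X₂) × (X₁ × X₂))) (_ : IsCoupling γ π π'),
    (∫⁻ z, (edist z.1.1 z.2.1 ^ p + edist z.1.2 z.2.2 ^ p) ∂γ) ^ (1 / p)

/-- `μ` has a finite `p`-th moment. -/
def HasFiniteMoment {X : Type*} [MeasurableSpace X] [PseudoEMetricSpace X] (p : ℝ)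
    (μ : Measure X) : Prop :=
  ∃ x₀ : X, ∫⁻ x, edist x x₀ ^ p ∂μ ≠ ⊤

/-- Condition `(A_{L,C})` on the cost function `c` relative to the marginals `μ₁, μ₂`. -/
def CondA {X₁ X₂ : Type*} [MeasurableSpace X₁] [MeasurableSpace X₂]
    [PseudoEMetricSpace X₁] [PseudoEMetricSpace X₂]
    (p L C : ℝ) (c : X₁ × X₂ → ℝ) (μ₁ : Measure X₁) (μ₂ : Measure X₂) : Prop :=
  ∀ (ν₁ : Measure X₁) (ν₂ : Measure X₂),
    IsProbabilityMeasure ν₁ → IsProbabilityMeasure ν₂ →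
    HasFiniteMoment p ν₁ → HasFiniteMoment p ν₂ →
    Wp p ν₁ μ₁ ≤ ENNReal.ofReal C → Wp p ν₂ μ₂ ≤ ENNReal.ofReal C →
    ∀ π : Measure (X₁ × X₂), IsCoupling π μ₁ μ₂ →
    ∀ π' : Measure (X₁ × X₂), IsCoupling π' ν₁ ν₂ →
      |(∫ z, c z ∂π) - ∫ z, c z ∂π'| ≤ L * (WpProd p π π').toReal

/-- Narrow convergence of a sequence of measures: convergence of the integrals of all
bounded continuous functions. -/
def NarrowTendsto {Z : Type*} [MeasurableSpace Z] [TopologicalSpace Z]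
    (πs : ℕ → Measure Z) (π : Measure Z) : Prop :=
  ∀ f : BoundedContinuousFunction Z ℝ,
    Tendsto (fun k => ∫ z, f z ∂(πs k)) atTop (𝓝 (∫ z, f z ∂π))

/-- The regularized functional `F_k`: `∫ c dπ + ε D_q(π, μ₁⊗μ₂)` on couplings,
`+∞` elsewhere. -/
def Freg {X₁ X₂ : Type*} [MeasurableSpace X₁] [MeasurableSpace X₂]
    (q ε : ℝ) (c : X₁ × X₂ → ℝ) (μ₁ : Measure X₁) (μ₂ : Measure X₂)
    (π : Measure (X₁ × X₂)) : ℝ≥0∞ :=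
  if IsCoupling π μ₁ μ₂ then
    ∫⁻ z, ENNReal.ofReal (c z) ∂π + ENNReal.ofReal ε * tsallisDiv q π (μ₁.prod μ₂)
  else ⊤

/-- The limit functional `F`: `∫ c dπ` on couplings, `+∞` elsewhere. -/
def Flim {X₁ X₂ : Type*} [MeasurableSpace X₁] [MeasurableSpace X₂]
    (c : X₁ × X₂ → ℝ) (μ₁ : Measure X₁) (μ₂ : Measure X₂)
    (π : Measure (X₁ × X₂)) : ℝ≥0∞ :=
  if IsCoupling π μ₁ μ₂ then ∫⁻ z, ENNReal.ofReal (c z) ∂π else ⊤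

set_option linter.unusedSectionVars false
set_option linter.unusedVariables false

/-- the transport cost -/
def hcost {X₁ X₂ : Type*} [PseudoEMetricSpace X₁] [PseudoEMetricSpace X₂] (p : ℝ)
    (z : (X₁ × X₂) × (X₁ × X₂)) : ℝ≥0∞ := edist z.1.1 z.2.1 ^ p + edist z.1.2 z.2.2 ^ p

/-- product-ized restriction -/
def gl {X Y : Type*} [MeasurableSpace X] [MeasurableSpace Y] (π : Measure (X × Y))
    (S : Set (X × Y)) : Measure (X × Y) :=
  (π S)⁻¹ • ((π.restrict S).map Prod.fst).prod ((π.restrict S).map Prod.snd)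

section gl
variable {X Y : Type*} [MeasurableSpace X] [MeasurableSpace Y] (π : Measure (X × Y))
    [IsFiniteMeasure π] (S : Set (X × Y))

lemma gl_smul_aux {Z : Type*} [MeasurableSpace Z] (f : X × Y → Z) :
    (π S)⁻¹ • (π S) • (π.restrict S).map f = (π.restrict S).map f := by
  by_cases h : π S = 0
  · have : π.restrict S = 0 := Measure.restrict_eq_zero.2 h
    simp [this]
  · rw [smul_smul, ENNReal.inv_mul_cancel h (measure_ne_top _ _), one_smul]

lemma gl_fst : (gl π S).map Prod.fst = (π.restrict S).map Prod.fst := by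
  rw [gl, Measure.map_smul, Measure.map_fst_prod, Measure.map_apply measurable_snd .univ]
  simpa using gl_smul_aux π S Prod.fst

lemma gl_snd : (gl π S).map Prod.snd = (π.restrict S).map Prod.snd := by
  rw [gl, Measure.map_smul, Measure.map_snd_prod, Measure.map_apply measurable_fst .univ]
  simpa using gl_smul_aux π S Prod.snd

lemma gl_univ : gl π S Set.univ = π S := by
  have := congrArg (fun m => m Set.univ) (gl_fst π S)
  simpa [Measure.map_apply measurable_fst MeasurableSet.univ] using this

instance : IsFiniteMeasure (gl π S) := ⟨by rw [gl_univ]; exact measure_lt_top _ _⟩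

lemma gl_le (μ : Measure X) (ν : Measure Y) [IsFiniteMeasure μ] [IsFiniteMeasure ν]
    (h : IsCoupling π μ ν) :
    gl π S ≤ (π S)⁻¹ • μ.prod ν := by
  have h1 : (π.restrict S).map Prod.fst ≤ μ := by
    rw [← h.1]; exact Measure.map_mono Measure.restrict_le_self measurable_fst
  have h2 : (π.restrict S).map Prod.snd ≤ ν := by
    rw [← h.2]; exact Measure.map_mono Measure.restrict_le_self measurable_snd
  unfold gl
  gcongr
end gl

lemma map_fsum {X Y : Type*} [MeasurableSpace X] [MeasurableSpace Y] {f : X → Y}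
    (hf : Measurable f) (s : Finset ℕ) (m : ℕ → Measure X) :
    (∑ i ∈ s, m i).map f = ∑ i ∈ s, (m i).map f := by
  ext t ht
  rw [Measure.map_apply hf ht]
  simp [Measure.map_apply hf ht]

section block
variable {X Y : Type*} [MeasurableSpace X] [MeasurableSpace Y] (π : Measure (X × Y))
    [IsFiniteMeasure π] (s : Finset ℕ) (E : ℕ → Set (X × Y))

lemma block_coupling (μ : Measure X) (ν : Measure Y)
    (h : IsCoupling π μ ν) (hE : π = ∑ i ∈ s, π.restrict (E i)) :
    IsCoupling (∑ i ∈ s, gl π (E i)) μ ν := by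
  constructor
  · rw [map_fsum measurable_fst, ← h.1]
    simp_rw [gl_fst]
    rw [← map_fsum measurable_fst, ← hE]
  · rw [map_fsum measurable_snd, ← h.2]
    simp_rw [gl_snd]
    rw [← map_fsum measurable_snd, ← hE]

lemma block_le (μ : Measure X) (ν : Measure Y) [IsFiniteMeasure μ] [IsFiniteMeasure ν]
    (h : IsCoupling π μ ν) (hE : π = ∑ i ∈ s, π.restrict (E i)) :
    ∃ M : ℝ≥0∞, M ≠ ⊤ ∧ ∑ i ∈ s, gl π (E i) ≤ M • μ.prod ν := by
  refine ⟨∑ i ∈ s.filter (fun i => π (E i) ≠ 0), (π (E i))⁻¹, ?_, ?_⟩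
  · refine ENNReal.sum_ne_top.2 fun i hi => ?_
    simpa using (Finset.mem_filter.1 hi).2
  · rw [← Finset.sum_filter_of_ne (p := fun i => π (E i) ≠ 0), Finset.sum_smul]
    · exact Finset.sum_le_sum fun i _ => gl_le π (E i) μ ν h
    · intro i _ hne h0
      apply hne
      rw [← Measure.measure_univ_eq_zero, gl_univ, h0]

/-- coupling of π with its block approximation -/
def blockGamma : Measure ((X × Y) × (X × Y)) :=
  ∑ i ∈ s, (π (E i))⁻¹ • (π.restrict (E i)).prod (gl π (E i))

lemma blockGamma_coupling (hE : π = ∑ i ∈ s, π.restrict (E i)) :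
    IsCoupling (blockGamma π s E) π (∑ i ∈ s, gl π (E i)) := by
  unfold blockGamma
  constructor
  · rw [map_fsum measurable_fst]
    conv_rhs => rw [hE]
    refine Finset.sum_congr rfl fun i _ => ?_
    rw [Measure.map_smul, Measure.map_fst_prod, gl_univ]
    simpa using gl_smul_aux π (E i) id
  · rw [map_fsum measurable_snd]
    refine Finset.sum_congr rfl fun i _ => ?_
    rw [Measure.map_smul, Measure.map_snd_prod]
    by_cases h : π (E i) = 0
    · have : gl π (E i) = 0 := by rw [← Measure.measure_univ_eq_zero, gl_univ, h]
      simp [this]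
    · simp [smul_smul, ENNReal.inv_mul_cancel h (measure_ne_top _ _)]
end block

lemma tsallis_bound {Z : Type*} [MeasurableSpace Z] (q : ℝ) (hq : 1 < q) (π ν : Measure Z)
    [IsFiniteMeasure π] [IsFiniteMeasure ν] (M : ℝ≥0∞) (hM : M ≠ ⊤) (h : π ≤ M • ν) :
    π ≪ ν ∧ tsallisDiv q π ν ≠ ⊤ := by
  have hac : π ≪ ν := (Measure.absolutelyContinuous_of_le h).trans
    (Measure.smul_absolutelyContinuous)
  refine ⟨hac, ?_⟩
  rw [tsallisDiv, if_pos hac]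
  have hle : π.rnDeriv ν ≤ᵐ[ν] fun _ => M := by
    refine ae_le_of_forall_setLIntegral_le_of_sigmaFinite (Measure.measurable_rnDeriv _ _)
      fun t ht _ => ?_
    rw [Measure.setLIntegral_rnDeriv hac]
    simpa using h t
  have hint : ∫⁻ x, π.rnDeriv ν x ^ q ∂ν ≠ ⊤ := by
    refine ne_top_of_le_ne_top (b := ∫⁻ x, M ^ q ∂ν) ?_ (lintegral_mono_ae ?_)
    · rw [lintegral_const]
      exact ENNReal.mul_ne_top (ENNReal.rpow_ne_top_of_nonneg (by linarith) hM) (measure_ne_top _ _)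
    · filter_upwards [hle] with x hx
      exact ENNReal.rpow_le_rpow hx (by linarith)
  refine ENNReal.div_ne_top (ne_top_of_le_ne_top hint tsub_le_self) ?_
  simpa using hq

section cost
variable {X Y : Type*} [PseudoEMetricSpace X] [SecondCountableTopology X]
  [MeasurableSpace X] [BorelSpace X]
  [PseudoEMetricSpace Y] [SecondCountableTopology Y] [MeasurableSpace Y] [BorelSpace Y]

lemma hcost_meas (p : ℝ) : Measurable (hcost p : (X × Y) × (X × Y) → ℝ≥0∞) := by
  unfold hcost
  fun_prop

lemma edist_pow_triangle {p : ℝ} (hp : 1 ≤ p) {Z : Type*} [PseudoEMetricSpace Z] (x y x₀ : Z) :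
    edist x y ^ p ≤ 2 ^ (p - 1) * (edist x x₀ ^ p + edist y x₀ ^ p) := by
  refine le_trans (ENNReal.rpow_le_rpow (edist_triangle_right x y x₀) (by linarith)) ?_
  exact ENNReal.rpow_add_le_mul_rpow_add_rpow _ _ hp

lemma hcost_triangle {p : ℝ} (hp : 1 ≤ p) (z z' z₀ : X × Y) :
    hcost p (z, z') ≤ 2 ^ (p - 1) * (hcost p (z, z₀) + hcost p (z', z₀)) := by
  unfold hcost
  refine le_trans (add_le_add (edist_pow_triangle hp z.1 z'.1 z₀.1)
    (edist_pow_triangle hp z.2 z'.2 z₀.2)) (le_of_eq ?_)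
  simp only
  ring

lemma edist_pow_le_hcost {p : ℝ} (hp : 1 ≤ p) (z z' : X × Y) :
    edist z z' ^ p ≤ hcost p (z, z') := by
  unfold hcost
  rw [Prod.edist_eq]
  rcases le_total (edist z.1 z'.1) (edist z.2 z'.2) with h | h
  · rw [max_eq_right h]; exact le_add_self
  · rw [max_eq_left h]; exact le_self_add

lemma hcost_coupling (p : ℝ) {π : Measure (X × Y)} {μ : Measure X} {ν : Measure Y}
    (h : IsCoupling π μ ν) (z₀ : X × Y) :
    ∫⁻ z, hcost p (z, z₀) ∂π = ∫⁻ x, edist x z₀.1 ^ p ∂μ + ∫⁻ y, edist y z₀.2 ^ p ∂ν := by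
  unfold hcost
  rw [lintegral_add_left (by fun_prop), ← h.1, ← h.2, lintegral_map (by fun_prop) measurable_fst,
    lintegral_map (by fun_prop) measurable_snd]

lemma hcost_gl (p : ℝ) (π : Measure (X × Y)) [IsFiniteMeasure π] (S : Set (X × Y)) (z : X × Y) :
    ∫⁻ z', hcost p (z, z') ∂(gl π S) = ∫⁻ z' in S, hcost p (z, z') ∂π := by
  unfold hcost
  rw [lintegral_add_left (by fun_prop), lintegral_add_left (by fun_prop)]
  congr 1
  · rw [← lintegral_map (f := fun x => edist z.1 x ^ p) (by fun_prop) measurable_fst, gl_fst,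
      lintegral_map (by fun_prop) measurable_fst]
  · rw [← lintegral_map (f := fun x => edist z.2 x ^ p) (by fun_prop) measurable_snd, gl_snd,
      lintegral_map (by fun_prop) measurable_snd]

/-- finite cost between any two couplings (product coupling) -/
lemma hcost_prod_fin {p : ℝ} (hp : 1 ≤ p) {π π' : Measure (X × Y)}
    [IsProbabilityMeasure π] [IsProbabilityMeasure π'] (z₀ : X × Y)
    (h : ∫⁻ z, hcost p (z, z₀) ∂π ≠ ⊤) (h' : ∫⁻ z, hcost p (z, z₀) ∂π' ≠ ⊤) :
    ∫⁻ z, hcost p z ∂(π.prod π') ≠ ⊤ := by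
  have hm : Measurable (fun z : X × Y => hcost p (z, z₀)) :=
    (hcost_meas p).comp (by fun_prop)
  rw [lintegral_prod _ (hcost_meas p).aemeasurable]
  refine ne_top_of_le_ne_top (b := ∫⁻ z, ∫⁻ z',
    2 ^ (p - 1) * (hcost p (z, z₀) + hcost p (z', z₀)) ∂π' ∂π) ?_
    (lintegral_mono fun z => lintegral_mono fun z' => hcost_triangle hp z z' z₀)
  have : ∀ z, ∫⁻ z', 2 ^ (p - 1) * (hcost p (z, z₀) + hcost p (z', z₀)) ∂π'
      = 2 ^ (p - 1) * (hcost p (z, z₀) + ∫⁻ z', hcost p (z', z₀) ∂π') := by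
    intro z
    rw [lintegral_const_mul _ (by fun_prop), lintegral_add_left (by fun_prop)]
    simp
  simp_rw [this]
  rw [lintegral_const_mul _ (by fun_prop), lintegral_add_left (by fun_prop)]
  refine ENNReal.mul_ne_top (ENNReal.rpow_ne_top_of_nonneg (by linarith) (by simp)) ?_
  simpa using ⟨h, h'⟩

lemma piece_cost (p : ℝ) (π : Measure (X × Y)) [IsFiniteMeasure π] (S : Set (X × Y)) :
    ∫⁻ z, hcost p z ∂((π S)⁻¹ • (π.restrict S).prod (gl π S)) =
      (π S)⁻¹ * ∫⁻ z in S, ∫⁻ z' in S, hcost p (z, z') ∂π ∂π := by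
  rw [lintegral_smul_measure, lintegral_prod _ (hcost_meas p).aemeasurable]
  simp_rw [hcost_gl]
  rfl

lemma piece_cost_small (p : ℝ) (π : Measure (X × Y)) [IsFiniteMeasure π] {S : Set (X × Y)}
    (hS : MeasurableSet S) (A : ℝ≥0∞) (hA : ∀ z ∈ S, ∀ z' ∈ S, hcost p (z, z') ≤ A) :
    ∫⁻ z, hcost p z ∂((π S)⁻¹ • (π.restrict S).prod (gl π S)) ≤ A * π S := by
  rw [piece_cost]
  have : ∫⁻ z in S, ∫⁻ z' in S, hcost p (z, z') ∂π ∂π ≤ ∫⁻ z in S, ∫⁻ z' in S, A ∂π ∂π :=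
    setLIntegral_mono' hS fun z hz => setLIntegral_mono' hS fun z' hz' => hA z hz z' hz'
  refine le_trans (mul_le_mul_right this _) ?_
  simp only [lintegral_const, Measure.restrict_apply MeasurableSet.univ, Set.univ_inter]
  by_cases h : π S = 0
  · simp [h]
  · rw [mul_comm, mul_assoc, ENNReal.mul_inv_cancel h (measure_ne_top _ _), mul_one]

lemma piece_cost_gen {p : ℝ} (hp : 1 ≤ p) (π : Measure (X × Y)) [IsFiniteMeasure π]
    (S : Set (X × Y)) (z₀ : X × Y) :
    ∫⁻ z, hcost p z ∂((π S)⁻¹ • (π.restrict S).prod (gl π S)) ≤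
      2 ^ p * ∫⁻ z in S, hcost p (z, z₀) ∂π := by
  have hm : Measurable (fun z : X × Y => hcost p (z, z₀)) :=
    (hcost_meas p).comp (by fun_prop)
  rw [piece_cost]
  have : ∫⁻ z in S, ∫⁻ z' in S, hcost p (z, z') ∂π ∂π ≤ ∫⁻ z in S, ∫⁻ z' in S,
      2 ^ (p - 1) * (hcost p (z, z₀) + hcost p (z', z₀)) ∂π ∂π :=
    lintegral_mono fun z => lintegral_mono fun z' => hcost_triangle hp z z' z₀
  refine le_trans (mul_le_mul_right this _) ?_
  have : ∀ z, ∫⁻ z' in S, 2 ^ (p - 1) * (hcost p (z, z₀) + hcost p (z', z₀)) ∂π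
      = 2 ^ (p - 1) * (hcost p (z, z₀) * π S + ∫⁻ z' in S, hcost p (z', z₀) ∂π) := by
    intro z
    rw [lintegral_const_mul _ (by fun_prop), lintegral_add_left (by fun_prop)]
    simp
  simp_rw [this]
  rw [lintegral_const_mul _ (by fun_prop), lintegral_add_left (by fun_prop),
    lintegral_mul_const _ hm]
  simp only [lintegral_const, Measure.restrict_apply MeasurableSet.univ, Set.univ_inter]
  by_cases h : π S = 0
  · simp [h, Measure.restrict_eq_zero.2 h]
  have h2 : (2 : ℝ≥0∞) ^ p = 2 ^ (p - 1) * 2 := by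
    conv_rhs => rw [← ENNReal.rpow_one 2, ← ENNReal.rpow_mul, ← ENNReal.rpow_add _ _ (by simp) (by simp)]
    simp
  rw [h2]
  set I := ∫⁻ z in S, hcost p (z, z₀) ∂π
  apply le_of_eq
  calc (π S)⁻¹ * (2 ^ (p - 1) * (I * π S + I * π S)) = 2 ^ (p-1) * 2 * I * (π S * (π S)⁻¹) := by ring
    _ = _ := by rw [ENNReal.mul_inv_cancel h (measure_ne_top _ _), mul_one]

end cost

lemma approx {X Y : Type*} [PseudoMetricSpace X] [SecondCountableTopology X]
    [MeasurableSpace X] [BorelSpace X]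
    [PseudoMetricSpace Y] [SecondCountableTopology Y] [MeasurableSpace Y] [BorelSpace Y]
    {p : ℝ} (hp : 1 ≤ p) (μ : Measure X) (ν : Measure Y) [IsProbabilityMeasure μ]
    [IsProbabilityMeasure ν] (π : Measure (X × Y)) [IsProbabilityMeasure π]
    (h : IsCoupling π μ ν) (z₀ : X × Y) (hz : ∫⁻ z, hcost p (z, z₀) ∂π ≠ ⊤)
    (e : ℝ) (he : 0 < e) (he1 : e ≤ 1) :
    ∃ π' : Measure (X × Y), IsCoupling π' μ ν ∧
      (∃ M : ℝ≥0∞, M ≠ ⊤ ∧ π' ≤ M • μ.prod ν) ∧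
      ∃ γ, IsCoupling γ π π' ∧ ∫⁻ z, hcost p z ∂γ ≤ ENNReal.ofReal e := by
  have : Nonempty (X × Y) := ⟨z₀⟩
  set B : ℕ → Set (X × Y) := fun j => Metric.ball (TopologicalSpace.denseSeq (X × Y) j) (e / 8)
    with hB
  have hBm : ∀ j, MeasurableSet (B j) := fun j => Metric.isOpen_ball.measurableSet
  have hBu : ⋃ j, B j = Set.univ := by
    refine Set.eq_univ_of_forall fun z => ?_
    obtain ⟨j, hj⟩ := (TopologicalSpace.denseRange_denseSeq (X × Y)).exists_dist_lt z
      (show 0 < e / 8 by positivity)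
    exact Set.mem_iUnion.2 ⟨j, hj⟩
  set R : ℕ → Set (X × Y) := fun N => (⋃ j ∈ Finset.range N, B j)ᶜ with hR
  have hRm : ∀ N, MeasurableSet (R N) := fun N =>
    (Finset.measurableSet_biUnion _ fun j _ => hBm j).compl
  have hRanti : Antitone R := by
    intro a b hab
    refine Set.compl_subset_compl.2 (Set.biUnion_subset_biUnion_left ?_)
    intro j hj
    simp at hj ⊢
    omega
  have hRlim : Tendsto (π ∘ R) atTop (𝓝 0) := by
    have := tendsto_measure_iInter_atTop (μ := π) (s := R)
      (fun i => (hRm i).nullMeasurableSet) hRanti ⟨0, measure_ne_top _ _⟩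
    have h0 : ⋂ n, R n = ∅ := by
      refine Set.eq_empty_of_forall_notMem fun z hz => ?_
      obtain ⟨j, hj⟩ := Set.mem_iUnion.1 (hBu.symm ▸ Set.mem_univ z : z ∈ ⋃ j, B j)
      have := Set.mem_iInter.1 hz (j + 1)
      apply this
      exact Set.mem_biUnion (by simp) hj
    rw [h0, measure_empty] at this
    exact this
  have hIlim := (ENNReal.Tendsto.const_mul (a := (2:ℝ≥0∞) ^ p) (tendsto_setLIntegral_zero hz hRlim)
    (Or.inr (ENNReal.rpow_ne_top_of_nonneg (by linarith) (by simp))))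
  rw [mul_zero] at hIlim
  obtain ⟨N, hN⟩ := (hIlim.eventually_lt_const
    (show (0 : ℝ≥0∞) < ENNReal.ofReal (e / 2) by simpa using he)).exists
  set E : ℕ → Set (X × Y) := disjointed (fun j => if j < N then B j else Set.univ) with hEdef
  have hEm : ∀ j, MeasurableSet (E j) := by
    refine fun j => MeasurableSet.disjointed (fun j => ?_) j
    split_ifs
    · exact hBm j
    · exact MeasurableSet.univ
  have hEsub : ∀ j < N, E j ⊆ B j := by
    intro j hj
    refine (disjointed_subset _ j).trans ?_
    simp [hj]
  have hEN : E N ⊆ R N := by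
    intro z hz
    rw [hEdef, disjointed_apply] at hz
    simp only [lt_irrefl, if_false] at hz
    simp only [hR, Set.mem_compl_iff, Set.mem_iUnion, not_exists]
    intro j hj hzj
    rw [Finset.mem_range] at hj
    apply hz.2
    rw [Finset.sup_set_eq_biUnion]
    refine Set.mem_biUnion (x := j) (by simpa using hj) ?_
    simpa [hj] using hzj
  have hEU : ⋃ j ∈ Finset.range (N + 1), E j = Set.univ := by
    have := biUnion_range_succ_disjointed (fun j => if j < N then B j else Set.univ) N
    rw [hEdef, this]
    refine Set.eq_univ_of_univ_subset ?_
    refine le_trans ?_ (le_partialSups _ N)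
    simp
  have hE : π = ∑ i ∈ Finset.range (N + 1), π.restrict (E i) := by
    have hd : Pairwise (Function.onFun Disjoint E) := disjoint_disjointed _
    have := Measure.restrict_biUnion_finset (μ := π) (s := E) (T := Finset.range (N + 1)) 
      (fun i _ j _ hij => hd hij) (fun b => hEm b)
    rw [hEU, Measure.restrict_univ] at this
    rw [← Measure.sum_coe_finset, ← this]
  refine ⟨_, block_coupling π (Finset.range (N + 1)) E μ ν h hE, block_le π _ E μ ν h hE,
    _, blockGamma_coupling π _ E hE, ?_⟩
  rw [blockGamma, lintegral_finsetSum_measure, Finset.sum_range_succ]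
  have hA : ∀ i < N, ∀ z ∈ E i, ∀ z' ∈ E i, hcost p (z, z') ≤ ENNReal.ofReal (e / 2) := by
    intro i hi z hz z' hz'
    have hd : dist z z' ≤ e / 4 := by
      have h1 : dist z _ < e / 8 := hEsub i hi hz
      have h2 : dist z' _ < e / 8 := hEsub i hi hz'
      have := dist_triangle_right z z' (TopologicalSpace.denseSeq (X × Y) i)
      linarith
    have hed : edist z z' ≤ ENNReal.ofReal (e / 4) := by
      rw [edist_dist]; exact ENNReal.ofReal_le_ofReal hd
    have key : ∀ t : ℝ≥0∞, t ≤ edist z z' → t ^ p ≤ ENNReal.ofReal (e / 4) := by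
      intro t ht
      have ht1 : t ≤ ENNReal.ofReal (e / 4) := ht.trans hed
      have ht2 : t ≤ 1 := ht1.trans (by rw [ENNReal.ofReal_le_one]; linarith)
      refine le_trans ?_ ht1
      simpa using ENNReal.rpow_le_rpow_of_exponent_ge ht2 hp
    unfold hcost
    have := add_le_add (key (edist z.1 z'.1) (by rw [Prod.edist_eq]; exact le_max_left _ _))
      (key (edist z.2 z'.2) (by rw [Prod.edist_eq]; exact le_max_right _ _))
    refine this.trans ?_
    rw [← ENNReal.ofReal_add (by positivity) (by positivity)]
    exact ENNReal.ofReal_le_ofReal (by linarith)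
  have h1 : ∑ i ∈ Finset.range N,
      ∫⁻ z, hcost p z ∂((π (E i))⁻¹ • (π.restrict (E i)).prod (gl π (E i))) ≤
      ENNReal.ofReal (e / 2) := by
    refine (Finset.sum_le_sum fun i hi => piece_cost_small p π (hEm i) _
      (hA i (Finset.mem_range.1 hi))).trans ?_
    rw [← Finset.mul_sum]
    refine mul_le_of_le_one_right' ?_
    have := congrArg (fun m : Measure _ => m Set.univ) hE
    simp only [measure_univ, Finset.sum_range_succ, Measure.coe_add, Pi.add_apply,
      Measure.coe_finsetSum, Finset.sum_apply, Measure.restrict_apply MeasurableSet.univ,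
      Set.univ_inter] at this
    rw [this]
    exact le_self_add
  have h2 := (piece_cost_gen hp π (E N) z₀).trans
    ((mul_le_mul_right (lintegral_mono_set hEN) _).trans hN.le)
  refine (add_le_add h1 h2).trans ?_
  rw [← ENNReal.ofReal_add (by positivity) (by positivity)]
  exact ENNReal.ofReal_le_ofReal (by linarith)

lemma exists_diag (D : ℕ → ℝ≥0∞) (hD : ∀ n, D n ≠ ⊤) (ε : ℕ → ℝ)
    (hε : Tendsto ε atTop (𝓝 0)) :
    ∃ n : ℕ → ℕ, Tendsto n atTop atTop ∧
      Tendsto (fun k => ENNReal.ofReal (ε k) * D (n k)) atTop (𝓝 0) := by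
  set P : ℕ → ℕ → Prop := fun k n => ENNReal.ofReal (ε k) * D n ≤ ((n : ℝ≥0∞))⁻¹ with hP
  have hev : ∀ n, ∀ᶠ k in atTop, P k n := by
    intro n
    have h1 : Tendsto (fun k => ENNReal.ofReal (ε k)) atTop (𝓝 0) := by
      simpa using ENNReal.tendsto_ofReal hε
    have h2 := ENNReal.Tendsto.mul_const h1 (Or.inr (hD n))
    rw [zero_mul] at h2
    filter_upwards [h2.eventually_lt_const (show (0 : ℝ≥0∞) < (n : ℝ≥0∞)⁻¹ by simp)] with k hk
    exact hk.le
  refine ⟨fun k => Nat.findGreatest (P k) k, ?_, ?_⟩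
  · refine tendsto_atTop.2 fun n => ?_
    filter_upwards [hev n, eventually_ge_atTop n] with k hk hnk
    exact Nat.le_findGreatest hnk hk
  · have hn : Tendsto (fun k => Nat.findGreatest (P k) k) atTop atTop := by
      refine tendsto_atTop.2 fun n => ?_
      filter_upwards [hev n, eventually_ge_atTop n] with k hk hnk
      exact Nat.le_findGreatest hnk hk
    refine tendsto_of_tendsto_of_tendsto_of_le_of_le' tendsto_const_nhds
      (ENNReal.tendsto_inv_nat_nhds_zero.comp hn) (by simp) ?_
    filter_upwards [hn.eventually_ge_atTop 1] with k hk
    exact Nat.findGreatest_of_ne_zero (P := P k) (n := k) rfl (by omega)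

/-- bundling -/
def mkPM {Z : Type*} [MeasurableSpace Z] (μ : Measure Z) (h : IsProbabilityMeasure μ) :
    ProbabilityMeasure Z := ⟨μ, h⟩

lemma mkPM_coe {Z : Type*} [MeasurableSpace Z] (μ : Measure Z) (h : IsProbabilityMeasure μ) :
    ((mkPM μ h : ProbabilityMeasure Z) : Measure Z) = μ := rfl

lemma narrow_iff {Z : Type*} [MeasurableSpace Z] [TopologicalSpace Z] [OpensMeasurableSpace Z]
    (πs : ℕ → Measure Z) (π : Measure Z) (hs : ∀ k, IsProbabilityMeasure (πs k))
    (h : IsProbabilityMeasure π) :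
    NarrowTendsto πs π ↔ Tendsto (fun k => mkPM (πs k) (hs k)) atTop (𝓝 (mkPM π h)) := by
  rw [ProbabilityMeasure.tendsto_iff_forall_integral_tendsto]
  rfl

section narrow
variable {X Y : Type*} [PseudoMetricSpace X] [SecondCountableTopology X]
    [MeasurableSpace X] [BorelSpace X]
    [PseudoMetricSpace Y] [SecondCountableTopology Y] [MeasurableSpace Y] [BorelSpace Y]

lemma narrow_of_cost
    {p : ℝ} (hp : 1 ≤ p) (π : Measure (X × Y)) [IsProbabilityMeasure π]
    (πs : ℕ → Measure (X × Y)) [hs : ∀ k, IsProbabilityMeasure (πs k)]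
    (γ : ℕ → Measure ((X × Y) × (X × Y))) (hγ : ∀ k, IsCoupling (γ k) π (πs k))
    (a : ℕ → ℝ≥0∞) (ha : Tendsto a atTop (𝓝 0))
    (hc : ∀ k, ∫⁻ z, hcost p z ∂(γ k) ≤ a k) : NarrowTendsto πs π := by
  rw [narrow_iff πs π hs inferInstance, tendsto_iff_forall_lipschitz_integral_tendsto]
  rintro f ⟨B, hB⟩ ⟨K, hK⟩
  simp only [mkPM_coe]
  have hp0 : 0 < p := by linarith
  have hγp : ∀ k, IsProbabilityMeasure (γ k) := fun k => ⟨by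
    have := congrArg (fun m : Measure _ => m Set.univ) (hγ k).1
    simpa [Measure.map_apply measurable_fst MeasurableSet.univ] using this⟩
  have hfc : Continuous f := hK.continuous
  have hint : ∀ (m : Measure (X × Y)) [IsProbabilityMeasure m], Integrable f m := by
    intro m _
    have hne : Nonempty (X × Y) := nonempty_of_isProbabilityMeasure m
    obtain ⟨z₀⟩ := hne
    refine Integrable.of_bound hfc.aestronglyMeasurable (‖f z₀‖ + B) (ae_of_all _ fun z => ?_)
    have := hB z z₀
    rw [Real.dist_eq] at this
    have h2 := norm_add_le (f z - f z₀) (f z₀)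
    simp only [sub_add_cancel] at h2
    rw [Real.norm_eq_abs (f z - f z₀)] at h2
    linarith
  rw [tendsto_iff_edist_tendsto_0]
  have key : ∀ k, edist (∫ z, f z ∂(πs k)) (∫ z, f z ∂π) ≤ K * (a k) ^ (1 / p) := by
    intro k
    have h1 : ∫ z, f z ∂π = ∫ z, f z.1 ∂(γ k) := by
      conv_lhs => rw [← (hγ k).1]
      exact integral_map measurable_fst.aemeasurable hfc.aestronglyMeasurable
    have h2 : ∫ z, f z ∂(πs k) = ∫ z, f z.2 ∂(γ k) := by
      conv_lhs => rw [← (hγ k).2]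
      exact integral_map measurable_snd.aemeasurable hfc.aestronglyMeasurable
    have i1 : Integrable (fun z : (X × Y) × (X × Y) => f z.1) (γ k) := by
      have := hint π
      rw [← (hγ k).1] at this
      exact this.comp_measurable measurable_fst
    have i2 : Integrable (fun z : (X × Y) × (X × Y) => f z.2) (γ k) := by
      have := hint (πs k)
      rw [← (hγ k).2] at this
      exact this.comp_measurable measurable_snd
    rw [h1, h2, edist_eq_enorm_sub, ← integral_sub i2 i1]
    refine (enorm_integral_le_lintegral_enorm _).trans ?_
    have hn := eLpNorm'_le_eLpNorm'_of_exponent_le (f := fun z : (X × Y) × (X × Y) => f z.2 - f z.1)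
      one_pos hp (γ k) (i2.sub i1).aestronglyMeasurable
    simp only [eLpNorm', ENNReal.rpow_one, div_one] at hn
    refine hn.trans ?_
    have hle : ∫⁻ z, ‖f z.2 - f z.1‖ₑ ^ p ∂(γ k) ≤ (K : ℝ≥0∞) ^ p * a k := by
      refine le_trans ?_ (mul_le_mul_right (hc k) _)
      rw [← lintegral_const_mul _ (hcost_meas p)]
      refine lintegral_mono fun z => ?_
      rw [← edist_eq_enorm_sub, edist_comm]
      refine (ENNReal.rpow_le_rpow (hK z.1 z.2) hp0.le).trans ?_
      rw [ENNReal.mul_rpow_of_nonneg _ _ hp0.le]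
      exact mul_le_mul_right (edist_pow_le_hcost hp z.1 z.2) _
    refine (ENNReal.rpow_le_rpow hle (by positivity)).trans (le_of_eq ?_)
    rw [ENNReal.mul_rpow_of_nonneg _ _ (by positivity), ← ENNReal.rpow_mul,
      mul_one_div_cancel hp0.ne', ENNReal.rpow_one]
  have hlim : Tendsto (fun k => (K : ℝ≥0∞) * (a k) ^ (1 / p)) atTop (𝓝 0) := by
    have := ENNReal.Tendsto.const_mul (a := (K : ℝ≥0∞)) (ha.ennrpow_const (1 / p))
      (Or.inr ENNReal.coe_ne_top)
    rwa [ENNReal.zero_rpow_of_pos (by positivity), mul_zero] at this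
  exact tendsto_of_tendsto_of_tendsto_of_le_of_le tendsto_const_nhds hlim (fun _ => zero_le) key

lemma wp_self {p : ℝ} (hp : 1 ≤ p) (μ : Measure X) : Wp p μ μ = 0 := by
  refine le_antisymm ?_ zero_le
  have hm : Measurable (fun x : X => (x, x)) := by fun_prop
  have hcp : IsCoupling (μ.map fun x => (x, x)) μ μ := by
    refine ⟨?_, ?_⟩
    · rw [Measure.map_map measurable_fst hm]; exact Measure.map_id
    · rw [Measure.map_map measurable_snd hm]; exact Measure.map_id
  refine (iInf₂_le (μ.map fun x => (x, x)) hcp).trans ?_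
  rw [lintegral_map (by fun_prop) hm]
  have h0 : (0 : ℝ≥0∞) ^ p = 0 := ENNReal.zero_rpow_of_pos (by linarith)
  have h1 : (0 : ℝ≥0∞) ^ p⁻¹ = 0 := ENNReal.zero_rpow_of_pos (by positivity)
  simp [h0, h1]

lemma condA_apply {p L C : ℝ} (hp : 1 ≤ p) (hL : 0 ≤ L) {c : X × Y → ℝ}
    {μ : Measure X} {ν : Measure Y} [IsProbabilityMeasure μ] [IsProbabilityMeasure ν]
    (hm₁ : HasFiniteMoment p μ) (hm₂ : HasFiniteMoment p ν) (hA : CondA p L C c μ ν)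
    {π π' : Measure (X × Y)} (h : IsCoupling π μ ν) (h' : IsCoupling π' μ ν)
    {γ : Measure ((X × Y) × (X × Y))} (hγ : IsCoupling γ π π') {a : ℝ≥0∞} (ha : a ≠ ⊤)
    (hc : ∫⁻ z, hcost p z ∂γ ≤ a) :
    |(∫ z, c z ∂π) - ∫ z, c z ∂π'| ≤ L * (a ^ (1 / p)).toReal := by
  refine (hA μ ν inferInstance inferInstance hm₁ hm₂ (by rw [wp_self hp]; exact zero_le)
    (by rw [wp_self hp]; exact zero_le) π h π' h').trans ?_
  refine mul_le_mul_of_nonneg_left ?_ hL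
  have hp1 : 0 ≤ 1 / p := by positivity
  refine ENNReal.toReal_mono (ENNReal.rpow_ne_top_of_nonneg hp1 ha) ?_
  exact (iInf₂_le γ hγ).trans (ENNReal.rpow_le_rpow hc hp1)

lemma zero_of_top {p L C : ℝ} (hp : 1 ≤ p) (hL : 0 ≤ L) {c : X × Y → ℝ} (hcc : Continuous c)
    (hc0 : ∀ z, 0 ≤ c z)
    {μ : Measure X} {ν : Measure Y} [IsProbabilityMeasure μ] [IsProbabilityMeasure ν]
    (hm₁ : HasFiniteMoment p μ) (hm₂ : HasFiniteMoment p ν) (hA : CondA p L C c μ ν)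
    {π π' : Measure (X × Y)} [IsProbabilityMeasure π] [IsProbabilityMeasure π']
    (h : IsCoupling π μ ν) (h' : IsCoupling π' μ ν)
    (hfin : ∫⁻ z, ENNReal.ofReal (c z) ∂π ≠ ⊤) (htop : ∫⁻ z, ENNReal.ofReal (c z) ∂π' = ⊤) :
    ∫⁻ z, ENNReal.ofReal (c z) ∂π = 0 := by
  have hp0 : 0 < p := by linarith
  obtain ⟨x₀, hx₀⟩ := hm₁
  obtain ⟨y₀, hy₀⟩ := hm₂
  set K := ∫⁻ z, hcost p z ∂(π.prod π') with hKdef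
  have hK : K ≠ ⊤ := hcost_prod_fin hp (x₀, y₀)
    (by rw [hcost_coupling p h]; exact ENNReal.add_ne_top.2 ⟨hx₀, hy₀⟩)
    (by rw [hcost_coupling p h']; exact ENNReal.add_ne_top.2 ⟨hx₀, hy₀⟩)
  have hm : Measurable (fun x : X × Y => (x, x)) := by fun_prop
  have hI : ∫ z, c z ∂π = (∫⁻ z, ENNReal.ofReal (c z) ∂π).toReal :=
    integral_eq_lintegral_of_nonneg_ae (ae_of_all _ hc0) hcc.aestronglyMeasurable
  have key : ∀ n : ℕ, ∫ z, c z ∂π ≤ L * (((((n + 1 : ℕ) : ℝ≥0∞)⁻¹ * K) ^ (1 / p))).toReal := by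
    intro n
    set t : ℝ≥0∞ := ((n + 1 : ℕ) : ℝ≥0∞)⁻¹ with ht
    have ht0 : t ≠ 0 := by simp [ht]
    have htt : t ≠ ⊤ := by simp [ht]
    have ht1 : t ≤ 1 := by
      rw [ht, ENNReal.inv_le_one]; exact_mod_cast Nat.succ_le_succ (Nat.zero_le n)
    have hadd : (1 - t) + t = 1 := tsub_add_cancel_of_le ht1
    set ρ := (1 - t) • π + t • π' with hρ
    have hρc : IsCoupling ρ μ ν := by
      constructor
      · rw [hρ, Measure.map_add _ _ measurable_fst, Measure.map_smul, Measure.map_smul, h.1, h'.1,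
          ← add_smul, hadd, one_smul]
      · rw [hρ, Measure.map_add _ _ measurable_snd, Measure.map_smul, Measure.map_smul, h.2, h'.2,
          ← add_smul, hadd, one_smul]
    set γ := (1 - t) • π.map (fun z => (z, z)) + t • π.prod π' with hγ
    have hγc : IsCoupling γ π ρ := by
      constructor
      · rw [hγ, Measure.map_add _ _ measurable_fst, Measure.map_smul, Measure.map_smul,
          Measure.map_map measurable_fst hm, Measure.map_fst_prod]
        simp only [measure_univ, one_smul]
        have : Prod.fst ∘ (fun z : X × Y => (z, z)) = id := rfl
        rw [this, Measure.map_id, ← add_smul, hadd, one_smul]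
      · rw [hγ, Measure.map_add _ _ measurable_snd, Measure.map_smul, Measure.map_smul,
          Measure.map_map measurable_snd hm, Measure.map_snd_prod]
        simp only [measure_univ, one_smul]
        have : Prod.snd ∘ (fun z : X × Y => (z, z)) = id := rfl
        rw [this, Measure.map_id]
    have hcost : ∫⁻ z, hcost p z ∂γ ≤ t * K := by
      rw [hγ, lintegral_add_measure, lintegral_smul_measure, lintegral_smul_measure,
        lintegral_map (hcost_meas p) hm]
      have h0 : (0 : ℝ≥0∞) ^ p = 0 := ENNReal.zero_rpow_of_pos (by linarith)
      simp [hcost, h0, hKdef]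
    have := condA_apply hp hL ⟨x₀, hx₀⟩ ⟨y₀, hy₀⟩ hA h hρc hγc (ENNReal.mul_ne_top htt hK) hcost
    have hz : ∫ z, c z ∂ρ = 0 := by
      rw [integral_eq_lintegral_of_nonneg_ae (ae_of_all _ hc0) hcc.aestronglyMeasurable, hρ,
        lintegral_add_measure, lintegral_smul_measure, lintegral_smul_measure, htop]
      simp [ENNReal.mul_top ht0]
    rw [hz, sub_zero] at this
    exact (le_abs_self _).trans this
  have hlim : Tendsto (fun n : ℕ => L * (((((n + 1 : ℕ) : ℝ≥0∞)⁻¹ * K) ^ (1 / p))).toReal)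
      atTop (𝓝 0) := by
    have h1 : Tendsto (fun n : ℕ => ((n + 1 : ℕ) : ℝ≥0∞)⁻¹ * K) atTop (𝓝 0) := by
      have := ENNReal.Tendsto.mul_const
        (ENNReal.tendsto_inv_nat_nhds_zero.comp (tendsto_add_atTop_nat 1)) (Or.inr hK)
      rwa [zero_mul] at this
    have h2 := h1.ennrpow_const (1 / p)
    rw [ENNReal.zero_rpow_of_pos (by positivity)] at h2
    have h3 := ((ENNReal.tendsto_toReal (by simp)).comp h2).const_mul L
    simpa using h3
  have h0 := ge_of_tendsto' hlim key
  rw [hI] at h0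
  have : (∫⁻ z, ENNReal.ofReal (c z) ∂π).toReal = 0 := le_antisymm h0 ENNReal.toReal_nonneg
  exact ((ENNReal.toReal_eq_zero_iff _).1 this).resolve_right hfin

lemma coupling_prob {μ : Measure X} {ν : Measure Y} [IsProbabilityMeasure μ]
    {π : Measure (X × Y)} (h : IsCoupling π μ ν) : IsProbabilityMeasure π := ⟨by
  have := congrArg (fun m : Measure _ => m Set.univ) h.1
  simpa [Measure.map_apply measurable_fst MeasurableSet.univ] using this⟩
end narrow

section main
variable {X Y : Type*} [MetricSpace X] [SecondCountableTopology X] [CompleteSpace X]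
    [MeasurableSpace X] [BorelSpace X]
    [MetricSpace Y] [SecondCountableTopology Y] [CompleteSpace Y]
    [MeasurableSpace Y] [BorelSpace Y]

lemma zero_on_compact {p L C : ℝ} (hp : 1 ≤ p) (hL : 0 ≤ L) {c : X × Y → ℝ} (hcc : Continuous c)
    (hc0 : ∀ z, 0 ≤ c z)
    {μ : Measure X} {ν : Measure Y} [IsProbabilityMeasure μ] [IsProbabilityMeasure ν]
    (hm₁ : HasFiniteMoment p μ) (hm₂ : HasFiniteMoment p ν) (hA : CondA p L C c μ ν)
    {π π' : Measure (X × Y)} [IsProbabilityMeasure π] [IsProbabilityMeasure π']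
    (h : IsCoupling π μ ν) (h' : IsCoupling π' μ ν)
    (hfin : ∫⁻ z, ENNReal.ofReal (c z) ∂π ≠ ⊤) (htop : ∫⁻ z, ENNReal.ofReal (c z) ∂π' = ⊤)
    {S : Set (X × Y)} (hS : IsCompact S) :
    (π.prod π) ((S ×ˢ S) ∩ {w | c (w.1.1, w.2.2) ≠ 0}) = 0 := by
  by_cases hS0 : π S = 0
  · refine measure_mono_null Set.inter_subset_left ?_
    rw [Measure.prod_prod, hS0, zero_mul]
  have hSm : MeasurableSet S := hS.measurableSet
  set ρ := π.restrict Sᶜ + gl π S with hρ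
  have hρc : IsCoupling ρ μ ν := by
    constructor
    · rw [hρ, Measure.map_add _ _ measurable_fst, gl_fst, ← Measure.map_add _ _ measurable_fst,
        Measure.restrict_compl_add_restrict hSm, h.1]
    · rw [hρ, Measure.map_add _ _ measurable_snd, gl_snd, ← Measure.map_add _ _ measurable_snd,
        Measure.restrict_compl_add_restrict hSm, h.2]
  have hρp : IsProbabilityMeasure ρ := coupling_prob hρc
  have hK : IsCompact ((Prod.fst '' S) ×ˢ (Prod.snd '' S)) :=
    (hS.image continuous_fst).prod (hS.image continuous_snd)
  obtain ⟨B, hB⟩ := (hK.image hcc).bddAbove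
  have hmap : ((π.restrict S).map Prod.fst).prod ((π.restrict S).map Prod.snd)
      = ((π.prod π).restrict (S ×ˢ S)).map (Prod.map Prod.fst Prod.snd) := by
    rw [Measure.map_prod_map _ _ measurable_fst measurable_snd, Measure.prod_restrict]
  have hmm : Measurable (Prod.map Prod.fst Prod.snd : (X × Y) × (X × Y) → X × Y) :=
    measurable_fst.prodMap measurable_snd
  have hcm : Measurable fun z => ENNReal.ofReal (c z) := hcc.measurable.ennreal_ofReal
  have hglI : ∫⁻ z, ENNReal.ofReal (c z) ∂(gl π S) =
      (π S)⁻¹ * ∫⁻ w in S ×ˢ S, ENNReal.ofReal (c (w.1.1, w.2.2)) ∂(π.prod π) := by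
    rw [gl, lintegral_smul_measure, hmap, lintegral_map hcm hmm]
    rfl
  have hglfin : ∫⁻ z, ENNReal.ofReal (c z) ∂(gl π S) ≠ ⊤ := by
    rw [hglI]
    refine ENNReal.mul_ne_top (by simpa using hS0) ?_
    refine ne_top_of_le_ne_top (b := ∫⁻ w in S ×ˢ S, ENNReal.ofReal B ∂(π.prod π)) ?_
      (setLIntegral_mono' (hSm.prod hSm) fun w hw => ENNReal.ofReal_le_ofReal ?_)
    · rw [lintegral_const]
      exact ENNReal.mul_ne_top ENNReal.ofReal_ne_top (measure_ne_top _ _)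
    · exact hB ⟨(w.1.1, w.2.2), ⟨⟨w.1, hw.1, rfl⟩, ⟨w.2, hw.2, rfl⟩⟩, rfl⟩
  have hρfin : ∫⁻ z, ENNReal.ofReal (c z) ∂ρ ≠ ⊤ := by
    rw [hρ, lintegral_add_measure]
    exact ENNReal.add_ne_top.2 ⟨ne_top_of_le_ne_top hfin (setLIntegral_le_lintegral _ _), hglfin⟩
  have hz := zero_of_top hp hL hcc hc0 hm₁ hm₂ hA hρc h' hρfin htop
  rw [hρ, lintegral_add_measure, add_eq_zero, hglI, mul_eq_zero] at hz
  have hz2 := hz.2.resolve_left (by simp)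
  rw [lintegral_eq_zero_iff (by fun_prop)] at hz2
  have hz3 := (ae_restrict_iff' (hSm.prod hSm)).1 hz2
  refine measure_mono_null ?_ (ae_iff.1 hz3)
  rintro w ⟨hw1, hw2⟩ hw3
  have := hw3 hw1
  simp only [Pi.zero_apply, ENNReal.ofReal_eq_zero] at this
  exact hw2 (le_antisymm this (hc0 _))

lemma ac_fin {p L C : ℝ} (hp : 1 ≤ p) (hL : 0 ≤ L) {c : X × Y → ℝ} (hcc : Continuous c)
    (hc0 : ∀ z, 0 ≤ c z)
    {μ : Measure X} {ν : Measure Y} [IsProbabilityMeasure μ] [IsProbabilityMeasure ν]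
    (hm₁ : HasFiniteMoment p μ) (hm₂ : HasFiniteMoment p ν) (hA : CondA p L C c μ ν)
    {π π' : Measure (X × Y)} [IsProbabilityMeasure π] [IsProbabilityMeasure π']
    (h : IsCoupling π μ ν) (h' : IsCoupling π' μ ν)
    (hfin : ∫⁻ z, ENNReal.ofReal (c z) ∂π ≠ ⊤) (hac : π' ≪ μ.prod ν) :
    ∫⁻ z, ENNReal.ofReal (c z) ∂π' ≠ ⊤ := by
  intro htop
  have hN : (π.prod π) {w | c (w.1.1, w.2.2) ≠ 0} = 0 := by
    refine le_antisymm ?_ zero_le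
    refine ENNReal.le_of_forall_pos_le_add fun e he _ => ?_
    rw [zero_add]
    obtain ⟨S, hS, hSe⟩ := isTightMeasureSet_iff_exists_isCompact_measure_compl_le.1
      (isTightMeasureSet_singleton (μ := π)) ((e : ℝ≥0∞) / 2)
      (ENNReal.half_pos (by simpa using he.ne'))
    have hSe := hSe π rfl
    have hsub : {w : (X × Y) × (X × Y) | c (w.1.1, w.2.2) ≠ 0} ⊆
        ((S ×ˢ S) ∩ {w | c (w.1.1, w.2.2) ≠ 0}) ∪ (Sᶜ ×ˢ Set.univ ∪ Set.univ ×ˢ Sᶜ) := by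
      intro w hw
      by_cases h1 : w.1 ∈ S
      · by_cases h2 : w.2 ∈ S
        · exact Or.inl ⟨⟨h1, h2⟩, hw⟩
        · exact Or.inr (Or.inr ⟨trivial, h2⟩)
      · exact Or.inr (Or.inl ⟨h1, trivial⟩)
    refine (measure_mono hsub).trans ((measure_union_le _ _).trans ?_)
    rw [zero_on_compact hp hL hcc hc0 hm₁ hm₂ hA h h' hfin htop hS, zero_add]
    refine (measure_union_le _ _).trans ?_
    rw [Measure.prod_prod, Measure.prod_prod, measure_univ, mul_one, one_mul]
    exact (add_le_add hSe hSe).trans (le_of_eq (ENNReal.add_halves _))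
  have hset : MeasurableSet {z : X × Y | c z ≠ 0} :=
    (hcc.measurable (measurableSet_singleton 0)).compl
  have hN2 : (μ.prod ν) {z | c z ≠ 0} = 0 := by
    rw [← h.1, ← h.2, Measure.map_prod_map _ _ measurable_fst measurable_snd,
      Measure.map_apply (measurable_fst.prodMap measurable_snd) hset]
    exact hN
  have hN3 := hac hN2
  have : ∫⁻ z, ENNReal.ofReal (c z) ∂π' = 0 := by
    rw [lintegral_eq_zero_iff hcc.measurable.ennreal_ofReal]
    have : ∀ᵐ z ∂π', c z = 0 := hN3
    filter_upwards [this] with z hz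
    simp [hz]
  rw [this] at htop
  simp at htop

lemma liminf_part {p : ℝ} {c : X × Y → ℝ} (hcc : Continuous c)
    (hc0 : ∀ z, 0 ≤ c z)
    {μ : Measure X} {ν : Measure Y} [IsProbabilityMeasure μ] [IsProbabilityMeasure ν]
    (q : ℝ) (ε : ℕ → ℝ) (πs : ℕ → Measure (X × Y)) (π : Measure (X × Y))
    (hs : ∀ k, IsProbabilityMeasure (πs k)) (hπ : IsProbabilityMeasure π)
    (hn : NarrowTendsto πs π) :
    Flim c μ ν π ≤ liminf (fun k => Freg q (ε k) c μ ν (πs k)) atTop := by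
  by_cases hcp : IsCoupling π μ ν
  · rw [Flim, if_pos hcp]
    refine (lintegral_le_liminf_lintegral_of_forall_isOpen_measure_le_liminf_measure
      (μs := πs) hcc hc0
      fun G hG => ?_).trans (liminf_le_liminf (Eventually.of_forall fun k => ?_))
    · exact ProbabilityMeasure.le_liminf_measure_open_of_tendsto
        ((narrow_iff πs π hs hπ).1 hn) hG
    · rw [Freg]
      split_ifs
      · exact le_self_add
      · exact le_top
  · have hev : ∀ᶠ k in atTop, ¬ IsCoupling (πs k) μ ν := by
      by_contra hf
      have hf : ∃ᶠ k in atTop, IsCoupling (πs k) μ ν := by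
        simpa [Filter.Frequently] using hf
      obtain ⟨φ, hφ, hφc⟩ := extraction_of_frequently_atTop hf
      apply hcp
      constructor
      · have : IsFiniteMeasure (π.map Prod.fst) := Measure.isFiniteMeasure_map _ _
        refine ext_of_forall_integral_eq_of_IsFiniteMeasure fun f => ?_
        rw [integral_map measurable_fst.aemeasurable f.continuous.aestronglyMeasurable]
        have hl := (hn (f.compContinuous ⟨Prod.fst, continuous_fst⟩)).comp hφ.tendsto_atTop
        refine tendsto_nhds_unique hl ?_
        refine tendsto_const_nhds.congr fun k => ?_
        conv_lhs => rw [← (hφc k).1]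
        rw [integral_map measurable_fst.aemeasurable f.continuous.aestronglyMeasurable]
        rfl
      · have : IsFiniteMeasure (π.map Prod.snd) := Measure.isFiniteMeasure_map _ _
        refine ext_of_forall_integral_eq_of_IsFiniteMeasure fun f => ?_
        rw [integral_map measurable_snd.aemeasurable f.continuous.aestronglyMeasurable]
        have hl := (hn (f.compContinuous ⟨Prod.snd, continuous_snd⟩)).comp hφ.tendsto_atTop
        refine tendsto_nhds_unique hl ?_
        refine tendsto_const_nhds.congr fun k => ?_
        conv_lhs => rw [← (hφc k).2]
        rw [integral_map measurable_snd.aemeasurable f.continuous.aestronglyMeasurable]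
        rfl
    have : Tendsto (fun k => Freg q (ε k) c μ ν (πs k)) atTop (𝓝 ⊤) := by
      refine tendsto_const_nhds.congr' ?_
      filter_upwards [hev] with k hk
      rw [Freg, if_neg hk]
    rw [this.liminf_eq]
    exact le_top

lemma limsup_part {p L C : ℝ} (hp : 1 ≤ p) (hL : 0 ≤ L) {c : X × Y → ℝ} (hcc : Continuous c)
    (hc0 : ∀ z, 0 ≤ c z)
    {μ : Measure X} {ν : Measure Y} [IsProbabilityMeasure μ] [IsProbabilityMeasure ν]
    (hm₁ : HasFiniteMoment p μ) (hm₂ : HasFiniteMoment p ν) (hA : CondA p L C c μ ν)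
    (q : ℝ) (hq : 1 < q) (ε : ℕ → ℝ) (hε : Tendsto ε atTop (𝓝 0))
    (π : Measure (X × Y)) (hπ : IsProbabilityMeasure π) (hmπ : HasFiniteMoment p π) :
    ∃ πs : ℕ → Measure (X × Y),
          (∀ k, IsProbabilityMeasure (πs k)) ∧ (∀ k, HasFiniteMoment p (πs k)) ∧
          NarrowTendsto πs π ∧
          limsup (fun k => Freg q (ε k) c μ ν (πs k)) atTop ≤ Flim c μ ν π := by
  by_cases hF : Flim c μ ν π = ⊤
  · refine ⟨fun _ => π, fun _ => hπ, fun _ => hmπ, fun f => tendsto_const_nhds, ?_⟩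
    rw [hF]; exact le_top
  have h : IsCoupling π μ ν := by
    by_contra hcp
    rw [Flim, if_neg hcp] at hF
    exact hF rfl
  rw [Flim, if_pos h] at hF ⊢
  obtain ⟨x₀, hx₀⟩ := id hm₁
  obtain ⟨y₀, hy₀⟩ := id hm₂
  have hmom : ∀ ρ : Measure (X × Y), IsCoupling ρ μ ν → ∫⁻ z, hcost p (z, (x₀, y₀)) ∂ρ ≠ ⊤ := by
    intro ρ hρ
    rw [hcost_coupling p hρ]; exact ENNReal.add_ne_top.2 ⟨hx₀, hy₀⟩
  have happ := fun n : ℕ => approx hp μ ν π h (x₀, y₀) (hmom π h) (1 / ((n : ℝ) + 1))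
    (by positivity) (by rw [div_le_one (by positivity)]; linarith [(Nat.cast_nonneg n : (0:ℝ) ≤ n)])
  choose ρ hρc hρM γ hγ hcost using happ
  choose M hM hρle using hρM
  have hρp : ∀ n, IsProbabilityMeasure (ρ n) := fun n => coupling_prob (hρc n)
  have hts := fun n => tsallis_bound q hq (ρ n) (μ.prod ν) (M n) (hM n) (hρle n)
  have hfin := fun n => ac_fin hp hL hcc hc0 hm₁ hm₂ hA h (hρc n) hF (hts n).1
  obtain ⟨φ, hφ, hφD⟩ := exists_diag (fun n => tsallisDiv q (ρ n) (μ.prod ν))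
    (fun n => (hts n).2) ε hε
  have ha : Tendsto (fun n : ℕ => ENNReal.ofReal (1 / ((n : ℝ) + 1))) atTop (𝓝 0) := by
    simpa using ENNReal.tendsto_ofReal tendsto_one_div_add_atTop_nhds_zero_nat
  have hnar : NarrowTendsto ρ π := narrow_of_cost hp π ρ γ hγ _ ha hcost
  refine ⟨fun k => ρ (φ k), fun k => hρp _, fun k => ⟨(x₀, y₀), ?_⟩, fun f => (hnar f).comp hφ, ?_⟩
  · exact ne_top_of_le_ne_top (hmom _ (hρc (φ k)))
      (lintegral_mono fun z => edist_pow_le_hcost hp z (x₀, y₀))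
  have hI : Tendsto (fun n => ∫ z, c z ∂(ρ n)) atTop (𝓝 (∫ z, c z ∂π)) := by
    rw [tendsto_iff_dist_tendsto_zero]
    have hb : Tendsto (fun n : ℕ => L * ((ENNReal.ofReal (1 / ((n : ℝ) + 1))) ^ (1 / p)).toReal)
        atTop (𝓝 0) := by
      have h2 := ha.ennrpow_const (1 / p)
      rw [ENNReal.zero_rpow_of_pos (by positivity)] at h2
      have h3 := ((ENNReal.tendsto_toReal (by simp)).comp h2).const_mul L
      simpa using h3
    refine squeeze_zero (fun _ => dist_nonneg) (fun n => ?_) hb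
    rw [dist_comm, Real.dist_eq]
    exact condA_apply hp hL hm₁ hm₂ hA h (hρc n) (hγ n) ENNReal.ofReal_ne_top (hcost n)
  have hl : ∀ m : Measure (X × Y), ∫⁻ z, ENNReal.ofReal (c z) ∂m ≠ ⊤ →
      ENNReal.ofReal (∫ z, c z ∂m) = ∫⁻ z, ENNReal.ofReal (c z) ∂m := by
    intro m hm
    rw [integral_eq_lintegral_of_nonneg_ae (ae_of_all _ hc0) hcc.aestronglyMeasurable,
      ENNReal.ofReal_toReal hm]
  have hI2 := ENNReal.tendsto_ofReal hI
  rw [hl π hF] at hI2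
  simp_rw [fun n => hl (ρ n) (hfin n)] at hI2
  have htot := (hI2.comp hφ).add hφD
  rw [add_zero] at htot
  refine le_of_eq (Tendsto.limsup_eq (htot.congr fun k => ?_))
  rw [Freg, if_pos (hρc _)]
  rfl
end main

/-- Γ-convergence of the Tsallis entropic regularized optimal transport functionals to the
Monge–Kantorovich functional, with respect to the narrow topology. -/
theorem tsallis_gammaConvergence
    {X₁ : Type*} [MetricSpace X₁] [CompleteSpace X₁] [TopologicalSpace.SeparableSpace X₁]
    [MeasurableSpace X₁] [BorelSpace X₁]
    {X₂ : Type*} [MetricSpace X₂] [CompleteSpace X₂] [TopologicalSpace.SeparableSpace X₂]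
    [MeasurableSpace X₂] [BorelSpace X₂]
    (p : ℝ) (hp : 1 ≤ p)
    (μ₁ : Measure X₁) (μ₂ : Measure X₂)
    [IsProbabilityMeasure μ₁] [IsProbabilityMeasure μ₂]
    (hm₁ : HasFiniteMoment p μ₁) (hm₂ : HasFiniteMoment p μ₂)
    (q : ℝ) (hq₁ : 1 < q) (hq₂ : q ≤ 2)
    (c : X₁ × X₂ → ℝ) (hc : Continuous c) (hc0 : ∀ z, 0 ≤ c z)
    (L C : ℝ) (hL : 0 ≤ L) (hC : 0 ≤ C) (hA : CondA p L C c μ₁ μ₂)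
    (ε : ℕ → ℝ) (hεpos : ∀ k, 0 < ε k) (hεlim : Tendsto ε atTop (𝓝 0)) :
    (∀ (πs : ℕ → Measure (X₁ × X₂)) (π : Measure (X₁ × X₂)),
        (∀ k, IsProbabilityMeasure (πs k)) → (∀ k, HasFiniteMoment p (πs k)) →
        IsProbabilityMeasure π → HasFiniteMoment p π →
        NarrowTendsto πs π →
        Flim c μ₁ μ₂ π ≤ liminf (fun k => Freg q (ε k) c μ₁ μ₂ (πs k)) atTop) ∧
    (∀ π : Measure (X₁ × X₂), IsProbabilityMeasure π → HasFiniteMoment p π →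
        ∃ πs : ℕ → Measure (X₁ × X₂),
          (∀ k, IsProbabilityMeasure (πs k)) ∧ (∀ k, HasFiniteMoment p (πs k)) ∧
          NarrowTendsto πs π ∧
          limsup (fun k => Freg q (ε k) c μ₁ μ₂ (πs k)) atTop ≤ Flim c μ₁ μ₂ π) := by
  have : SecondCountableTopology X₁ := UniformSpace.secondCountable_of_separable X₁
  have : SecondCountableTopology X₂ := UniformSpace.secondCountable_of_separable X₂
  refine ⟨fun πs π hs _ hπ _ hn => ?_, fun π hπ hmπ => ?_⟩
  · exact liminf_part (p := p) hc hc0 q ε πs π hs hπ hn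
  · exact limsup_part hp hL hc hc0 hm₁ hm₂ hA q hq₁ ε hεlim π hπ hmπ

end
end

section
/- Let X₁ and X₂ be Polish metric spaces, μᵢ probability measures on Xᵢ, c: X₁ × X₂ → [0,∞) continuous, q > 1, and ε_k > 0 with ε_k → 0. Define F_k(π) = ∫ c dπ + ε_k D_q(π, μ₁⊗μ₂) for π ∈ Π(μ₁,μ₂) and +∞ otherwise, and F(π) = ∫ c dπ for π ∈ Π(μ₁,μ₂) and +∞ otherwise. Then for any sequence of probability measures π_k on X₁ × X₂ converging narrowly to π, one has F(π) ≤ liminf_{k→∞} F_k(π_k). -/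
open MeasureTheory Filter Topology
open scoped ENNReal Classical

noncomputable section

/-- If narrowly convergent measures have frequently the same image under a continuous map,
the limit has this image too. -/
theorem map_eq_of_narrowTendsto {Z Y : Type*} [TopologicalSpace Z] [MeasurableSpace Z]
    [OpensMeasurableSpace Z] [MetricSpace Y] [MeasurableSpace Y] [BorelSpace Y]
    (πs : ℕ → Measure Z) (π : Measure Z) [IsProbabilityMeasure π]
    (hn : NarrowTendsto πs π) (g : Z → Y) (hg : Continuous g) (hgm : Measurable g)
    (μ : Measure Y) [IsProbabilityMeasure μ]
    (h : ∃ᶠ k in atTop, (πs k).map g = μ) : π.map g = μ := by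
  have : IsProbabilityMeasure (π.map g) := Measure.isProbabilityMeasure_map hgm.aemeasurable
  apply ext_of_forall_integral_eq_of_IsFiniteMeasure
  intro f
  have hint : ∀ ρ : Measure Z, ∫ y, f y ∂(ρ.map g) = ∫ z, f (g z) ∂ρ := fun ρ =>
    integral_map hgm.aemeasurable f.continuous.measurable.aestronglyMeasurable
  rw [hint]
  have ht := hn (f.compContinuous ⟨g, hg⟩)
  have hmem := (isClosed_singleton (x := ∫ y, f y ∂μ)).mem_of_frequently_of_tendsto
    (h.mono fun k hk => by
      show ∫ z, f (g z) ∂(πs k) = ∫ y, f y ∂μ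
      rw [← hint, hk]) ht
  exact hmem

/-- The liminf inequality for the Tsallis entropic regularized functionals. -/
theorem tsallis_liminf_inequality
    {X₁ : Type*} [MetricSpace X₁] [CompleteSpace X₁] [TopologicalSpace.SeparableSpace X₁]
    [MeasurableSpace X₁] [BorelSpace X₁]
    {X₂ : Type*} [MetricSpace X₂] [CompleteSpace X₂] [TopologicalSpace.SeparableSpace X₂]
    [MeasurableSpace X₂] [BorelSpace X₂]
    (μ₁ : Measure X₁) (μ₂ : Measure X₂)
    [IsProbabilityMeasure μ₁] [IsProbabilityMeasure μ₂]
    (c : X₁ × X₂ → ℝ) (hc : Continuous c) (hc0 : ∀ z, 0 ≤ c z)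
    (q : ℝ) (hq : 1 < q)
    (ε : ℕ → ℝ) (hεpos : ∀ k, 0 < ε k) (hεlim : Tendsto ε atTop (𝓝 0))
    (πs : ℕ → Measure (X₁ × X₂)) (π : Measure (X₁ × X₂))
    (hπs : ∀ k, IsProbabilityMeasure (πs k)) (hπ : IsProbabilityMeasure π)
    (hnarrow : NarrowTendsto πs π) :
    Flim c μ₁ μ₂ π ≤ liminf (fun k => Freg q (ε k) c μ₁ μ₂ (πs k)) atTop := by
  have := UniformSpace.secondCountable_of_separable X₁
  have := UniformSpace.secondCountable_of_separable X₂
  by_cases hfr : ∃ᶠ k in atTop, IsCoupling (πs k) μ₁ μ₂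
  · have hcoup : IsCoupling π μ₁ μ₂ :=
      ⟨map_eq_of_narrowTendsto πs π hnarrow Prod.fst continuous_fst measurable_fst μ₁
        (hfr.mono fun k hk => hk.1),
       map_eq_of_narrowTendsto πs π hnarrow Prod.snd continuous_snd measurable_snd μ₂
        (hfr.mono fun k hk => hk.2)⟩
    let P : ProbabilityMeasure (X₁ × X₂) := ⟨π, hπ⟩
    let Ps : ℕ → ProbabilityMeasure (X₁ × X₂) := fun k => ⟨πs k, hπs k⟩
    have hconv : Tendsto Ps atTop (𝓝 P) :=
      ProbabilityMeasure.tendsto_iff_forall_integral_tendsto.2 hnarrow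
    have hlsc := lintegral_le_liminf_lintegral_of_forall_isOpen_measure_le_liminf_measure
      (μ := π) (μs := πs) hc hc0
      (fun G hG => ProbabilityMeasure.le_liminf_measure_open_of_tendsto (μ := P) (μs := Ps) hconv hG)
    rw [Flim, if_pos hcoup]
    refine hlsc.trans (liminf_le_liminf (Eventually.of_forall fun k => ?_))
    simp only [Freg]
    split_ifs
    · exact le_self_add
    · exact le_top
  · rw [not_frequently] at hfr
    have hev : (fun k => Freg q (ε k) c μ₁ μ₂ (πs k)) =ᶠ[atTop] fun _ => ⊤ := by
      filter_upwards [hfr] with k hk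
      rw [Freg, if_neg hk]
    rw [liminf_congr hev, liminf_const]
    exact le_top

end
end

section
/- Let X₁ and X₂ be Polish metric spaces, p ∈ [1,∞), μᵢ ∈ 𝒫_p(Xᵢ) (i = 1,2), 1 < q ≤ 2, and let c: X₁ × X₂ → [0,∞) be a continuous cost satisfying condition (A_{L,C}) for some L, C ≥ 0. Let ε_k > 0 be a sequence converging to 0 with ε_k φ_q(k) → 0, where φ_q(x) = (x^{q−1} − 1)/(q − 1). Then for every π ∈ Π(μ₁,μ₂) there exists a sequence π_k ∈ Π(μ₁,μ₂) converging narrowly to π such that limsup_{k→∞} (∫ c dπ_k + ε_k D_q(π_k, μ₁⊗μ₂)) ≤ ∫ c dπ. -/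
open MeasureTheory Filter Topology
open scoped ENNReal Classical

noncomputable section

set_option linter.unusedSectionVars false

section Block

variable {X₁ X₂ : Type*} [MeasurableSpace X₁] [MeasurableSpace X₂]

/-- Coupling between `π` and its block approximation along the partition `T ⁻¹' {i}`, `i < n`. -/
def blockG (μ₁ : Measure X₁) (π : Measure (X₁ × X₂)) (T : X₁ → ℕ) (n : ℕ) :
    Measure ((X₁ × X₂) × (X₁ × X₂)) :=
  ∑ i ∈ Finset.range n, (μ₁ (T ⁻¹' {i}))⁻¹ •
    ((μ₁.restrict (T ⁻¹' {i})).prod (π.restrict (Prod.fst ⁻¹' (T ⁻¹' {i})))).map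
      (fun w => (w.2, (w.1, w.2.2)))

theorem lintegral_blockG (μ₁ : Measure X₁) (π : Measure (X₁ × X₂)) [IsProbabilityMeasure μ₁]
    [IsProbabilityMeasure π] (T : X₁ → ℕ) (n : ℕ)
    (g : (X₁ × X₂) × (X₁ × X₂) → ℝ≥0∞) (hg : Measurable g) :
    ∫⁻ w, g w ∂(blockG μ₁ π T n) = ∑ i ∈ Finset.range n, (μ₁ (T ⁻¹' {i}))⁻¹ *
      ∫⁻ x in T ⁻¹' {i}, ∫⁻ z in Prod.fst ⁻¹' (T ⁻¹' {i}), g (z, (x, z.2)) ∂π ∂μ₁ := by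
  unfold blockG
  rw [lintegral_finsetSum_measure]
  refine Finset.sum_congr rfl fun i _ => ?_
  rw [lintegral_smul_measure, lintegral_map hg (by fun_prop), lintegral_prod _ (by fun_prop)]
  simp

theorem sum_fiber {α : Type*} [MeasurableSpace α] (μ : Measure α) (T : α → ℕ) (hT : Measurable T)
    (n : ℕ) (hn : ∀ x, T x < n) (g : α → ℝ≥0∞) :
    ∑ i ∈ Finset.range n, ∫⁻ x in T ⁻¹' {i}, g x ∂μ = ∫⁻ x, g x ∂μ := by
  rw [← lintegral_biUnion_finset]
  · have : ⋃ b ∈ Finset.range n, T ⁻¹' {b} = Set.univ := by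
      ext x; simp [hn x]
    rw [this, Measure.restrict_univ]
  · intro i _ j _ hij
    exact Disjoint.preimage _ (by simpa using hij)
  · intro b _
    exact hT (measurableSet_singleton b)

theorem ennreal_inv_mul_mul_self {a I : ℝ≥0∞} (ha : a ≠ ⊤) (h : a = 0 → I = 0) : a⁻¹ * (a * I) = I := by
  by_cases h0 : a = 0
  · simp [h h0]
  · rw [← mul_assoc, ENNReal.inv_mul_cancel h0 ha, one_mul]

theorem coup_prob {μ₁ : Measure X₁} {μ₂ : Measure X₂} [IsProbabilityMeasure μ₁]
    {π : Measure (X₁ × X₂)} (hπ : IsCoupling π μ₁ μ₂) : IsProbabilityMeasure π := by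
  constructor
  have := congrArg (fun m => m Set.univ) hπ.1
  simpa [Measure.map_apply measurable_fst MeasurableSet.univ] using this

theorem coup_fst {μ₁ : Measure X₁} {μ₂ : Measure X₂}
    {π : Measure (X₁ × X₂)} (hπ : IsCoupling π μ₁ μ₂) {s : Set X₁} (hs : MeasurableSet s) :
    π (Prod.fst ⁻¹' s) = μ₁ s := by
  rw [← hπ.1, Measure.map_apply measurable_fst hs]

theorem coup_snd {μ₁ : Measure X₁} {μ₂ : Measure X₂}
    {π : Measure (X₁ × X₂)} (hπ : IsCoupling π μ₁ μ₂) {s : Set X₂} (hs : MeasurableSet s) :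
    π (Prod.snd ⁻¹' s) = μ₂ s := by
  rw [← hπ.2, Measure.map_apply measurable_snd hs]

theorem coup_lint_fst {μ₁ : Measure X₁} {μ₂ : Measure X₂}
    {π : Measure (X₁ × X₂)} (hπ : IsCoupling π μ₁ μ₂) {g : X₁ → ℝ≥0∞} (hg : Measurable g) :
    ∫⁻ z, g z.1 ∂π = ∫⁻ x, g x ∂μ₁ := by
  rw [← hπ.1, lintegral_map hg measurable_fst]

theorem coup_lint_snd {μ₁ : Measure X₁} {μ₂ : Measure X₂}
    {π : Measure (X₁ × X₂)} (hπ : IsCoupling π μ₁ μ₂) {g : X₂ → ℝ≥0∞} (hg : Measurable g) :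
    ∫⁻ z, g z.2 ∂π = ∫⁻ x, g x ∂μ₂ := by
  rw [← hπ.2, lintegral_map hg measurable_snd]

theorem lintegral_blockG_fst
    {μ₁ : Measure X₁} {μ₂ : Measure X₂} [IsProbabilityMeasure μ₁] [IsProbabilityMeasure μ₂]
    {π : Measure (X₁ × X₂)} (hπ : IsCoupling π μ₁ μ₂) {T : X₁ → ℕ} (hT : Measurable T)
    {n : ℕ} (hn : ∀ x, T x < n) (g : X₁ × X₂ → ℝ≥0∞) (hg : Measurable g) :
    ∫⁻ w, g w.1 ∂(blockG μ₁ π T n) = ∫⁻ z, g z ∂π := by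
  have := coup_prob hπ
  rw [lintegral_blockG _ _ _ _ _ (by fun_prop), ← sum_fiber π (T ∘ Prod.fst) (by fun_prop) n
    (fun z => hn _)]
  refine Finset.sum_congr rfl fun i _ => ?_
  have hA : MeasurableSet (T ⁻¹' {i}) := hT (measurableSet_singleton i)
  simp only [lintegral_const, Measure.restrict_apply_univ]
  rw [mul_comm (lintegral _ _)]
  refine (ennreal_inv_mul_mul_self (measure_ne_top _ _) ?_)
  intro h0
  have : π (Prod.fst ⁻¹' (T ⁻¹' {i})) = 0 := by rw [coup_fst hπ hA, h0]
  rw [Measure.restrict_eq_zero.2 this]; simp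

theorem lintegral_blockG_x
    {μ₁ : Measure X₁} {μ₂ : Measure X₂} [IsProbabilityMeasure μ₁] [IsProbabilityMeasure μ₂]
    {π : Measure (X₁ × X₂)} (hπ : IsCoupling π μ₁ μ₂) {T : X₁ → ℕ} (hT : Measurable T)
    {n : ℕ} (hn : ∀ x, T x < n) (g : X₁ → ℝ≥0∞) (hg : Measurable g) :
    ∫⁻ w, g w.2.1 ∂(blockG μ₁ π T n) = ∫⁻ z, g z ∂μ₁ := by
  have := coup_prob hπ
  rw [lintegral_blockG _ _ _ _ _ (by fun_prop), ← sum_fiber μ₁ T hT n hn]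
  refine Finset.sum_congr rfl fun i _ => ?_
  have hA : MeasurableSet (T ⁻¹' {i}) := hT (measurableSet_singleton i)
  simp only [lintegral_const, Measure.restrict_apply_univ]
  rw [lintegral_mul_const _ hg, coup_fst hπ hA, mul_comm (lintegral _ _)]
  refine (ennreal_inv_mul_mul_self (measure_ne_top _ _) ?_)
  intro h0
  rw [Measure.restrict_eq_zero.2 h0]; simp

theorem blockG_map_fst
    {μ₁ : Measure X₁} {μ₂ : Measure X₂} [IsProbabilityMeasure μ₁] [IsProbabilityMeasure μ₂]
    {π : Measure (X₁ × X₂)} (hπ : IsCoupling π μ₁ μ₂) {T : X₁ → ℕ} (hT : Measurable T)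
    {n : ℕ} (hn : ∀ x, T x < n) : (blockG μ₁ π T n).map Prod.fst = π := by
  ext s hs
  have h := lintegral_blockG_fst hπ hT hn (s.indicator 1) (measurable_one.indicator hs)
  rw [← lintegral_indicator_one hs, ← lintegral_indicator_one hs,
    lintegral_map (measurable_one.indicator hs) measurable_fst, h]

theorem block_coupling_s3
    {μ₁ : Measure X₁} {μ₂ : Measure X₂} [IsProbabilityMeasure μ₁] [IsProbabilityMeasure μ₂]
    {π : Measure (X₁ × X₂)} (hπ : IsCoupling π μ₁ μ₂) {T : X₁ → ℕ} (hT : Measurable T)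
    {n : ℕ} (hn : ∀ x, T x < n) : IsCoupling ((blockG μ₁ π T n).map Prod.snd) μ₁ μ₂ := by
  constructor
  · ext s hs
    have h := lintegral_blockG_x hπ hT hn (s.indicator 1) (measurable_one.indicator hs)
    rw [Measure.map_map measurable_fst measurable_snd,
      ← lintegral_indicator_one hs, ← lintegral_indicator_one hs,
      lintegral_map (measurable_one.indicator hs) (by fun_prop)]
    exact h
  · have := coup_prob hπ
    have hm : Measurable (fun w : (X₁ × X₂) × (X₁ × X₂) => w.2.2) := by fun_prop
    rw [Measure.map_map measurable_snd measurable_snd]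
    ext s hs
    have h1 : Measurable (s.indicator (1 : X₂ → ℝ≥0∞)) := measurable_one.indicator hs
    have h := lintegral_blockG_fst hπ hT hn (fun z => s.indicator 1 z.2) (by fun_prop)
    have h2 := lintegral_blockG μ₁ π T n (fun w => s.indicator (1 : X₂ → ℝ≥0∞) w.1.2)
      (by fun_prop)
    have h3 := lintegral_blockG μ₁ π T n (fun w => s.indicator (1 : X₂ → ℝ≥0∞) w.2.2)
      (by fun_prop)
    rw [← lintegral_indicator_one hs, lintegral_map h1 (by fun_prop)]
    simp only [Function.comp]
    rw [h3, ← h2, h, ← lintegral_map h1 measurable_snd, hπ.2, lintegral_indicator_one hs]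

theorem block_le_s3
    {μ₁ : Measure X₁} {μ₂ : Measure X₂} [IsProbabilityMeasure μ₁] [IsProbabilityMeasure μ₂]
    {π : Measure (X₁ × X₂)} (hπ : IsCoupling π μ₁ μ₂) {T : X₁ → ℕ} (hT : Measurable T)
    {n : ℕ} (hn : ∀ x, T x < n) (g : X₁ × X₂ → ℝ≥0∞) (hg : Measurable g) :
    ∫⁻ z, g z ∂((blockG μ₁ π T n).map Prod.snd) ≤
      ∫⁻ z, (μ₁ (T ⁻¹' {T z.1}))⁻¹ * g z ∂(μ₁.prod μ₂) := by
  have := coup_prob hπ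
  have hh : Measurable (fun x => (μ₁ (T ⁻¹' {T x}))⁻¹) :=
    (measurable_from_nat (f := fun i => (μ₁ (T ⁻¹' {i}))⁻¹)).comp hT
  have hh' : Measurable (fun z : X₁ × X₂ => (μ₁ (T ⁻¹' {T z.1}))⁻¹ * g z) :=
    (hh.comp measurable_fst).mul hg
  have hg2 : Measurable (fun w : (X₁ × X₂) × (X₁ × X₂) => g w.2) := hg.comp measurable_snd
  rw [lintegral_map hg measurable_snd, lintegral_blockG _ _ _ _ _ hg2,
    lintegral_prod _ hh'.aemeasurable, ← sum_fiber μ₁ T hT n hn]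
  refine Finset.sum_le_sum fun i _ => ?_
  have hA : MeasurableSet (T ⁻¹' {i}) := hT (measurableSet_singleton i)
  have hg3 : Measurable (fun w : X₁ × (X₁ × X₂) => g (w.1, w.2.2)) := by fun_prop
  rw [← lintegral_const_mul _ hg3.lintegral_prod_right']
  refine setLIntegral_mono' hA fun x hx => ?_
  have hx' : T x = i := hx
  have hg4 : Measurable (fun y => g (x, y)) := by fun_prop
  simp only [hx']
  rw [lintegral_const_mul _ hg4, ← coup_lint_snd hπ hg4]
  gcongr
  exact Measure.restrict_le_self

theorem block_dens
    {μ₁ : Measure X₁} {μ₂ : Measure X₂} [IsProbabilityMeasure μ₁] [IsProbabilityMeasure μ₂]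
    {π : Measure (X₁ × X₂)} (hπ : IsCoupling π μ₁ μ₂) {T : X₁ → ℕ} (hT : Measurable T)
    {n : ℕ} (hn : ∀ x, T x < n) : (blockG μ₁ π T n).map Prod.snd ≪ μ₁.prod μ₂ ∧
    ∀ᵐ z ∂(μ₁.prod μ₂), ((blockG μ₁ π T n).map Prod.snd).rnDeriv (μ₁.prod μ₂) z ≤
      (μ₁ (T ⁻¹' {T z.1}))⁻¹ := by
  have hh : Measurable (fun z : X₁ × X₂ => (μ₁ (T ⁻¹' {T z.1}))⁻¹) :=
    (measurable_from_nat (f := fun i => (μ₁ (T ⁻¹' {i}))⁻¹)).comp (hT.comp measurable_fst)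
  have key : ∀ s, MeasurableSet s → ((blockG μ₁ π T n).map Prod.snd) s ≤
      ∫⁻ z in s, (μ₁ (T ⁻¹' {T z.1}))⁻¹ ∂(μ₁.prod μ₂) := by
    intro s hs
    rw [← lintegral_indicator_one hs, ← lintegral_indicator hs]
    refine (block_le_s3 hπ hT hn _ (measurable_one.indicator hs)).trans (lintegral_mono fun z => ?_)
    by_cases hz : z ∈ s <;> simp [hz]
  constructor
  · refine Measure.AbsolutelyContinuous.mk fun s hs h0 => ?_
    have := key s hs
    rw [Measure.restrict_eq_zero.2 h0] at this
    simpa using this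
  · refine ae_le_of_forall_setLIntegral_le_of_sigmaFinite (Measure.measurable_rnDeriv _ _)
      fun s hs _ => (Measure.setLIntegral_rnDeriv_le s).trans (key s hs)

theorem block_entropy
    {μ₁ : Measure X₁} {μ₂ : Measure X₂} [IsProbabilityMeasure μ₁] [IsProbabilityMeasure μ₂]
    {π : Measure (X₁ × X₂)} (hπ : IsCoupling π μ₁ μ₂) {T : X₁ → ℕ} (hT : Measurable T)
    {n : ℕ} (hn : ∀ x, T x < n) {q : ℝ} (hq₁ : 1 < q) (hq₂ : q ≤ 2) :
    tsallisDiv q ((blockG μ₁ π T n).map Prod.snd) (μ₁.prod μ₂) ≤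
      ENNReal.ofReal (((n : ℝ) ^ (q - 1) - 1) / (q - 1)) := by
  obtain ⟨hac, hle⟩ := block_dens hπ hT hn
  have hc := block_coupling_s3 hπ hT hn
  have hprob := coup_prob hc
  set P := (blockG μ₁ π T n).map Prod.snd with hP
  have hh : Measurable (fun x => (μ₁ (T ⁻¹' {T x}))⁻¹) :=
    (measurable_from_nat (f := fun i => (μ₁ (T ⁻¹' {i}))⁻¹)).comp hT
  have h1 : ∫⁻ x, P.rnDeriv (μ₁.prod μ₂) x ∂(μ₁.prod μ₂) = 1 := by
    rw [Measure.lintegral_rnDeriv hac]; simp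
  have hr : 0 < q - 1 := by linarith
  have h2 : ∫⁻ x, P.rnDeriv (μ₁.prod μ₂) x ^ q ∂(μ₁.prod μ₂) ≤
      ∫⁻ x, (μ₁ (T ⁻¹' {T x}))⁻¹ ^ (q - 1) ∂μ₁ := by
    calc _ = ∫⁻ x, P.rnDeriv (μ₁.prod μ₂) x * P.rnDeriv (μ₁.prod μ₂) x ^ (q-1) ∂(μ₁.prod μ₂) := by
          refine lintegral_congr fun x => ?_
          nth_rewrite 2 [← ENNReal.rpow_one (P.rnDeriv (μ₁.prod μ₂) x)]
          rw [← ENNReal.rpow_add_of_nonneg _ _ zero_le_one hr.le]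
          congr 1; ring
      _ ≤ ∫⁻ z, P.rnDeriv (μ₁.prod μ₂) z * ((μ₁ (T ⁻¹' {T z.1}))⁻¹) ^ (q-1) ∂(μ₁.prod μ₂) := by
          refine lintegral_mono_ae ?_
          filter_upwards [hle] with z hz
          gcongr
      _ = ∫⁻ z, ((μ₁ (T ⁻¹' {T z.1}))⁻¹) ^ (q-1) ∂P :=
          lintegral_rnDeriv_mul hac ((hh.comp measurable_fst).pow_const _).aemeasurable
      _ = _ := coup_lint_fst hc (hh.pow_const _)
  have h3 : ∫⁻ x, (μ₁ (T ⁻¹' {T x}))⁻¹ ∂μ₁ ≤ n := by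
    rw [← sum_fiber μ₁ T hT n hn]
    calc _ ≤ ∑ i ∈ Finset.range n, (1 : ℝ≥0∞) := by
          refine Finset.sum_le_sum fun i _ => ?_
          have hA : MeasurableSet (T ⁻¹' {i}) := hT (measurableSet_singleton i)
          rw [setLIntegral_congr_fun hA (g := fun _ => (μ₁ (T ⁻¹' {i}))⁻¹)
            (fun x hx => by have : T x = i := hx
                            simp [this])]
          rw [setLIntegral_const]
          exact ENNReal.inv_mul_le_one _
      _ = n := by simp
  have h4 : ∫⁻ x, (μ₁ (T ⁻¹' {T x}))⁻¹ ^ (q - 1) ∂μ₁ ≤ (n : ℝ≥0∞) ^ (q - 1) := by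
    have := eLpNorm'_le_eLpNorm'_of_exponent_le hr (by linarith : q - 1 ≤ 1) μ₁
      (f := fun x => (μ₁ (T ⁻¹' {T x}))⁻¹) hh.aestronglyMeasurable
    simp only [eLpNorm', enorm_eq_self, ENNReal.rpow_one, div_one] at this
    rw [one_div, ENNReal.rpow_inv_le_iff hr] at this
    exact this.trans (ENNReal.rpow_le_rpow h3 hr.le)
  unfold tsallisDiv
  rw [if_pos hac, h1, ENNReal.ofReal_div_of_pos hr]
  gcongr
  rw [ENNReal.ofReal_sub _ zero_le_one, ENNReal.ofReal_one, ← ENNReal.ofReal_rpow_of_nonneg (by positivity) hr.le,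
    ENNReal.ofReal_natCast]
  exact tsub_le_tsub_right (h2.trans h4) _

end Block

section Cost

variable {X₁ X₂ : Type*} [MetricSpace X₁] [MetricSpace X₂]
  [SecondCountableTopology X₁] [SecondCountableTopology X₂]
  [MeasurableSpace X₁] [MeasurableSpace X₂] [BorelSpace X₁] [BorelSpace X₂]

theorem edist_rpow_le {X : Type*} [PseudoEMetricSpace X] {p : ℝ} (hp : 1 ≤ p) (a b e : X) :
    edist a b ^ p ≤ 2 ^ (p - 1) * (edist a e ^ p + edist b e ^ p) :=
  (ENNReal.rpow_le_rpow (edist_triangle_right a b e) (by linarith)).trans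
    (ENNReal.rpow_add_le_mul_rpow_add_rpow _ _ hp)

/-- The transport cost integrand. -/
def pcost (p : ℝ) (w : (X₁ × X₂) × (X₁ × X₂)) : ℝ≥0∞ :=
  edist w.1.1 w.2.1 ^ p + edist w.1.2 w.2.2 ^ p

theorem pcost_self {p : ℝ} (hp : 1 ≤ p) (z : X₁ × X₂) : pcost p (z, z) = 0 := by
  have : 0 < p := by linarith
  simp [pcost, this]

theorem pcost_measurable (p : ℝ) : Measurable (pcost (X₁ := X₁) (X₂ := X₂) p) := by
  unfold pcost
  have h1 : Measurable (fun w : (X₁ × X₂) × (X₁ × X₂) => edist w.1.1 w.2.1) :=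
    (by fun_prop : Measurable fun w : (X₁ × X₂) × (X₁ × X₂) => w.1.1).edist (by fun_prop)
  have h2 : Measurable (fun w : (X₁ × X₂) × (X₁ × X₂) => edist w.1.2 w.2.2) :=
    (by fun_prop : Measurable fun w : (X₁ × X₂) × (X₁ × X₂) => w.1.2).edist (by fun_prop)
  exact (h1.pow_const p).add (h2.pow_const p)

variable {μ₁ : Measure X₁} {μ₂ : Measure X₂} [IsProbabilityMeasure μ₁] [IsProbabilityMeasure μ₂]

theorem block_cost {π : Measure (X₁ × X₂)} (hπ : IsCoupling π μ₁ μ₂) {T : X₁ → ℕ}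
    (hT : Measurable T) {n : ℕ} (hn : ∀ x, T x < n) {p : ℝ} (hp : 1 ≤ p) (e : ℕ → X₁) :
    ∫⁻ w, pcost p w ∂(blockG μ₁ π T n) ≤
      2 ^ (p - 1) * (∫⁻ x, edist (e (T x)) x ^ p ∂μ₁ + ∫⁻ x, edist (e (T x)) x ^ p ∂μ₁) := by
  have := coup_prob hπ
  have hp0 : 0 < p := by linarith
  have hf : Measurable (fun x => edist (e (T x)) x ^ p) :=
    (((measurable_from_nat (f := e)).comp hT).edist measurable_id).pow_const p
  have hf1 : Measurable (fun w : (X₁ × X₂) × (X₁ × X₂) => edist (e (T w.1.1)) w.1.1 ^ p) :=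
    hf.comp (by fun_prop : Measurable fun w : (X₁ × X₂) × (X₁ × X₂) => w.1.1)
  have hf2 : Measurable (fun w : (X₁ × X₂) × (X₁ × X₂) => edist (e (T w.2.1)) w.2.1 ^ p) :=
    hf.comp (by fun_prop : Measurable fun w : (X₁ × X₂) × (X₁ × X₂) => w.2.1)
  have hf12 : Measurable (fun w : (X₁ × X₂) × (X₁ × X₂) =>
    edist (e (T w.1.1)) w.1.1 ^ p + edist (e (T w.2.1)) w.2.1 ^ p) := hf1.add hf2
  have e1 := lintegral_blockG_fst hπ hT hn (fun z => edist (e (T z.1)) z.1 ^ p)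
    (hf.comp measurable_fst)
  rw [coup_lint_fst hπ hf] at e1
  have e2 := lintegral_blockG_x hπ hT hn _ hf
  calc _ ≤ ∫⁻ w, 2 ^ (p - 1) * (edist (e (T w.1.1)) w.1.1 ^ p + edist (e (T w.2.1)) w.2.1 ^ p)
        ∂(blockG μ₁ π T n) := by
        rw [lintegral_blockG _ _ _ _ _ (pcost_measurable p),
          lintegral_blockG _ _ _ _ _ (hf12.const_mul _)]
        refine Finset.sum_le_sum fun i _ => ?_
        have hA : MeasurableSet (T ⁻¹' {i}) := hT (measurableSet_singleton i)
        refine mul_le_mul_right ?_ _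
        refine setLIntegral_mono' hA fun x hx => setLIntegral_mono' (measurable_fst hA)
          fun z hz => ?_
        have hx' : T x = i := hx
        have hz' : T z.1 = i := hz
        simp only [pcost, edist_self, ENNReal.zero_rpow_of_pos hp0, add_zero, hx', hz']
        rw [edist_comm (e i) z.1, edist_comm (e i) x]
        exact edist_rpow_le hp _ _ _
    _ = _ := by
        rw [lintegral_const_mul _ hf12, lintegral_add_left hf1, e1, e2]

theorem WpProd_le {p : ℝ} {σ τ : Measure (X₁ × X₂)} {γ : Measure ((X₁ × X₂) × (X₁ × X₂))}
    (hγ : IsCoupling γ σ τ) : WpProd p σ τ ≤ (∫⁻ w, pcost p w ∂γ) ^ (1 / p) :=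
  iInf₂_le γ hγ

theorem Wp_self {X : Type*} [MetricSpace X] [SecondCountableTopology X] [MeasurableSpace X]
    [BorelSpace X] {p : ℝ} (hp : 1 ≤ p) (μ : Measure X) : Wp p μ μ = 0 := by
  have hp0 : 0 < p := by linarith
  have hd : Measurable (fun x : X => (x, x)) := by fun_prop
  have hcp : IsCoupling (μ.map fun x => (x, x)) μ μ := by
    constructor
    · rw [Measure.map_map measurable_fst hd]; exact Measure.map_id
    · rw [Measure.map_map measurable_snd hd]; exact Measure.map_id
  have hle : Wp p μ μ ≤ (∫⁻ z, edist z.1 z.2 ^ p ∂(μ.map fun x => (x, x))) ^ (1 / p) :=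
    iInf₂_le (μ.map fun x => (x, x)) hcp
  refine nonpos_iff_eq_zero.1 (hle.trans ?_)
  rw [lintegral_map ((measurable_fst.edist measurable_snd).pow_const p) hd]
  simp [hp0]

theorem condA_self {p L C : ℝ} (hp : 1 ≤ p) {c : X₁ × X₂ → ℝ}
    (hm₁ : HasFiniteMoment p μ₁) (hm₂ : HasFiniteMoment p μ₂)
    (hA : CondA p L C c μ₁ μ₂) {σ τ : Measure (X₁ × X₂)} (hσ : IsCoupling σ μ₁ μ₂)
    (hτ : IsCoupling τ μ₁ μ₂) :
    |(∫ z, c z ∂σ) - ∫ z, c z ∂τ| ≤ L * (WpProd p σ τ).toReal :=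
  hA μ₁ μ₂ inferInstance inferInstance hm₁ hm₂ (by simp [Wp_self hp]) (by simp [Wp_self hp])
    σ hσ τ hτ

theorem cost_lt_top {p : ℝ} (hp : 1 ≤ p) 
    (hm₁ : HasFiniteMoment p μ₁) (hm₂ : HasFiniteMoment p μ₂)
    {σ τ : Measure (X₁ × X₂)} (hσ : IsCoupling σ μ₁ μ₂) (hτ : IsCoupling τ μ₁ μ₂)
    {γ : Measure ((X₁ × X₂) × (X₁ × X₂))} (hγ : IsCoupling γ σ τ) :
    ∫⁻ w, pcost p w ∂γ < ⊤ := by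
  obtain ⟨x₀, hx⟩ := hm₁
  obtain ⟨y₀, hy⟩ := hm₂
  have fx : Measurable (fun x : X₁ => edist x x₀ ^ p) := (measurable_id.edist measurable_const).pow_const p
  have fy : Measurable (fun x : X₂ => edist x y₀ ^ p) := (measurable_id.edist measurable_const).pow_const p
  have m1 : Measurable (fun w : (X₁ × X₂) × (X₁ × X₂) => edist w.1.1 x₀ ^ p) :=
    fx.comp (measurable_fst.comp measurable_fst)
  have m2 : Measurable (fun w : (X₁ × X₂) × (X₁ × X₂) => edist w.2.1 x₀ ^ p) :=
    fx.comp (measurable_fst.comp measurable_snd)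
  have m3 : Measurable (fun w : (X₁ × X₂) × (X₁ × X₂) => edist w.1.2 y₀ ^ p) :=
    fy.comp (measurable_snd.comp measurable_fst)
  have m4 : Measurable (fun w : (X₁ × X₂) × (X₁ × X₂) => edist w.2.2 y₀ ^ p) :=
    fy.comp (measurable_snd.comp measurable_snd)
  have m12 : Measurable (fun w : (X₁ × X₂) × (X₁ × X₂) => edist w.1.1 x₀ ^ p + edist w.2.1 x₀ ^ p) := m1.add m2
  have m34 : Measurable (fun w : (X₁ × X₂) × (X₁ × X₂) => edist w.1.2 y₀ ^ p + edist w.2.2 y₀ ^ p) := m3.add m4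
  have i1 := (coup_lint_fst hγ (fx.comp measurable_fst)).trans (coup_lint_fst hσ fx)
  have i2 := (coup_lint_snd hγ (fx.comp measurable_fst)).trans (coup_lint_fst hτ fx)
  have i3 := (coup_lint_fst hγ (fy.comp measurable_snd)).trans (coup_lint_snd hσ fy)
  have i4 := (coup_lint_snd hγ (fy.comp measurable_snd)).trans (coup_lint_snd hτ fy)
  simp only [Function.comp] at i1 i2 i3 i4
  calc _ ≤ ∫⁻ w, (2 ^ (p - 1) * (edist w.1.1 x₀ ^ p + edist w.2.1 x₀ ^ p) +
          2 ^ (p - 1) * (edist w.1.2 y₀ ^ p + edist w.2.2 y₀ ^ p)) ∂γ :=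
        lintegral_mono fun w => add_le_add (edist_rpow_le hp _ _ _) (edist_rpow_le hp _ _ _)
    _ = 2 ^ (p - 1) * (∫⁻ x, edist x x₀ ^ p ∂μ₁ + ∫⁻ x, edist x x₀ ^ p ∂μ₁) +
        2 ^ (p - 1) * (∫⁻ x, edist x y₀ ^ p ∂μ₂ + ∫⁻ x, edist x y₀ ^ p ∂μ₂) := by
        rw [lintegral_add_left (m12.const_mul _), lintegral_const_mul _ m12,
          lintegral_const_mul _ m34, lintegral_add_left m1, lintegral_add_left m3,
          i1, i2, i3, i4]
    _ < ⊤ := by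
        have : (2 : ℝ≥0∞) ^ (p - 1) ≠ ⊤ := ENNReal.rpow_ne_top_of_nonneg (by linarith) (by simp)
        exact ENNReal.add_lt_top.2 ⟨ENNReal.mul_lt_top this.lt_top (ENNReal.add_lt_top.2
          ⟨hx.lt_top, hx.lt_top⟩), ENNReal.mul_lt_top this.lt_top (ENNReal.add_lt_top.2
          ⟨hy.lt_top, hy.lt_top⟩)⟩

/-- If some coupling has non-integrable cost, every integrable coupling has cost zero. -/
theorem zero_of_not_integrable {p L C : ℝ} (hp : 1 ≤ p) {c : X₁ × X₂ → ℝ}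
    (hm₁ : HasFiniteMoment p μ₁) (hm₂ : HasFiniteMoment p μ₂)
    (hA : CondA p L C c μ₁ μ₂) {σ τ : Measure (X₁ × X₂)} (hσ : IsCoupling σ μ₁ μ₂)
    (hτ : IsCoupling τ μ₁ μ₂) (hni : ¬ Integrable c τ) : ∫ z, c z ∂σ = 0 := by
  have hp0 : 0 < p := by linarith
  have pσ := coup_prob hσ
  have pτ := coup_prob hτ
  have hprod : IsCoupling (σ.prod τ) σ τ := ⟨by simp, by simp⟩
  have hM := cost_lt_top hp hm₁ hm₂ hσ hτ hprod
  set M := ∫⁻ w, pcost p w ∂(σ.prod τ) with hMdef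
  have hd : Measurable (fun z : X₁ × X₂ => (z, z)) := by fun_prop
  have key : ∀ t : ℝ≥0∞, t ≠ 0 → t ≤ 1 → |∫ z, c z ∂σ| ≤ L * ((t * M) ^ (1 / p)).toReal ∨ L < 0 := by
    intro t ht0 ht1
    have hsum : (1 - t) + t = 1 := tsub_add_cancel_of_le ht1
    have hcoup : IsCoupling ((1 - t) • σ + t • τ) μ₁ μ₂ := by
      constructor
      · rw [Measure.map_add _ _ measurable_fst, Measure.map_smul, Measure.map_smul, hσ.1, hτ.1,
          ← add_smul, hsum, one_smul]
      · rw [Measure.map_add _ _ measurable_snd, Measure.map_smul, Measure.map_smul, hσ.2, hτ.2,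
          ← add_smul, hsum, one_smul]
    have hγ : IsCoupling ((1 - t) • σ.map (fun z => (z, z)) + t • σ.prod τ) σ
        ((1 - t) • σ + t • τ) := by
      constructor
      · rw [Measure.map_add _ _ measurable_fst, Measure.map_smul, Measure.map_smul, hprod.1,
          Measure.map_map measurable_fst hd]
        simp only [Function.comp_def, Measure.map_id']
        rw [← add_smul, hsum, one_smul]
      · rw [Measure.map_add _ _ measurable_snd, Measure.map_smul, Measure.map_smul, hprod.2,
          Measure.map_map measurable_snd hd]
        simp only [Function.comp_def, Measure.map_id']
    have hcost : ∫⁻ w, pcost p w ∂((1 - t) • σ.map (fun z => (z, z)) + t • σ.prod τ) = t * M := by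
      rw [lintegral_add_measure, lintegral_smul_measure, lintegral_smul_measure,
        lintegral_map (pcost_measurable p) hd]
      simp [pcost_self hp, hMdef]
    have hni' : ¬ Integrable c ((1 - t) • σ + t • τ) := by
      intro h
      refine hni ?_
      have h2 : Integrable c (t • τ) := h.mono_measure (Measure.le_add_left le_rfl)
      rwa [integrable_smul_measure ht0 (ne_top_of_le_ne_top ENNReal.one_ne_top ht1)] at h2
    have := condA_self hp hm₁ hm₂ hA hσ hcoup
    rw [integral_undef hni', sub_zero] at this
    rcases lt_or_ge L 0 with hL | hL
    · exact Or.inr hL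
    left
    refine this.trans (mul_le_mul_of_nonneg_left (ENNReal.toReal_mono ?_ ?_) hL)
    · refine ENNReal.rpow_ne_top_of_nonneg (by positivity) ?_
      exact (ENNReal.mul_lt_top (ht1.trans_lt ENNReal.one_lt_top) hM).ne
    · rw [← hcost]; exact WpProd_le hγ
  rcases lt_or_ge L 0 with hL | hL
  · have := condA_self hp hm₁ hm₂ hA hσ hτ
    rw [integral_undef hni, sub_zero] at this
    have h0 : |∫ z, c z ∂σ| ≤ 0 :=
      this.trans (mul_nonpos_of_nonpos_of_nonneg hL.le ENNReal.toReal_nonneg)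
    exact abs_nonpos_iff.1 h0
  have hlim : Tendsto (fun n : ℕ => L * ((((n : ℝ≥0∞) + 1)⁻¹ * M) ^ (1 / p)).toReal) atTop (𝓝 0) := by
    have h1 : Tendsto (fun n : ℕ => ((n : ℝ≥0∞) + 1)⁻¹) atTop (𝓝 0) := by
      have := (ENNReal.tendsto_inv_nat_nhds_zero).comp (tendsto_add_atTop_nat 1)
      simpa [Function.comp_def] using this
    have h2 : Tendsto (fun n : ℕ => ((n : ℝ≥0∞) + 1)⁻¹ * M) atTop (𝓝 0) := by
      simpa using ENNReal.Tendsto.mul_const h1 (Or.inr hM.ne)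
    have h3 := h2.ennrpow_const (1 / p)
    rw [ENNReal.zero_rpow_of_pos (by positivity)] at h3
    have h4 := (ENNReal.tendsto_toReal ENNReal.zero_ne_top).comp h3
    simpa using h4.const_mul L
  refine abs_nonpos_iff.1 (ge_of_tendsto' hlim fun n => ?_)
  refine (key _ (by simp) (by simp)).resolve_right (not_lt.2 hL)

end Cost

section Integrability

variable {X₁ X₂ : Type*} [MetricSpace X₁] [MetricSpace X₂]
  [SecondCountableTopology X₁] [SecondCountableTopology X₂] [CompleteSpace X₁] [CompleteSpace X₂]
  [MeasurableSpace X₁] [MeasurableSpace X₂] [BorelSpace X₁] [BorelSpace X₂]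
  {μ₁ : Measure X₁} {μ₂ : Measure X₂} [IsProbabilityMeasure μ₁] [IsProbabilityMeasure μ₂]

theorem exists_compact_compl {X : Type*} [MetricSpace X] [SecondCountableTopology X]
    [CompleteSpace X] [MeasurableSpace X] [BorelSpace X] (μ : Measure X) [IsProbabilityMeasure μ]
    {η : ℝ≥0∞} (hη : 0 < η) : ∃ K : Set X, IsCompact K ∧ μ Kᶜ ≤ η := by
  obtain ⟨K, hK, h⟩ := isTightMeasureSet_iff_exists_isCompact_measure_compl_le.1
    (isTightMeasureSet_singleton (μ := μ)) η hη
  exact ⟨K, hK, h μ rfl⟩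

theorem zero_of_all_zero {c : X₁ × X₂ → ℝ} (hc : Continuous c) (hc0 : ∀ z, 0 ≤ c z)
    {π : Measure (X₁ × X₂)} (hπ : IsCoupling π μ₁ μ₂) (hi : Integrable c π)
    (H : ∀ σ : Measure (X₁ × X₂), IsCoupling σ μ₁ μ₂ → Integrable c σ → ∫ z, c z ∂σ = 0) :
    (μ₁.prod μ₂) {z | c z ≠ 0} = 0 := by
  have := coup_prob hπ
  have hN : MeasurableSet {z | c z ≠ 0} := (hc.measurable (measurableSet_singleton 0)).compl
  set N := {z | c z ≠ 0} with hNdef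
  suffices h : ∀ η : ℝ≥0∞, 0 < η → (μ₁.prod μ₂) N / 6 ≤ η by
    have h0 : (μ₁.prod μ₂) N / 6 ≤ 0 := le_of_forall_gt_imp_ge_of_dense fun a ha => h a ha
    have h1 := nonpos_iff_eq_zero.1 h0
    rw [ENNReal.div_eq_zero_iff] at h1
    exact h1.resolve_right (by simp)
  intro η hη
  obtain ⟨K₁, hK₁, hμK₁⟩ := exists_compact_compl μ₁ hη
  obtain ⟨K₂, hK₂, hμK₂⟩ := exists_compact_compl μ₂ hη
  have hU : MeasurableSet (K₁ ×ˢ K₂) := hK₁.measurableSet.prod hK₂.measurableSet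
  obtain ⟨M, hM⟩ := (hK₁.prod hK₂).exists_bound_of_continuousOn hc.continuousOn
  set U := K₁ ×ˢ K₂ with hUdef
  have hδ : π Uᶜ ≤ 2 * η := by
    have : Uᶜ ⊆ Prod.fst ⁻¹' K₁ᶜ ∪ Prod.snd ⁻¹' K₂ᶜ := by
      intro z hz
      by_cases h : z.1 ∈ K₁
      · right; intro h2; exact hz ⟨h, h2⟩
      · left; exact h
    refine (measure_mono this).trans ((measure_union_le _ _).trans ?_)
    rw [coup_fst hπ hK₁.measurableSet.compl, coup_snd hπ hK₂.measurableSet.compl, two_mul]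
    exact add_le_add hμK₁ hμK₂
  set α := (π.restrict U).map Prod.fst with hα
  set β := (π.restrict U).map Prod.snd with hβ
  set α' := (π.restrict Uᶜ).map Prod.fst with hα'
  set β' := (π.restrict Uᶜ).map Prod.snd with hβ'
  have hμ₁ : α + α' = μ₁ := by
    rw [hα, hα', ← Measure.map_add _ _ measurable_fst, Measure.restrict_add_restrict_compl hU, hπ.1]
  have hμ₂ : β + β' = μ₂ := by
    rw [hβ, hβ', ← Measure.map_add _ _ measurable_snd, Measure.restrict_add_restrict_compl hU, hπ.2]
  have mα : α Set.univ = π U := by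
    rw [hα, Measure.map_apply measurable_fst MeasurableSet.univ]; simp
  have mβ : β Set.univ = π U := by
    rw [hβ, Measure.map_apply measurable_snd MeasurableSet.univ]; simp
  have mα' : α' Set.univ = π Uᶜ := by
    rw [hα', Measure.map_apply measurable_fst MeasurableSet.univ]; simp
  have mβ' : β' Set.univ = π Uᶜ := by
    rw [hβ', Measure.map_apply measurable_snd MeasurableSet.univ]; simp
  have fα : IsFiniteMeasure α := by rw [hα]; infer_instance
  have fβ : IsFiniteMeasure β := by rw [hβ]; infer_instance
  have fα' : IsFiniteMeasure α' := by rw [hα']; infer_instance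
  have fβ' : IsFiniteMeasure β' := by rw [hβ']; infer_instance
  -- the product of the restricted marginals gives no mass to `N`
  have hαβ : (α.prod β) N = 0 := by
    by_cases hm : π U = 0
    · have : α = 0 := by rw [hα, Measure.restrict_eq_zero.2 hm]; simp
      rw [this]; simp
    have hmt : π U ≠ ⊤ := measure_ne_top _ _
    have hcp : IsCoupling (π.restrict Uᶜ + (π U)⁻¹ • α.prod β) μ₁ μ₂ := by
      constructor
      · rw [Measure.map_add _ _ measurable_fst, Measure.map_smul, Measure.map_fst_prod, mβ,
          smul_smul, ENNReal.inv_mul_cancel hm hmt, one_smul, add_comm]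
        exact hμ₁
      · rw [Measure.map_add _ _ measurable_snd, Measure.map_smul, Measure.map_snd_prod, mα,
          smul_smul, ENNReal.inv_mul_cancel hm hmt, one_smul, add_comm]
        exact hμ₂
    have hbd : ∀ᵐ z ∂(α.prod β), ‖c z‖ ≤ M := by
      have h1 : ∀ᵐ x ∂α, x ∈ K₁ := by
        refine (ae_map_iff measurable_fst.aemeasurable hK₁.measurableSet).2 ?_
        filter_upwards [ae_restrict_mem hU] with z hz using hz.1
      have h2 : ∀ᵐ x ∂β, x ∈ K₂ := by
        refine (ae_map_iff measurable_snd.aemeasurable hK₂.measurableSet).2 ?_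
        filter_upwards [ae_restrict_mem hU] with z hz using hz.2
      filter_upwards [Measure.quasiMeasurePreserving_fst.ae h1,
        Measure.quasiMeasurePreserving_snd.ae h2] with z hz1 hz2
      exact hM z ⟨hz1, hz2⟩
    have hi1 : Integrable c (α.prod β) :=
      Integrable.of_bound hc.measurable.aestronglyMeasurable M hbd
    have hi2 : Integrable c ((π U)⁻¹ • α.prod β) := hi1.smul_measure (ENNReal.inv_ne_top.2 hm)
    have hi3 : Integrable c (π.restrict Uᶜ + (π U)⁻¹ • α.prod β) :=
      hi.restrict.add_measure hi2
    have h0 := H _ hcp hi3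
    rw [integral_eq_zero_iff_of_nonneg hc0 hi3] at h0
    have h1 : (π.restrict Uᶜ + (π U)⁻¹ • α.prod β) N = 0 := h0
    simp only [Measure.add_apply, Measure.smul_apply, add_eq_zero, smul_eq_mul, mul_eq_zero,
      ENNReal.inv_eq_zero] at h1
    exact h1.2.resolve_left hmt
  have hsmall : ∀ (a : Measure X₁) (b : Measure X₂) [IsFiniteMeasure a] [IsFiniteMeasure b],
      (a.prod b) N ≤ a Set.univ * b Set.univ := by
    intro a b _ _
    refine (measure_mono (Set.subset_univ N)).trans ?_
    rw [← Set.univ_prod_univ, Measure.prod_prod]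
  rw [ENNReal.div_le_iff (by simp) (by simp)]
  have hb1 : (α.prod β') N ≤ 2 * η := by
    refine (hsmall _ _).trans ?_
    rw [mα, mβ']
    exact (mul_le_of_le_one_left' prob_le_one).trans hδ
  have hb2 : (α'.prod β) N ≤ 2 * η := by
    refine (hsmall _ _).trans ?_
    rw [mα', mβ]
    exact (mul_le_of_le_one_right' prob_le_one).trans hδ
  have hb3 : (α'.prod β') N ≤ 2 * η := by
    refine (hsmall _ _).trans ?_
    rw [mα', mβ']
    exact (mul_le_of_le_one_right' prob_le_one).trans hδ
  rw [← hμ₁, ← hμ₂, Measure.prod_add, Measure.add_prod, Measure.add_prod]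
  simp only [Measure.add_apply, hαβ, zero_add]
  calc _ ≤ 2 * η + (2 * η + 2 * η) := add_le_add hb2 (add_le_add hb1 hb3)
    _ = η * 6 := by ring

theorem integrable_of_ac {p L C : ℝ} (hp : 1 ≤ p) {c : X₁ × X₂ → ℝ} (hc : Continuous c)
    (hc0 : ∀ z, 0 ≤ c z) (hm₁ : HasFiniteMoment p μ₁) (hm₂ : HasFiniteMoment p μ₂)
    (hA : CondA p L C c μ₁ μ₂) {π τ : Measure (X₁ × X₂)} (hπ : IsCoupling π μ₁ μ₂)
    (hi : Integrable c π) (hτ : IsCoupling τ μ₁ μ₂) (hac : τ ≪ μ₁.prod μ₂) : Integrable c τ := by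
  by_contra hni
  have h := hac (zero_of_all_zero hc hc0 hπ hi
    fun σ hσ _ => zero_of_not_integrable hp hm₁ hm₂ hA hσ hτ hni)
  have h2 : c =ᵐ[τ] 0 := h
  exact hni ((integrable_congr h2).2 (integrable_zero _ _ _))

theorem narrow_of_cost_s3 {p : ℝ} (hp : 1 ≤ p) {π : Measure (X₁ × X₂)} [IsProbabilityMeasure π]
    {πs : ℕ → Measure (X₁ × X₂)} (hprob : ∀ k, IsProbabilityMeasure (πs k))
    {γ : ℕ → Measure ((X₁ × X₂) × (X₁ × X₂))} (hγ : ∀ k, IsCoupling (γ k) π (πs k))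
    (hlim : Tendsto (fun k => ∫⁻ w, pcost p w ∂(γ k)) atTop (𝓝 0)) : NarrowTendsto πs π := by
  have hp0 : 0 < p := by linarith
  have pγ : ∀ k, IsProbabilityMeasure (γ k) := fun k => coup_prob (hγ k)
  let P : ProbabilityMeasure (X₁ × X₂) := ⟨π, inferInstance⟩
  let Ps : ℕ → ProbabilityMeasure (X₁ × X₂) := fun k => ⟨πs k, hprob k⟩
  suffices h : Tendsto Ps atTop (𝓝 P) by
    intro f
    exact (ProbabilityMeasure.tendsto_iff_forall_integral_tendsto.1 h) f
  rw [tendsto_iff_forall_lipschitz_integral_tendsto]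
  rintro f ⟨B, hB⟩ ⟨K, hK⟩
  change Tendsto (fun k => ∫ z, f z ∂(πs k)) atTop (𝓝 (∫ z, f z ∂π))
  have hfm : Measurable f := hK.continuous.measurable
  have hfi : ∀ ν : Measure (X₁ × X₂), IsProbabilityMeasure ν → Integrable f ν := by
    intro ν hν
    obtain ⟨z₀⟩ := nonempty_of_isProbabilityMeasure ν
    refine Integrable.of_bound hfm.aestronglyMeasurable (B + ‖f z₀‖) (ae_of_all _ fun z => ?_)
    have := hB z z₀
    rw [dist_eq_norm] at this
    have h2 := norm_le_norm_add_norm_sub' (f z) (f z₀)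
    linarith
  have hem : Measurable (fun w : (X₁ × X₂) × (X₁ × X₂) => edist w.1 w.2) :=
    measurable_fst.edist measurable_snd
  have hbound : ∀ k, ‖∫ z, f z ∂(πs k) - ∫ z, f z ∂π‖ₑ ≤
      K * (∫⁻ w, pcost p w ∂(γ k)) ^ (1 / p) := by
    intro k
    have e1 : ∫ z, f z ∂π = ∫ w, f w.1 ∂(γ k) := by
      rw [← (hγ k).1, integral_map measurable_fst.aemeasurable hfm.aestronglyMeasurable]
    have e2 : ∫ z, f z ∂(πs k) = ∫ w, f w.2 ∂(γ k) := by
      rw [← (hγ k).2, integral_map measurable_snd.aemeasurable hfm.aestronglyMeasurable]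
    have i1 : Integrable (fun w => f w.1) (γ k) := by
      have := hfi π inferInstance
      rw [← (hγ k).1] at this
      exact this.comp_measurable measurable_fst
    have i2 : Integrable (fun w => f w.2) (γ k) := by
      have := hfi (πs k) (hprob k)
      rw [← (hγ k).2] at this
      exact this.comp_measurable measurable_snd
    rw [e1, e2, ← integral_sub i2 i1]
    refine (enorm_integral_le_lintegral_enorm _).trans ?_
    calc _ ≤ ∫⁻ w, K * edist w.1 w.2 ∂(γ k) := by
          refine lintegral_mono fun w => ?_
          rw [← edist_eq_enorm_sub, edist_comm]
          exact hK w.1 w.2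
      _ = K * ∫⁻ w, edist w.1 w.2 ∂(γ k) := lintegral_const_mul _ hem
      _ ≤ K * (∫⁻ w, edist w.1 w.2 ^ p ∂(γ k)) ^ (1 / p) := by
          have := eLpNorm'_le_eLpNorm'_of_exponent_le zero_lt_one hp (γ k)
            (f := fun w => edist w.1 w.2) hem.aestronglyMeasurable
          simp only [eLpNorm', enorm_eq_self, ENNReal.rpow_one, div_one] at this
          gcongr
      _ ≤ _ := by
          gcongr with w
          unfold pcost
          rw [Prod.edist_eq]
          rcases le_total (edist w.1.1 w.2.1) (edist w.1.2 w.2.2) with h | h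
          · rw [max_eq_right h]; exact le_add_self
          · rw [max_eq_left h]; exact le_self_add
  rw [tendsto_iff_edist_tendsto_0]
  have h3 := hlim.ennrpow_const (1 / p)
  rw [ENNReal.zero_rpow_of_pos (by positivity)] at h3
  have h4 : Tendsto (fun k => (K : ℝ≥0∞) * (∫⁻ w, pcost p w ∂(γ k)) ^ (1 / p)) atTop (𝓝 0) := by
    simpa using ENNReal.Tendsto.const_mul h3 (Or.inr ENNReal.coe_ne_top)
  refine tendsto_of_tendsto_of_tendsto_of_le_of_le tendsto_const_nhds h4 (fun _ => bot_le) ?_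
  intro k
  simp only [edist_eq_enorm_sub]
  exact hbound k

end Integrability

/-- The limsup inequality (existence of a recovery sequence) for the Tsallis entropic
regularized functionals, under `ε_k φ_q(k) → 0`. -/
theorem tsallis_limsup_inequality
    {X₁ : Type*} [MetricSpace X₁] [CompleteSpace X₁] [TopologicalSpace.SeparableSpace X₁]
    [MeasurableSpace X₁] [BorelSpace X₁]
    {X₂ : Type*} [MetricSpace X₂] [CompleteSpace X₂] [TopologicalSpace.SeparableSpace X₂]
    [MeasurableSpace X₂] [BorelSpace X₂]
    (p : ℝ) (hp : 1 ≤ p)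
    (μ₁ : Measure X₁) (μ₂ : Measure X₂)
    [IsProbabilityMeasure μ₁] [IsProbabilityMeasure μ₂]
    (hm₁ : HasFiniteMoment p μ₁) (hm₂ : HasFiniteMoment p μ₂)
    (q : ℝ) (hq₁ : 1 < q) (hq₂ : q ≤ 2)
    (c : X₁ × X₂ → ℝ) (hc : Continuous c) (hc0 : ∀ z, 0 ≤ c z)
    (L C : ℝ) (hL : 0 ≤ L) (hC : 0 ≤ C) (hA : CondA p L C c μ₁ μ₂)
    (ε : ℕ → ℝ) (hεpos : ∀ k, 0 < ε k) (hεlim : Tendsto ε atTop (𝓝 0))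
    (hεφ : Tendsto (fun k : ℕ => ε k * (((k : ℝ) ^ (q - 1) - 1) / (q - 1)))
      atTop (𝓝 0))
    (π : Measure (X₁ × X₂)) (hπ : IsCoupling π μ₁ μ₂) :
    ∃ πs : ℕ → Measure (X₁ × X₂),
      (∀ k, IsCoupling (πs k) μ₁ μ₂) ∧ NarrowTendsto πs π ∧
      limsup (fun k =>
          ∫⁻ z, ENNReal.ofReal (c z) ∂(πs k)
            + ENNReal.ofReal (ε k) * tsallisDiv q (πs k) (μ₁.prod μ₂)) atTop
        ≤ ∫⁻ z, ENNReal.ofReal (c z) ∂π := by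
  have sc₁ : SecondCountableTopology X₁ := UniformSpace.secondCountable_of_separable X₁
  have sc₂ : SecondCountableTopology X₂ := UniformSpace.secondCountable_of_separable X₂
  have hp0 : 0 < p := by linarith
  have pπ := coup_prob hπ
  have hr : 0 < q - 1 := by linarith
  obtain ⟨x₀, hx₀⟩ := id hm₁
  have : Nonempty X₁ := ⟨x₀⟩
  -- a dense sequence starting at `x₀`
  let e : ℕ → X₁ := fun k => Nat.casesOn k x₀ (TopologicalSpace.denseSeq X₁)
  have he : ∀ x, x ∈ closure (Set.range e) := by
    intro x
    refine closure_mono ?_ (TopologicalSpace.denseRange_denseSeq X₁ x)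
    rintro _ ⟨k, rfl⟩
    exact ⟨k + 1, rfl⟩
  let T : ℕ → X₁ → ℕ := fun k => SimpleFunc.nearestPtInd e (k - 1)
  have hT : ∀ k, Measurable (T k) := fun k => (SimpleFunc.nearestPtInd e (k - 1)).measurable
  have hn : ∀ k x, T k x < k - 1 + 1 :=
    fun k x => Nat.lt_succ_of_le (SimpleFunc.nearestPtInd_le e (k - 1) x)
  let γ : ℕ → Measure ((X₁ × X₂) × (X₁ × X₂)) := fun k => blockG μ₁ π (T k) (k - 1 + 1)
  let πs : ℕ → Measure (X₁ × X₂) := fun k => (γ k).map Prod.snd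
  have hcp : ∀ k, IsCoupling (πs k) μ₁ μ₂ := fun k => block_coupling_s3 hπ (hT k) (hn k)
  have hprob : ∀ k, IsProbabilityMeasure (πs k) := fun k => coup_prob (hcp k)
  have hγ : ∀ k, IsCoupling (γ k) π (πs k) := fun k => ⟨blockG_map_fst hπ (hT k) (hn k), rfl⟩
  -- quantization error
  have hF : Tendsto (fun k => ∫⁻ x, edist (SimpleFunc.nearestPt e k x) x ^ p ∂μ₁) atTop (𝓝 0) := by
    have h0 : ∫⁻ _ : X₁, (0 : ℝ≥0∞) ∂μ₁ = 0 := by simp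
    rw [← h0]
    refine tendsto_lintegral_of_dominated_convergence (fun x => edist x x₀ ^ p) ?_ ?_ hx₀ ?_
    · intro k
      exact ((SimpleFunc.nearestPt e k).measurable.edist measurable_id).pow_const p
    · intro k
      refine ae_of_all _ fun x => ENNReal.rpow_le_rpow ?_ hp0.le
      rw [edist_comm x x₀]
      exact SimpleFunc.edist_nearestPt_le e x (Nat.zero_le k)
    · refine ae_of_all _ fun x => ?_
      have h1 := tendsto_iff_edist_tendsto_0.1 (SimpleFunc.tendsto_nearestPt (he x))
      have h2 := h1.ennrpow_const p
      rwa [ENNReal.zero_rpow_of_pos hp0] at h2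
  have hcost : Tendsto (fun k => ∫⁻ w, pcost p w ∂(γ k)) atTop (𝓝 0) := by
    have h1 := hF.comp (tendsto_sub_atTop_nat 1)
    have h2 : (2 : ℝ≥0∞) ^ (p - 1) ≠ ⊤ := ENNReal.rpow_ne_top_of_nonneg (by linarith) (by simp)
    have h3 := ENNReal.Tendsto.const_mul (h1.add h1) (Or.inr h2)
    rw [add_zero, mul_zero] at h3
    exact tendsto_of_tendsto_of_tendsto_of_le_of_le tendsto_const_nhds h3 (fun _ => bot_le)
      fun k => block_cost hπ (hT k) (hn k) hp e
  refine ⟨πs, hcp, narrow_of_cost_s3 hp hprob hγ hcost, ?_⟩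
  by_cases hi : Integrable c π
  swap
  · have : ∫⁻ z, ENNReal.ofReal (c z) ∂π = ⊤ := by
      by_contra h
      exact hi ((lintegral_ofReal_ne_top_iff_integrable hc.measurable.aestronglyMeasurable
        (ae_of_all _ hc0)).1 h)
    rw [this]; exact le_top
  have hik : ∀ k, Integrable c (πs k) := fun k =>
    integrable_of_ac hp hc hc0 hm₁ hm₂ hA hπ hi (hcp k) (block_dens hπ (hT k) (hn k)).1
  have hW : Tendsto (fun k => L * (WpProd p π (πs k)).toReal) atTop (𝓝 0) := by
    have h3 := hcost.ennrpow_const (1 / p)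
    rw [ENNReal.zero_rpow_of_pos (by positivity)] at h3
    have h4 : Tendsto (fun k => WpProd p π (πs k)) atTop (𝓝 0) :=
      tendsto_of_tendsto_of_tendsto_of_le_of_le tendsto_const_nhds h3 (fun _ => bot_le)
        fun k => WpProd_le (hγ k)
    have h5 := (ENNReal.tendsto_toReal ENNReal.zero_ne_top).comp h4
    simpa using h5.const_mul L
  have hint : Tendsto (fun k => ∫ z, c z ∂(πs k)) atTop (𝓝 (∫ z, c z ∂π)) := by
    rw [tendsto_iff_dist_tendsto_zero]
    refine squeeze_zero (fun _ => dist_nonneg) (fun k => ?_) hW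
    rw [dist_comm, Real.dist_eq]
    exact condA_self hp hm₁ hm₂ hA hπ (hcp k)
  have hlint : ∀ k, ∫⁻ z, ENNReal.ofReal (c z) ∂(πs k) = ENNReal.ofReal (∫ z, c z ∂(πs k)) :=
    fun k => (ofReal_integral_eq_lintegral_ofReal (hik k) (ae_of_all _ hc0)).symm
  have hub : Tendsto (fun k : ℕ => ENNReal.ofReal (∫ z, c z ∂(πs k)) +
      ENNReal.ofReal (ε k * (((k : ℝ) ^ (q - 1) - 1) / (q - 1)))) atTop
      (𝓝 (∫⁻ z, ENNReal.ofReal (c z) ∂π)) := by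
    rw [← ofReal_integral_eq_lintegral_ofReal hi (ae_of_all _ hc0)]
    simpa using (ENNReal.tendsto_ofReal hint).add (ENNReal.tendsto_ofReal hεφ)
  rw [← hub.limsup_eq]
  refine limsup_le_limsup ?_
  filter_upwards [eventually_ge_atTop 1] with k hk
  rw [hlint k, ENNReal.ofReal_mul (hεpos k).le]
  have hent := block_entropy hπ (hT k) (hn k) hq₁ hq₂
  rw [Nat.sub_add_cancel hk] at hent
  gcongr
  simpa only [πs, γ, Nat.sub_add_cancel hk] using hent

end
end

section
/- Let X₁ and X₂ be Polish metric spaces, μᵢ probability measures on Xᵢ, c: X₁ × X₂ → [0,∞) continuous with ∫ c d(μ₁⊗μ₂) < ∞, 1 < q ≤ 2, and ε > 0. Then the functional π ↦ ∫ c dπ + ε D_q(π, μ₁⊗μ₂) attains its infimum over Π(μ₁,μ₂), and the minimizer is unique. -/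
open MeasureTheory Filter Topology
open scoped ENNReal Classical

noncomputable section

lemma ptwise_gap (q : ℝ) (hq : 1 < q) (δ : ℝ) (hδ : 0 < δ) :
    ∃ C : ℝ, 0 < C ∧ ∀ a b : ℝ, 0 ≤ a → 0 ≤ b →
      |a - b| + C * ((a + b) / 2) ^ q ≤ C * ((a ^ q + b ^ q) / 2) + δ * (1 + a + b) := by
  have hq0 : 0 < q := by linarith
  -- convexity of the power
  have hconv : ∀ a b : ℝ, 0 ≤ a → 0 ≤ b → ((a + b) / 2) ^ q ≤ (a ^ q + b ^ q) / 2 := by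
    intro a b ha hb
    have := (strictConvexOn_rpow hq).convexOn.2 (Set.mem_Ici.2 ha) (Set.mem_Ici.2 hb)
      (by norm_num : (0 : ℝ) ≤ 1 / 2) (by norm_num : (0 : ℝ) ≤ 1 / 2) (by norm_num)
    simp only [smul_eq_mul] at this
    have e : 1 / 2 * a + 1 / 2 * b = (a + b) / 2 := by ring
    rw [e] at this
    linarith
  obtain ⟨κ, hκ, hg⟩ : ∃ κ : ℝ, 0 < κ ∧ ∀ t ∈ Set.Icc δ 1,
      κ ≤ ((1 + t) ^ q + (1 - t) ^ q) / 2 - 1 := by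
    rcases (Set.Icc δ (1:ℝ)).eq_empty_or_nonempty with h | h
    · exact ⟨1, one_pos, by simp [h]⟩
    · have hcont : Continuous (fun t : ℝ => ((1 + t) ^ q + (1 - t) ^ q) / 2 - 1) := by
        have h1 : Continuous (fun t : ℝ => (1 + t) ^ q) :=
          (Real.continuous_rpow_const hq0.le).comp (by fun_prop)
        have h2 : Continuous (fun t : ℝ => (1 - t) ^ q) :=
          (Real.continuous_rpow_const hq0.le).comp (by fun_prop)
        fun_prop
      obtain ⟨t, ht, hmin⟩ := isCompact_Icc.exists_isMinOn h hcont.continuousOn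
      refine ⟨_, ?_, fun s hs => hmin hs⟩
      have hp1 : 1 + t ∈ Set.Ici (0 : ℝ) := by simp only [Set.mem_Ici]; linarith [ht.1]
      have hp2 : 1 - t ∈ Set.Ici (0 : ℝ) := by simp only [Set.mem_Ici]; linarith [ht.2]
      have := (strictConvexOn_rpow hq).2 hp1 hp2 (by intro h; linarith [ht.1])
        (by norm_num : (0 : ℝ) < 1 / 2) (by norm_num : (0 : ℝ) < 1 / 2) (by norm_num)
      simp only [smul_eq_mul] at this
      have e : 1 / 2 * (1 + t) + 1 / 2 * (1 - t) = 1 := by ring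
      rw [e, Real.one_rpow] at this
      linarith
  -- the constant
  set C : ℝ := 2 * (δ / 2) ^ (1 - q) / κ with hC
  have hCpos : 0 < C := by positivity
  refine ⟨C, hCpos, ?_⟩
  have main : ∀ a b : ℝ, 0 ≤ b → b ≤ a →
      (a - b) + C * ((a + b) / 2) ^ q ≤ C * ((a ^ q + b ^ q) / 2) + δ * (1 + a + b) := by
    intro a b hb hab
    have ha : 0 ≤ a := hb.trans hab
    have hc := mul_le_mul_of_nonneg_left (hconv a b ha hb) hCpos.le
    by_cases h1 : a - b ≤ δ * (1 + a + b)
    · linarith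
    push Not at h1
    have hδab : 0 ≤ δ * (a + b) := by positivity
    have hm : δ / 2 < (a + b) / 2 := by nlinarith
    set m := (a + b) / 2 with hmdef
    have hm0 : 0 < m := by linarith
    set t := (a - b) / (2 * m) with ht
    have ht1 : t ≤ 1 := by
      rw [ht, div_le_one (by positivity)]; linarith
    have ht2 : δ ≤ t := by
      rw [ht, le_div_iff₀ (by positivity)]; nlinarith
    have hae : a = m * (1 + t) := by rw [ht]; field_simp; rw [hmdef]; ring
    have hbe : b = m * (1 - t) := by rw [ht]; field_simp; rw [hmdef]; ring
    have hA : a ^ q = m ^ q * (1 + t) ^ q := by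
      rw [hae, Real.mul_rpow hm0.le (by linarith)]
    have hB : b ^ q = m ^ q * (1 - t) ^ q := by
      rw [hbe, Real.mul_rpow hm0.le (by linarith)]
    have hk := hg t ⟨ht2, ht1⟩
    have hmq : 0 < m ^ q := by positivity
    have h3 : m ^ q * κ ≤ (a ^ q + b ^ q) / 2 - m ^ q := by
      rw [hA, hB]; nlinarith
    have h4 : m ≤ (δ / 2) ^ (1 - q) * m ^ q := by
      have h5 : m ^ (1 - q) ≤ (δ / 2) ^ (1 - q) :=
        Real.rpow_le_rpow_of_nonpos (by positivity) hm.le (by linarith)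
      calc m = m ^ (1 - q) * m ^ q := by
            rw [← Real.rpow_add hm0]; simp
        _ ≤ _ := by gcongr
    have h6 : C * (m ^ q * κ) = 2 * ((δ / 2) ^ (1 - q) * m ^ q) := by
      rw [hC]; field_simp
    have h7 := mul_le_mul_of_nonneg_left h3 hCpos.le
    have : a - b ≤ 2 * m := by linarith
    nlinarith
  intro a b ha hb
  rcases le_total b a with h | h
  · rw [abs_of_nonneg (by linarith)]; exact main a b hb h
  · rw [abs_of_nonpos (by linarith)]
    have := main b a ha h
    rw [add_comm b a] at this
    linarith

lemma lintegral_gap {Z : Type*} [MeasurableSpace Z] (ν : Measure Z) [IsProbabilityMeasure ν]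
    (c : Z → ℝ) (hcm : Measurable c) (hc0 : ∀ z, 0 ≤ c z) (A : ℝ) (hA : 0 < A)
    (q : ℝ) (hq : 1 < q) (δ : ℝ) (hδ : 0 < δ) :
    ∃ C : ℝ, 0 < C ∧ ∀ f g : Lp ℝ 1 ν, 0 ≤ᵐ[ν] f → 0 ≤ᵐ[ν] g →
      ∫ z, f z ∂ν ≤ 1 → ∫ z, g z ∂ν ≤ 1 →
      edist f g + ENNReal.ofReal C *
          ∫⁻ z, ENNReal.ofReal (c z * ((f z + g z) / 2) + A * ((f z + g z) / 2) ^ q) ∂ν ≤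
      ENNReal.ofReal (C / 2) * (∫⁻ z, ENNReal.ofReal (c z * f z + A * f z ^ q) ∂ν +
        ∫⁻ z, ENNReal.ofReal (c z * g z + A * g z ^ q) ∂ν) + ENNReal.ofReal (3 * δ) := by
  obtain ⟨C, hC, h⟩ := ptwise_gap q hq δ hδ
  refine ⟨C / A, by positivity, ?_⟩
  intro f g hf hg hf1 hg1
  have mf : Measurable f := (Lp.stronglyMeasurable f).measurable
  have mg : Measurable g := (Lp.stronglyMeasurable g).measurable
  have hfi : Integrable f ν := L1.integrable_coeFn f
  have hgi : Integrable g ν := L1.integrable_coeFn g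
  have hd : edist f g = ∫⁻ z, ENNReal.ofReal |f z - g z| ∂ν := by
    rw [L1.edist_def]
    simp_rw [edist_dist, Real.dist_eq]
  have h3 : ∫⁻ z, ENNReal.ofReal (δ * (1 + f z + g z)) ∂ν ≤ ENNReal.ofReal (3 * δ) := by
    have hi : Integrable (fun z => δ * (1 + f z + g z)) ν :=
      (((integrable_const 1).add hfi).add hgi).const_mul δ
    rw [← ofReal_integral_eq_lintegral_ofReal hi]
    · apply ENNReal.ofReal_le_ofReal
      have h1f : Integrable (fun z => 1 + f z) ν := (integrable_const 1).add hfi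
      rw [integral_const_mul, integral_add h1f hgi,
        integral_add (integrable_const 1) hfi]
      simp
      nlinarith
    · filter_upwards [hf, hg] with z h1 h2
      simp only [Pi.zero_apply] at *
      positivity
  have hp : ∀ F : Z → ℝ, Measurable F →
      Measurable (fun z => ENNReal.ofReal (c z * F z + A * F z ^ q)) := by
    intro F hF
    fun_prop
  rw [hd]
  refine le_trans ?_ (add_le_add le_rfl h3)
  rw [← lintegral_const_mul _ (hp _ (by fun_prop)), ← lintegral_add_left (by fun_prop),
    ← lintegral_add_left (hp f mf), ← lintegral_const_mul _ (by fun_prop),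
    ← lintegral_add_left (by fun_prop)]
  apply lintegral_mono_ae
  filter_upwards [hf, hg] with z h1 h2
  simp only [Pi.zero_apply] at h1 h2
  have := h (f z) (g z) h1 h2
  have hcz := hc0 z
  rw [← ENNReal.ofReal_mul (by positivity), ← ENNReal.ofReal_add (by positivity) (by positivity),
    ← ENNReal.ofReal_add (by positivity) (by positivity),
    ← ENNReal.ofReal_mul (by positivity), ← ENNReal.ofReal_add (by positivity) (by positivity)]
  apply ENNReal.ofReal_le_ofReal
  have e1 : C / A * (c z * ((f z + g z) / 2) + A * ((f z + g z) / 2) ^ q)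
    = C / A * (c z * ((f z + g z) / 2)) + C * ((f z + g z) / 2) ^ q := by field_simp
  have e2 : C / A / 2 * (c z * f z + A * f z ^ q + (c z * g z + A * g z ^ q))
    = C / A * (c z * ((f z + g z) / 2)) + C * ((f z ^ q + g z ^ q) / 2) := by field_simp; ring
  rw [e1, e2]
  linarith

lemma exists_min_L1 {Z : Type*} [MeasurableSpace Z] (ν : Measure Z) [IsProbabilityMeasure ν]
    (c : Z → ℝ) (hcm : Measurable c) (hc0 : ∀ z, 0 ≤ c z) (A : ℝ) (hA : 0 < A)
    (q : ℝ) (hq : 1 < q) (K : Set (Lp ℝ 1 ν)) (hKc : IsClosed K)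
    (hKm : ∀ f ∈ K, ∀ g ∈ K, (1 / 2 : ℝ) • (f + g) ∈ K)
    (hK0 : ∀ f ∈ K, 0 ≤ᵐ[ν] f) (hK1 : ∀ f ∈ K, ∫ z, f z ∂ν ≤ 1)
    (J : Lp ℝ 1 ν → ℝ≥0∞)
    (hJ : ∀ f, J f = ∫⁻ z, ENNReal.ofReal (c z * f z + A * f z ^ q) ∂ν)
    (hne : ∃ f ∈ K, J f ≠ ⊤) :
    ∃ f ∈ K, J f ≠ ⊤ ∧ (∀ g ∈ K, J f ≤ J g) ∧ ∀ g ∈ K, J g ≤ J f → g = f := by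
  set L : ℝ≥0∞ := ⨅ f ∈ K, J f with hL
  have hLle : ∀ f ∈ K, L ≤ J f := fun f hf => iInf₂_le f hf
  have hLtop : L ≠ ⊤ := by
    obtain ⟨f, hf, hf'⟩ := hne
    exact ne_top_of_le_ne_top hf' (hLle f hf)
  have key : ∀ e : ℝ, 0 < e → ∃ η : ℝ, 0 < η ∧ ∀ f ∈ K, ∀ g ∈ K,
      J f ≤ L + ENNReal.ofReal η → J g ≤ L + ENNReal.ofReal η → edist f g ≤ ENNReal.ofReal e := by
    intro e he
    obtain ⟨C, hC, h⟩ := lintegral_gap ν c hcm hc0 A hA q hq (e / 6) (by positivity)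
    refine ⟨e / (2 * C), by positivity, ?_⟩
    intro f hf g hg hJf hJg
    have h1 := h f g (hK0 f hf) (hK0 g hg) (hK1 f hf) (hK1 g hg)
    have hm : ∫⁻ z, ENNReal.ofReal (c z * ((f z + g z) / 2) + A * ((f z + g z) / 2) ^ q) ∂ν
        = J ((1 / 2 : ℝ) • (f + g)) := by
      rw [hJ]
      apply lintegral_congr_ae
      filter_upwards [Lp.coeFn_smul (1 / 2 : ℝ) (f + g), Lp.coeFn_add f g] with z h1 h2
      rw [h1, Pi.smul_apply, h2, Pi.add_apply, smul_eq_mul]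
      congr 3 <;> ring_nf
    rw [hm, ← hJ, ← hJ] at h1
    have h2 : edist f g + ENNReal.ofReal C * L ≤ ENNReal.ofReal e + ENNReal.ofReal C * L := by
      calc edist f g + ENNReal.ofReal C * L
          ≤ edist f g + ENNReal.ofReal C * J ((1 / 2 : ℝ) • (f + g)) := by
            gcongr; exact hLle _ (hKm f hf g hg)
        _ ≤ _ := h1
        _ ≤ ENNReal.ofReal (C / 2) * ((L + ENNReal.ofReal (e / (2 * C))) +
              (L + ENNReal.ofReal (e / (2 * C)))) + ENNReal.ofReal (3 * (e / 6)) := by gcongr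
        _ = ENNReal.ofReal e + ENNReal.ofReal C * L := by
            lift L to NNReal using hLtop with l hl
            rw [← ENNReal.ofReal_coe_nnreal]
            have hl0 : (0 : ℝ) ≤ l := l.2
            rw [← ENNReal.ofReal_mul (by positivity),
              ← ENNReal.ofReal_add (by positivity) (by positivity),
              ← ENNReal.ofReal_add (by positivity) (by positivity),
              ← ENNReal.ofReal_add (by positivity) (by positivity),
              ← ENNReal.ofReal_mul (by positivity),
              ← ENNReal.ofReal_add (by positivity) (by positivity)]
            congr 1
            field_simp
            ring
    exact (ENNReal.add_le_add_iff_right (ENNReal.mul_ne_top ENNReal.ofReal_ne_top hLtop)).1 h2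
  have hseq : ∀ n : ℕ, ∃ f ∈ K, J f ≤ L + ENNReal.ofReal (1 / ((n : ℝ) + 1)) := by
    intro n
    have : L < L + ENNReal.ofReal (1 / ((n : ℝ) + 1)) :=
      ENNReal.lt_add_right hLtop (by
        have : 0 < ENNReal.ofReal (1 / ((n : ℝ) + 1)) := ENNReal.ofReal_pos.2 (by positivity)
        exact this.ne')
    rw [hL] at this
    simp only [iInf_lt_iff] at this
    obtain ⟨f, hf, h⟩ := this
    exact ⟨f, hf, h.le⟩
  choose u huK hu using hseq
  have hto0 : Tendsto (fun n : ℕ => 1 / ((n : ℝ) + 1)) atTop (𝓝 0) :=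
    tendsto_one_div_add_atTop_nhds_zero_nat
  have hcau : CauchySeq u := by
    rw [EMetric.cauchySeq_iff]
    intro e he
    obtain ⟨e', he', hee⟩ : ∃ e' : ℝ, 0 < e' ∧ ENNReal.ofReal e' < e := by
      obtain ⟨r, hr, hr'⟩ := ENNReal.lt_iff_exists_nnreal_btwn.1 he
      exact ⟨r, by exact_mod_cast hr, by simpa using hr'⟩
    obtain ⟨η, hη, h⟩ := key e' he'
    obtain ⟨N, hN⟩ := eventually_atTop.1 (hto0.eventually (gt_mem_nhds hη))
    refine ⟨N, fun m hm n hn => lt_of_le_of_lt (h _ (huK m) _ (huK n) ?_ ?_) hee⟩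
    · refine (hu m).trans ?_
      gcongr
      exact (hN m hm).le
    · refine (hu n).trans ?_
      gcongr
      exact (hN n hn).le
  obtain ⟨f, hf⟩ := cauchySeq_tendsto_of_complete hcau
  have hfK : f ∈ K := hKc.mem_of_tendsto hf (Eventually.of_forall huK)
  have hJf : J f ≤ L := by
    obtain ⟨ns, hns, hae⟩ := (tendstoInMeasure_of_tendsto_Lp hf).exists_seq_tendsto_ae
    have hcontA : ∀ z, Continuous (fun x : ℝ => ENNReal.ofReal (c z * x + A * x ^ q)) := by
      intro z
      have : Continuous (fun x : ℝ => x ^ q) := Real.continuous_rpow_const (by linarith)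
      exact ENNReal.continuous_ofReal.comp (by fun_prop)
    have hp : ∀ g : Lp ℝ 1 ν,
        Measurable (fun z => ENNReal.ofReal (c z * g z + A * g z ^ q)) := by
      intro g
      have mg : Measurable g := (Lp.stronglyMeasurable g).measurable
      fun_prop
    calc J f = ∫⁻ z, liminf (fun k => ENNReal.ofReal
              (c z * u (ns k) z + A * u (ns k) z ^ q)) atTop ∂ν := by
          rw [hJ]
          apply lintegral_congr_ae
          filter_upwards [hae] with z hz
          exact (((hcontA z).tendsto _).comp hz).liminf_eq.symm
      _ ≤ liminf (fun k => ∫⁻ z, ENNReal.ofReal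
              (c z * u (ns k) z + A * u (ns k) z ^ q) ∂ν) atTop :=
          lintegral_liminf_le (fun k => hp _)
      _ ≤ liminf (fun k => L + ENNReal.ofReal (1 / ((ns k : ℝ) + 1))) atTop := by
          refine liminf_le_liminf (Eventually.of_forall fun k => ?_)
          rw [← hJ]
          exact hu (ns k)
      _ = L := by
          apply Tendsto.liminf_eq
          have := (ENNReal.tendsto_ofReal (hto0.comp hns.tendsto_atTop)).const_add L
          simpa using this
  refine ⟨f, hfK, ne_top_of_le_ne_top hLtop hJf, fun g hg => hJf.trans (hLle g hg), ?_⟩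
  intro g hg hgf
  rw [← edist_le_zero]
  refine le_of_forall_gt_imp_ge_of_dense fun e he => ?_
  obtain ⟨r, hr, hr'⟩ := ENNReal.lt_iff_exists_nnreal_btwn.1 he
  obtain ⟨η, hη, h⟩ := key r (by exact_mod_cast hr)
  refine (h g hg f hfK ((hgf.trans hJf).trans le_self_add) (hJf.trans le_self_add)).trans ?_
  simpa using hr'.le

lemma value_eq {Z : Type*} [MeasurableSpace Z] (ν : Measure Z) [IsProbabilityMeasure ν]
    (c : Z → ℝ) (hcm : Measurable c) (hc0 : ∀ z, 0 ≤ c z)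
    (q : ℝ) (hq : 1 < q) (ε : ℝ) (hε : 0 < ε) (g : Z → ℝ) (hg : Measurable g)
    (hg0 : 0 ≤ᵐ[ν] g) (hg1 : ∫⁻ z, ENNReal.ofReal (g z) ∂ν = 1) :
    (∫⁻ z, ENNReal.ofReal (c z) ∂(ν.withDensity fun z => ENNReal.ofReal (g z))
      + ENNReal.ofReal ε * tsallisDiv q (ν.withDensity fun z => ENNReal.ofReal (g z)) ν)
      + ENNReal.ofReal (ε / (q - 1)) =
    ∫⁻ z, ENNReal.ofReal (c z * g z + ε / (q - 1) * g z ^ q) ∂ν := by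
  have hq0 : 0 < q - 1 := by linarith
  have hA : 0 < ε / (q - 1) := by positivity
  have mg : Measurable fun z => ENNReal.ofReal (g z) := by fun_prop
  have hrn := Measure.rnDeriv_withDensity ν mg
  set I : ℝ≥0∞ := ∫⁻ z, ENNReal.ofReal (g z ^ q) ∂ν with hI
  have hI' : ∫⁻ z, (ν.withDensity fun z => ENNReal.ofReal (g z)).rnDeriv ν z ^ q ∂ν = I := by
    apply lintegral_congr_ae
    filter_upwards [hrn, hg0] with z h1 h2
    rw [h1, ENNReal.ofReal_rpow_of_nonneg h2 (by linarith)]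
  have hI1 : ∫⁻ z, (ν.withDensity fun z => ENNReal.ofReal (g z)).rnDeriv ν z ∂ν = 1 := by
    rw [lintegral_congr_ae hrn, hg1]
  have hIge : 1 ≤ I := by
    have h1 : ∫⁻ z, ENNReal.ofReal q * ENNReal.ofReal (g z) ∂ν ≤
        ∫⁻ z, (ENNReal.ofReal (g z ^ q) + ENNReal.ofReal (q - 1)) ∂ν := by
      apply lintegral_mono_ae
      filter_upwards [hg0] with z h2
      simp only [Pi.zero_apply] at h2
      rw [← ENNReal.ofReal_mul (by linarith),
        ← ENNReal.ofReal_add (by positivity) (by linarith)]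
      apply ENNReal.ofReal_le_ofReal
      have := one_add_mul_self_le_rpow_one_add (s := g z - 1) (by linarith) hq.le
      rw [show 1 + (g z - 1) = g z by ring] at this
      linarith
    rw [lintegral_const_mul _ mg, hg1, lintegral_add_right _ measurable_const,
      lintegral_const, measure_univ, mul_one, mul_one] at h1
    have h2 : ENNReal.ofReal q = 1 + ENNReal.ofReal (q - 1) := by
      rw [← ENNReal.ofReal_one, ← ENNReal.ofReal_add (by norm_num) (by linarith)]
      congr 1; ring
    rw [h2] at h1
    exact (ENNReal.add_le_add_iff_right ENNReal.ofReal_ne_top).1 h1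
  have hR : ∫⁻ z, ENNReal.ofReal (c z * g z + ε / (q - 1) * g z ^ q) ∂ν =
      ∫⁻ z, ENNReal.ofReal (c z * g z) ∂ν + ENNReal.ofReal (ε / (q - 1)) * I := by
    rw [hI, ← lintegral_const_mul _ (by fun_prop), ← lintegral_add_left (by fun_prop)]
    apply lintegral_congr_ae
    filter_upwards [hg0] with z h2
    simp only [Pi.zero_apply] at h2
    have := hc0 z
    rw [← ENNReal.ofReal_mul hA.le, ENNReal.ofReal_add (by positivity) (by positivity)]
  have hc1 : ∫⁻ z, ENNReal.ofReal (c z) ∂(ν.withDensity fun z => ENNReal.ofReal (g z)) =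
      ∫⁻ z, ENNReal.ofReal (c z * g z) ∂ν := by
    rw [lintegral_withDensity_eq_lintegral_mul _ mg (by fun_prop)]
    apply lintegral_congr
    intro z
    rw [Pi.mul_apply, mul_comm, ENNReal.ofReal_mul (hc0 z)]
  rw [hR, hc1, tsallisDiv, if_pos (withDensity_absolutelyContinuous _ _), hI', hI1, add_assoc]
  congr 1
  rw [ENNReal.ofReal_div_of_pos hq0, div_eq_mul_inv, div_eq_mul_inv, mul_comm (I - 1), ← mul_assoc]
  nth_rewrite 2 [← mul_one (ENNReal.ofReal ε * (ENNReal.ofReal (q - 1))⁻¹)]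
  rw [← mul_add, tsub_add_cancel_of_le hIge]

lemma map_withDensity_iff {Z X : Type*} [MeasurableSpace Z] [MeasurableSpace X]
    (ν : Measure Z) (μ : Measure X) [IsProbabilityMeasure μ] (p : Z → X) (hp : Measurable p)
    (g : Z → ℝ) (hg : Integrable g ν) (hg0 : 0 ≤ᵐ[ν] g) :
    (ν.withDensity fun z => ENNReal.ofReal (g z)).map p = μ ↔
      ∀ s, MeasurableSet s → ∫ z in p ⁻¹' s, g z ∂ν = (μ s).toReal := by
  have h : ∀ s, MeasurableSet s → (ν.withDensity fun z => ENNReal.ofReal (g z)).map p s =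
      ENNReal.ofReal (∫ z in p ⁻¹' s, g z ∂ν) := by
    intro s hs
    rw [Measure.map_apply hp hs, withDensity_apply _ (hp hs),
      ofReal_integral_eq_lintegral_ofReal hg.integrableOn (ae_restrict_of_ae hg0)]
  constructor
  · intro h1 s hs
    rw [← h1, h s hs, ENNReal.toReal_ofReal]
    exact integral_nonneg_of_ae (ae_restrict_of_ae hg0)
  · intro h1
    ext s hs
    rw [h s hs, h1 s hs, ENNReal.ofReal_toReal (measure_ne_top _ _)]

/-- The Tsallis entropic regularized optimal transport problem admits a unique minimizer. -/
theorem tsallis_exists_unique_minimizer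
    {X₁ : Type*} [MetricSpace X₁] [CompleteSpace X₁] [TopologicalSpace.SeparableSpace X₁]
    [MeasurableSpace X₁] [BorelSpace X₁]
    {X₂ : Type*} [MetricSpace X₂] [CompleteSpace X₂] [TopologicalSpace.SeparableSpace X₂]
    [MeasurableSpace X₂] [BorelSpace X₂]
    (μ₁ : Measure X₁) (μ₂ : Measure X₂)
    [IsProbabilityMeasure μ₁] [IsProbabilityMeasure μ₂]
    (c : X₁ × X₂ → ℝ) (hc : Continuous c) (hc0 : ∀ z, 0 ≤ c z)
    (hcint : ∫⁻ z, ENNReal.ofReal (c z) ∂(μ₁.prod μ₂) ≠ ⊤)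
    (q : ℝ) (hq₁ : 1 < q) (hq₂ : q ≤ 2) (ε : ℝ) (hε : 0 < ε) :
    ∃! π : Measure (X₁ × X₂), IsCoupling π μ₁ μ₂ ∧
      ∀ π' : Measure (X₁ × X₂), IsCoupling π' μ₁ μ₂ →
        ∫⁻ z, ENNReal.ofReal (c z) ∂π + ENNReal.ofReal ε * tsallisDiv q π (μ₁.prod μ₂)
          ≤ ∫⁻ z, ENNReal.ofReal (c z) ∂π'
            + ENNReal.ofReal ε * tsallisDiv q π' (μ₁.prod μ₂) := by
  set ν := μ₁.prod μ₂ with hν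
  have hcm : Measurable c := hc.measurable
  have hq0 : 0 < q - 1 := by linarith
  set A : ℝ := ε / (q - 1) with hAdef
  have hA : 0 < A := by positivity
  set K : Set (Lp ℝ 1 ν) := {f | 0 ≤ f ∧
    (∀ s, MeasurableSet s → ∫ z in Prod.fst ⁻¹' s, f z ∂ν = (μ₁ s).toReal) ∧
    (∀ s, MeasurableSet s → ∫ z in Prod.snd ⁻¹' s, f z ∂ν = (μ₂ s).toReal)} with hK
  set J : Lp ℝ 1 ν → ℝ≥0∞ :=
    fun f => ∫⁻ z, ENNReal.ofReal (c z * f z + A * f z ^ q) ∂ν with hJ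
  set V : Measure (X₁ × X₂) → ℝ≥0∞ := fun π =>
    ∫⁻ z, ENNReal.ofReal (c z) ∂π + ENNReal.ofReal ε * tsallisDiv q π ν with hV
  have hKc : IsClosed K := by
    simp only [hK, Set.setOf_and, Set.setOf_forall]
    refine isClosed_Ici.inter (IsClosed.inter ?_ ?_)
    · exact isClosed_iInter fun s => isClosed_iInter fun _ =>
        isClosed_eq (continuous_setIntegral _) continuous_const
    · exact isClosed_iInter fun s => isClosed_iInter fun _ =>
        isClosed_eq (continuous_setIntegral _) continuous_const
  have hmid : ∀ (f g : Lp ℝ 1 ν) (S : Set (X₁ × X₂)),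
      ∫ z in S, ((1 / 2 : ℝ) • (f + g) : Lp ℝ 1 ν) z ∂ν =
        1 / 2 * (∫ z in S, f z ∂ν + ∫ z in S, g z ∂ν) := by
    intro f g S
    rw [← integral_add (L1.integrable_coeFn f).integrableOn (L1.integrable_coeFn g).integrableOn,
      ← integral_const_mul]
    apply integral_congr_ae
    apply ae_restrict_of_ae
    filter_upwards [Lp.coeFn_smul (1 / 2 : ℝ) (f + g), Lp.coeFn_add f g] with z h1 h2
    rw [h1, Pi.smul_apply, h2, Pi.add_apply, smul_eq_mul]
  have hKm : ∀ f ∈ K, ∀ g ∈ K, (1 / 2 : ℝ) • (f + g) ∈ K := by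
    intro f hf g hg
    refine ⟨?_, ?_, ?_⟩
    · rw [← Lp.coeFn_nonneg]
      filter_upwards [Lp.coeFn_smul (1 / 2 : ℝ) (f + g), Lp.coeFn_add f g,
        (Lp.coeFn_nonneg f).2 hf.1, (Lp.coeFn_nonneg g).2 hg.1] with z h1 h2 h3 h4
      rw [h1, Pi.smul_apply, h2, Pi.add_apply, smul_eq_mul]
      simp only [Pi.zero_apply] at *
      positivity
    · intro s hs
      rw [hmid, hf.2.1 s hs, hg.2.1 s hs]; ring
    · intro s hs
      rw [hmid, hf.2.2 s hs, hg.2.2 s hs]; ring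
  have hK0 : ∀ f ∈ K, 0 ≤ᵐ[ν] f := fun f hf => (Lp.coeFn_nonneg f).2 hf.1
  have hKint : ∀ f ∈ K, ∫ z, f z ∂ν = 1 := by
    intro f hf
    have := hf.2.1 Set.univ MeasurableSet.univ
    simpa using this
  -- elements of `K` give couplings
  have hcoup : ∀ f ∈ K,
      IsCoupling (ν.withDensity fun z => ENNReal.ofReal (f z)) μ₁ μ₂ := by
    intro f hf
    exact ⟨(map_withDensity_iff ν μ₁ _ measurable_fst f (L1.integrable_coeFn f) (hK0 f hf)).2
      hf.2.1, (map_withDensity_iff ν μ₂ _ measurable_snd f (L1.integrable_coeFn f) (hK0 f hf)).2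
      hf.2.2⟩
  have hval : ∀ f ∈ K,
      V (ν.withDensity fun z => ENNReal.ofReal (f z)) + ENNReal.ofReal A = J f := by
    intro f hf
    refine value_eq ν c hcm hc0 q hq₁ ε hε f (Lp.stronglyMeasurable f).measurable (hK0 f hf) ?_
    rw [← ofReal_integral_eq_lintegral_ofReal (L1.integrable_coeFn f) (hK0 f hf), hKint f hf,
      ENNReal.ofReal_one]
  -- couplings of finite value come from elements of `K`
  have hback : ∀ π, IsCoupling π μ₁ μ₂ → π ≪ ν →
      ∃ f ∈ K, π = ν.withDensity fun z => ENNReal.ofReal (f z) := by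
    intro π hπ hac
    have hprob : IsProbabilityMeasure π := by
      constructor
      have : π.map Prod.fst Set.univ = 1 := by rw [hπ.1]; exact measure_univ
      rwa [Measure.map_apply measurable_fst MeasurableSet.univ, Set.preimage_univ] at this
    have hi : Integrable (fun z => (π.rnDeriv ν z).toReal) ν := Measure.integrable_toReal_rnDeriv
    have hfe : π = ν.withDensity fun z => ENNReal.ofReal (hi.toL1 _ z) := by
      conv_lhs => rw [← Measure.withDensity_rnDeriv_eq π ν hac]
      apply withDensity_congr_ae
      filter_upwards [hi.coeFn_toL1, Measure.rnDeriv_lt_top π ν] with z h1 h2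
      rw [h1, ENNReal.ofReal_toReal h2.ne]
    have hf0 : 0 ≤ hi.toL1 _ := by
      rw [← Lp.coeFn_nonneg]
      filter_upwards [hi.coeFn_toL1] with z h1
      rw [h1]
      exact ENNReal.toReal_nonneg
    refine ⟨hi.toL1 _, ⟨hf0, ?_, ?_⟩, hfe⟩
    · refine (map_withDensity_iff ν μ₁ _ measurable_fst _ (L1.integrable_coeFn _)
        ((Lp.coeFn_nonneg _).2 hf0)).1 ?_
      rw [← hfe]; exact hπ.1
    · refine (map_withDensity_iff ν μ₂ _ measurable_snd _ (L1.integrable_coeFn _)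
        ((Lp.coeFn_nonneg _).2 hf0)).1 ?_
      rw [← hfe]; exact hπ.2
  have hVtop : ∀ π, ¬ π ≪ ν → V π = ⊤ := by
    intro π h
    simp only [hV, tsallisDiv, if_neg h]
    rw [ENNReal.mul_top (ENNReal.ofReal_pos.2 hε).ne', add_top]
  have hne : ∃ f ∈ K, J f ≠ ⊤ := by
    have hνc : IsCoupling ν μ₁ μ₂ := by
      constructor <;> simp [hν]
    obtain ⟨f, hf, hfe⟩ := hback ν hνc Measure.AbsolutelyContinuous.rfl
    refine ⟨f, hf, ?_⟩
    rw [← hval f hf, ← hfe]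
    refine ENNReal.add_ne_top.2 ⟨ENNReal.add_ne_top.2 ⟨hcint, ?_⟩, ENNReal.ofReal_ne_top⟩
    refine ENNReal.mul_ne_top ENNReal.ofReal_ne_top ?_
    rw [tsallisDiv, if_pos Measure.AbsolutelyContinuous.rfl]
    refine ENNReal.div_ne_top ?_ (ENNReal.ofReal_pos.2 hq0).ne'
    refine ne_top_of_le_ne_top ?_ tsub_le_self
    have : ∫⁻ z, ν.rnDeriv ν z ^ q ∂ν = 1 := by
      have h1 : ∫⁻ z, ν.rnDeriv ν z ^ q ∂ν = ∫⁻ _, 1 ∂ν := by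
        apply lintegral_congr_ae
        filter_upwards [Measure.rnDeriv_self ν] with z h
        rw [h]; simp
      rw [h1]; simp
    rw [this]
    exact ENNReal.one_ne_top
  obtain ⟨f, hfK, hftop, hmin, huniq⟩ := exists_min_L1 ν c hcm hc0 A hA q hq₁ K hKc hKm hK0
    (fun f hf => (hKint f hf).le) J (fun _ => rfl) hne
  have hVle : ∀ f ∈ K, ∀ g ∈ K, J f ≤ J g ↔ V (ν.withDensity fun z => ENNReal.ofReal (f z)) ≤
      V (ν.withDensity fun z => ENNReal.ofReal (g z)) := by
    intro f hf g hg
    rw [← hval f hf, ← hval g hg]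
    exact ENNReal.add_le_add_iff_right ENNReal.ofReal_ne_top
  refine ⟨ν.withDensity fun z => ENNReal.ofReal (f z), ⟨hcoup f hfK, ?_⟩, ?_⟩
  · intro π' hπ'
    change V _ ≤ V π'
    by_cases hac : π' ≪ ν
    · obtain ⟨g, hg, rfl⟩ := hback π' hπ' hac
      exact (hVle f hfK g hg).1 (hmin g hg)
    · rw [hVtop π' hac]; exact le_top
  · rintro π' ⟨hπ', hm⟩
    have h1 : V π' ≤ V (ν.withDensity fun z => ENNReal.ofReal (f z)) := hm _ (hcoup f hfK)
    have hac : π' ≪ ν := by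
      by_contra h
      rw [hVtop π' h, top_le_iff] at h1
      apply hftop
      rw [← hval f hfK, h1, top_add]
    obtain ⟨g, hg, rfl⟩ := hback π' hπ' hac
    rw [huniq g hg ((hVle g hg f hfK).2 h1)]

end
end

section
/- Let X₁ and X₂ be Polish metric spaces, p ∈ [1,∞), μᵢ ∈ 𝒫_p(Xᵢ) (i = 1,2). Suppose μ₂ satisfies quant_p(C,β) for some β ≥ 1, C ≥ 0, and the continuous cost c: X₁ × X₂ → [0,∞) satisfies condition (A_{L,C}) for some L ≥ 0. Then for every 1 < q ≤ 2, every ε > 0, and every integer n ≥ 1: OT_{q,ε} − OT ≤ 2LC n^{−1/β} + ε (n^{q−1} − 1)/(q − 1). -/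
open MeasureTheory Filter Topology
open scoped ENNReal Classical

noncomputable section

/-- `μ` is supported on at most `n` points. -/
def SupportedOnAtMost {X : Type*} [MeasurableSpace X] (n : ℕ) (μ : Measure X) : Prop :=
  ∃ s : Finset X, s.card ≤ n ∧ μ (↑s)ᶜ = 0

/-- `μ` satisfies `quant_p(C, β)`: there are `n`-point probability measures `μⁿ` with
`W_p(μⁿ, μ) ≤ C n^{-1/β}`. -/
def Quant {X : Type*} [MeasurableSpace X] [PseudoEMetricSpace X] (p C β : ℝ)
    (μ : Measure X) : Prop :=
  ∃ μs : ℕ → Measure X, ∀ n : ℕ, 1 ≤ n →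
    IsProbabilityMeasure (μs n) ∧ SupportedOnAtMost n (μs n) ∧
      Wp p (μs n) μ ≤ ENNReal.ofReal (C * (n : ℝ) ^ (-(1 / β)))

/-- The Tsallis entropic regularized optimal transport value `OT_{q,ε}`. -/
def OTq {X₁ X₂ : Type*} [MeasurableSpace X₁] [MeasurableSpace X₂]
    (q ε : ℝ) (c : X₁ × X₂ → ℝ) (μ₁ : Measure X₁) (μ₂ : Measure X₂) : ℝ≥0∞ :=
  ⨅ (π : Measure (X₁ × X₂)) (_ : IsCoupling π μ₁ μ₂),
    (∫⁻ z, ENNReal.ofReal (c z) ∂π + ENNReal.ofReal ε * tsallisDiv q π (μ₁.prod μ₂))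

/-- The Monge–Kantorovich optimal transport value `OT`. -/
def OT0 {X₁ X₂ : Type*} [MeasurableSpace X₁] [MeasurableSpace X₂]
    (c : X₁ × X₂ → ℝ) (μ₁ : Measure X₁) (μ₂ : Measure X₂) : ℝ≥0∞ :=
  ⨅ (π : Measure (X₁ × X₂)) (_ : IsCoupling π μ₁ μ₂), ∫⁻ z, ENNReal.ofReal (c z) ∂π

lemma aux_withDensity_sum {X ι : Type*} [MeasurableSpace X] (μ : Measure X) (s : Finset ι)
    (a : ι → X → ℝ≥0∞) (ha : ∀ j, Measurable (a j)) :
    μ.withDensity (fun x => ∑ j ∈ s, a j x) = ∑ j ∈ s, μ.withDensity (a j) := by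
  ext A hA
  rw [withDensity_apply _ hA, Measure.finsetSum_apply, lintegral_finsetSum _ (fun j _ => ha j)]
  exact Finset.sum_congr rfl (fun j _ => (withDensity_apply _ hA).symm)

lemma aux_density {X ι : Type*} [MeasurableSpace X] (μ : Measure X) [IsProbabilityMeasure μ]
    (s : Finset ι) (α : ι → Measure X) (hα : ∑ j ∈ s, α j = μ) :
    ∃ a : ι → X → ℝ≥0∞, (∀ j, Measurable (a j)) ∧ (∀ j ∈ s, μ.withDensity (a j) = α j) ∧
      ∀ᵐ x ∂μ, ∑ j ∈ s, a j x = 1 := by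
  have hle : ∀ j ∈ s, α j ≤ μ := by
    intro j hj
    rw [← hα]
    exact Finset.single_le_sum (f := α) (fun i _ => Measure.zero_le _) hj
  have hd : ∀ j ∈ s, μ.withDensity ((α j).rnDeriv μ) = α j := by
    intro j hj
    have : IsFiniteMeasure (α j) := isFiniteMeasure_of_le μ (hle j hj)
    exact Measure.withDensity_rnDeriv_eq _ _ (Measure.absolutelyContinuous_of_le (hle j hj))
  refine ⟨fun j => (α j).rnDeriv μ, fun j => Measure.measurable_rnDeriv _ _, hd, ?_⟩
  have h1 : μ.withDensity (fun x => ∑ j ∈ s, (α j).rnDeriv μ x) = μ.withDensity 1 := by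
    rw [aux_withDensity_sum _ _ _ (fun j => Measure.measurable_rnDeriv _ _), withDensity_one,
      Finset.sum_congr rfl hd, hα]
  have hm : Measurable (fun x => ∑ j ∈ s, (α j).rnDeriv μ x) :=
    Finset.measurable_sum _ (fun j _ => Measure.measurable_rnDeriv _ _)
  have := (withDensity_eq_iff (μ := μ) (g := 1) (f := fun x => ∑ j ∈ s, (α j).rnDeriv μ x)
    hm.aemeasurable aemeasurable_const ?_).1 h1
  · exact this
  · have h2 := congrArg (fun m => m Set.univ) h1
    simp only [withDensity_apply _ MeasurableSet.univ, Measure.restrict_univ] at h2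
    rw [h2]; simp

lemma aux_sum_pow {ι : Type*} (s : Finset ι) (n : ℕ) (hs : s.card ≤ n) (w : ι → ℝ≥0∞)
    (hw : ∑ j ∈ s, w j = 1) (q : ℝ) (hq₁ : 1 < q) (hq₂ : q ≤ 2) :
    ∑ j ∈ s, w j * (w j)⁻¹ ^ q * w j ≤ (n : ℝ≥0∞) ^ (q - 1) := by
  have h0 : 0 < q - 1 := by linarith
  have h1 : ∑ j ∈ s, w j * (w j)⁻¹ ^ q * w j ≤ ∑ j ∈ s, w j * (w j)⁻¹ ^ (q - 1) := by
    refine Finset.sum_le_sum (fun j _ => ?_)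
    have : (w j)⁻¹ ^ q = (w j)⁻¹ ^ (q - 1) * (w j)⁻¹ := by
      conv_lhs => rw [show q = (q - 1) + 1 by ring, ENNReal.rpow_add_of_nonneg _ _ h0.le zero_le_one,
        ENNReal.rpow_one]
    rw [this]
    calc w j * ((w j)⁻¹ ^ (q - 1) * (w j)⁻¹) * w j
        = w j * (w j)⁻¹ ^ (q - 1) * ((w j)⁻¹ * w j) := by ring
      _ ≤ w j * (w j)⁻¹ ^ (q - 1) * 1 := by gcongr; exact ENNReal.inv_mul_le_one _
      _ = _ := mul_one _
  refine h1.trans ?_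
  have h2 := ENNReal.rpow_arith_mean_le_arith_mean_rpow s w (fun j => (w j)⁻¹ ^ (q - 1)) hw
    (p := 1 / (q - 1)) (by rw [le_div_iff₀ h0]; linarith)
  have h3 : ∑ j ∈ s, w j * ((w j)⁻¹ ^ (q - 1)) ^ (1 / (q - 1)) ≤ (n : ℝ≥0∞) := by
    calc _ ≤ ∑ j ∈ s, (1 : ℝ≥0∞) := by
          refine Finset.sum_le_sum (fun j _ => ?_)
          rw [← ENNReal.rpow_mul, mul_one_div_cancel h0.ne', ENNReal.rpow_one, mul_comm]
          exact ENNReal.inv_mul_le_one _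
      _ = (s.card : ℝ≥0∞) := by simp
      _ ≤ n := by exact_mod_cast hs
  have h4 := ENNReal.rpow_le_rpow (h2.trans h3) h0.le
  rwa [← ENNReal.rpow_mul, one_div_mul_cancel h0.ne', ENNReal.rpow_one] at h4

/-- Entropy bound. -/
lemma aux_entropy {X₁ X₂ ι : Type*} [MeasurableSpace X₁] [MeasurableSpace X₂]
    (μ₁ : Measure X₁) (μ₂ : Measure X₂) [IsProbabilityMeasure μ₁] [IsProbabilityMeasure μ₂]
    (s : Finset ι) (n : ℕ) (hs : s.card ≤ n)
    (α : ι → Measure X₁) (γ : ι → Measure X₂) (hα : ∑ j ∈ s, α j = μ₁) (hγ : ∑ j ∈ s, γ j = μ₂)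
    (hαγ : ∀ j ∈ s, α j Set.univ = γ j Set.univ)
    (q : ℝ) (hq₁ : 1 < q) (hq₂ : q ≤ 2)
    (ρ : Measure (X₁ × X₂)) [IsProbabilityMeasure ρ]
    (hρ : ρ = ∑ j ∈ s, (α j Set.univ)⁻¹ • (α j).prod (γ j)) :
    tsallisDiv q ρ (μ₁.prod μ₂) ≤ ((n : ℝ≥0∞) ^ (q - 1) - 1) / ENNReal.ofReal (q - 1) := by
  obtain ⟨a, ham, had, ha1⟩ := aux_density μ₁ s α hα
  obtain ⟨g, hgm, hgd, hg1⟩ := aux_density μ₂ s γ hγ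
  set w : ι → ℝ≥0∞ := fun j => α j Set.univ with hw
  have hwa : ∀ j ∈ s, ∫⁻ x, a j x ∂μ₁ = w j := by
    intro j hj
    simp only [hw]
    rw [← had j hj, withDensity_apply _ MeasurableSet.univ, Measure.restrict_univ]
  have hwg : ∀ j ∈ s, ∫⁻ x, g j x ∂μ₂ = w j := by
    intro j hj
    simp only [hw]
    rw [hαγ j hj, ← hgd j hj, withDensity_apply _ MeasurableSet.univ, Measure.restrict_univ]
  have hw1 : ∑ j ∈ s, w j = 1 := by
    have := congrArg (fun m => m Set.univ) hα
    simpa [Measure.finsetSum_apply] using this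
  set f : X₁ × X₂ → ℝ≥0∞ := fun z => ∑ j ∈ s, g j z.2 * ((w j)⁻¹ * a j z.1) with hf
  have htm : ∀ j, Measurable (fun z : X₁ × X₂ => g j z.2 * ((w j)⁻¹ * a j z.1)) := by
    intro j
    exact ((hgm j).comp measurable_snd).mul (((ham j).comp measurable_fst).const_mul _)
  have hfm : Measurable f := Finset.measurable_sum _ (fun j _ => htm j)
  have hρf : ρ = (μ₁.prod μ₂).withDensity f := by
    rw [hρ, hf, aux_withDensity_sum _ _ _ htm]
    refine Finset.sum_congr rfl (fun j hj => ?_)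
    rw [← had j hj, ← hgd j hj, prod_withDensity (ham j) (hgm j), had j hj]
    have hmm : Measurable (fun z : X₁ × X₂ => a j z.1 * g j z.2) :=
      ((ham j).comp measurable_fst).mul ((hgm j).comp measurable_snd)
    rw [← withDensity_smul _ hmm]
    congr 1
    ext z
    simp only [Pi.smul_apply, smul_eq_mul, hw]
    ring
  have hac : ρ ≪ μ₁.prod μ₂ := by
    rw [hρf]; exact withDensity_absolutelyContinuous _ _
  have hrn : ρ.rnDeriv (μ₁.prod μ₂) =ᵐ[μ₁.prod μ₂] f := by
    rw [hρf]; exact Measure.rnDeriv_withDensity _ hfm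
  rw [tsallisDiv, if_pos hac]
  have hI : ∫⁻ x, ρ.rnDeriv (μ₁.prod μ₂) x ∂(μ₁.prod μ₂) = 1 := by
    rw [Measure.lintegral_rnDeriv hac]; simp
  rw [hI]
  gcongr
  have hbd : ∀ᵐ z ∂(μ₁.prod μ₂), ρ.rnDeriv (μ₁.prod μ₂) z ^ q ≤
      ∑ j ∈ s, ((w j)⁻¹ ^ q * a j z.1) * g j z.2 := by
    have e1 := Measure.quasiMeasurePreserving_fst (μ := μ₁) (ν := μ₂) |>.ae ha1
    have e2 := Measure.quasiMeasurePreserving_snd (μ := μ₁) (ν := μ₂) |>.ae hg1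
    filter_upwards [hrn, e1, e2] with z h1 h2 h3
    rw [h1]
    refine (ENNReal.rpow_arith_mean_le_arith_mean_rpow s (fun j => g j z.2)
      (fun j => (w j)⁻¹ * a j z.1) h3 hq₁.le).trans ?_
    refine Finset.sum_le_sum (fun j hj => ?_)
    have haj : a j z.1 ≤ 1 := by
      rw [← h2]
      exact Finset.single_le_sum (f := fun j => a j z.1) (fun i _ => zero_le) hj
    rw [ENNReal.mul_rpow_of_nonneg _ _ (by linarith), mul_comm]
    gcongr
    exact ENNReal.rpow_le_self_of_le_one haj hq₁.le
  refine (lintegral_mono_ae hbd).trans ?_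
  have hmm : ∀ j ∈ s, Measurable (fun z : X₁ × X₂ => ((w j)⁻¹ ^ q * a j z.1) * g j z.2) :=
    fun j _ => (((ham j).comp measurable_fst).const_mul _).mul ((hgm j).comp measurable_snd)
  rw [lintegral_finsetSum _ hmm]
  refine le_trans (le_of_eq ?_) (aux_sum_pow s n hs w hw1 q hq₁ hq₂)
  refine Finset.sum_congr rfl (fun j hj => ?_)
  rw [lintegral_prod_mul (f := fun x => (w j)⁻¹ ^ q * a j x)
    (((ham j).const_mul _).aemeasurable) (hgm j).aemeasurable, lintegral_const_mul _ (ham j),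
    hwa j hj, hwg j hj]
  ring

/-- Moving the second coordinate to finitely many points. -/
lemma aux_WpProd {X₁ X₂ : Type*} [MetricSpace X₁] [SecondCountableTopology X₁]
    [MeasurableSpace X₁] [BorelSpace X₁] [MetricSpace X₂] [SecondCountableTopology X₂]
    [MeasurableSpace X₂] [BorelSpace X₂] (p : ℝ) (hp : 1 ≤ p) (s : Finset X₂)
    (σ : X₂ → Measure (X₁ × X₂)) (γ : X₂ → Measure X₂)
    (hγ : ∀ j ∈ s, (σ j).map Prod.snd = γ j) :
    WpProd p (∑ j ∈ s, σ j) (∑ j ∈ s, ((σ j).map Prod.fst).map (fun x => (x, j))) ≤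
      (∑ j ∈ s, ∫⁻ y, edist j y ^ p ∂(γ j)) ^ (1 / p) := by
  have hm : ∀ j : X₂, Measurable (fun z : X₁ × X₂ => (z, (z.1, j))) := fun j => by fun_prop
  refine (iInf₂_le (∑ j ∈ s, (σ j).map (fun z => (z, (z.1, j)))) ⟨?h1, ?h2⟩).trans ?h3
  case h1 =>
    rw [Measure.map_finset_sum measurable_fst.aemeasurable]
    refine Finset.sum_congr rfl (fun j _ => ?_)
    rw [Measure.map_map measurable_fst (hm j)]
    exact Measure.map_id
  case h2 =>
    rw [Measure.map_finset_sum measurable_snd.aemeasurable]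
    refine Finset.sum_congr rfl (fun j _ => ?_)
    rw [Measure.map_map measurable_snd (hm j), Measure.map_map (by fun_prop) measurable_fst]
    rfl
  case h3 =>
    refine ENNReal.rpow_le_rpow (le_of_eq ?_) (by positivity)
    rw [lintegral_finsetSum_measure]
    refine Finset.sum_congr rfl (fun j hj => ?_)
    have hM : Measurable (fun z : (X₁ × X₂) × (X₁ × X₂) =>
        edist z.1.1 z.2.1 ^ p + edist z.1.2 z.2.2 ^ p) := by fun_prop
    rw [lintegral_map hM (hm j), ← hγ j hj, lintegral_map (by fun_prop) measurable_snd]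
    refine lintegral_congr (fun z => ?_)
    simp [ENNReal.zero_rpow_of_pos (show 0 < p by linarith), edist_comm]

/-- Decomposition of a coupling whose first marginal is finitely supported. -/
lemma aux_decomp {X : Type*} [MetricSpace X] [SecondCountableTopology X]
    [MeasurableSpace X] [BorelSpace X] (p : ℝ) (ν μ : Measure X) (γ : Measure (X × X))
    (hγ : IsCoupling γ ν μ) (s : Finset X) (hs : ν (↑s)ᶜ = 0) :
    ∃ γs : X → Measure X, ∑ j ∈ s, γs j = μ ∧
      ∑ j ∈ s, (γs j Set.univ) • Measure.dirac j = ν ∧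
      ∑ j ∈ s, ∫⁻ y, edist j y ^ p ∂(γs j) = ∫⁻ z, edist z.1 z.2 ^ p ∂γ := by
  have hmS : ∀ j : X, MeasurableSet (Prod.fst ⁻¹' {j} : Set (X × X)) :=
    fun j => measurable_fst (measurableSet_singleton j)
  have hsum : ∑ j ∈ s, γ.restrict (Prod.fst ⁻¹' {j}) = γ := by
    have h1 : γ.restrict (⋃ j ∈ s, (Prod.fst ⁻¹' {j} : Set (X × X))) =
        ∑ j ∈ s, γ.restrict (Prod.fst ⁻¹' {j}) := by
      rw [Measure.restrict_biUnion_finset _ hmS, Measure.sum_fintype,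
        Finset.sum_coe_sort s (fun j => γ.restrict (Prod.fst ⁻¹' {j}))]
      intro i _ j _ hij
      exact Disjoint.preimage _ (by simpa using hij)
    rw [← h1]
    refine Measure.restrict_eq_self_of_ae_mem ?_
    have h2 : ∀ᵐ x ∂ν, x ∈ (s : Set X) := by rwa [ae_iff]
    rw [← hγ.1] at h2
    have h3 := ae_of_ae_map measurable_fst.aemeasurable h2
    filter_upwards [h3] with z hz
    simpa using hz
  refine ⟨fun j => (γ.restrict (Prod.fst ⁻¹' {j})).map Prod.snd, ?_, ?_, ?_⟩
  · rw [← Measure.map_finset_sum measurable_snd.aemeasurable, hsum, hγ.2]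
  · conv_rhs => rw [← hγ.1, ← hsum, Measure.map_finset_sum measurable_fst.aemeasurable]
    refine Finset.sum_congr rfl (fun j _ => ?_)
    rw [Measure.map_apply measurable_snd MeasurableSet.univ, Set.preimage_univ]
    have : (γ.restrict (Prod.fst ⁻¹' {j})).map Prod.fst
        = (γ.restrict (Prod.fst ⁻¹' {j})).map (fun _ => j) := by
      refine Measure.map_congr ?_
      filter_upwards [ae_restrict_mem (hmS j)] with z hz
      exact hz
    rw [this, Measure.map_const]
  · conv_rhs => rw [← hsum, lintegral_finsetSum_measure]
    refine Finset.sum_congr rfl (fun j _ => ?_)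
    rw [lintegral_map (by fun_prop) measurable_snd]
    refine lintegral_congr_ae ?_
    filter_upwards [ae_restrict_mem (hmS j)] with z hz
    have : z.1 = j := hz
    rw [this]

lemma aux_dirac {X₁ X₂ : Type*} [MetricSpace X₁] [SecondCountableTopology X₁]
    [MeasurableSpace X₁] [BorelSpace X₁] [MetricSpace X₂] [SecondCountableTopology X₂]
    [MeasurableSpace X₂] [BorelSpace X₂] (p : ℝ) (hp : 1 ≤ p)
    (μ₁ : Measure X₁) (μ₂ : Measure X₂) [IsProbabilityMeasure μ₁]
    (β : ℝ) (hquant : Quant p 0 β μ₂)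
    (π σ : Measure (X₁ × X₂)) (hπ : IsCoupling π μ₁ μ₂) (hσ : IsCoupling σ μ₁ μ₂) : σ = π := by
  have hp0 : 0 < p := by linarith
  obtain ⟨μs, hμs⟩ := hquant
  obtain ⟨hP, ⟨s, hs, hsν⟩, hW⟩ := hμs 1 le_rfl
  have hex : ∃ x : X₂, ∀ᵐ y ∂(μs 1), y = x := by
    have h2 : ∀ᵐ x ∂(μs 1), x ∈ (s : Set X₂) := by rwa [ae_iff]
    obtain ⟨x, hx⟩ := h2.exists
    refine ⟨x, ?_⟩
    filter_upwards [h2] with y hy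
    exact Finset.card_le_one.1 hs y hy x hx
  obtain ⟨x, hx⟩ := hex
  have h0 : (∫⁻ y, edist x y ^ p ∂μ₂) ^ (1 / p) ≤ 0 := by
    have : Wp p (μs 1) μ₂ ≤ 0 := by simpa using hW
    refine le_trans (le_iInf₂ (fun γ hγ => ?_)) this
    refine ENNReal.rpow_le_rpow (le_of_eq ?_) (by positivity)
    rw [← hγ.2, lintegral_map (by fun_prop) measurable_snd]
    rw [← hγ.1] at hx
    refine lintegral_congr_ae ?_
    filter_upwards [ae_of_ae_map measurable_fst.aemeasurable hx] with z hz
    rw [hz]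
  have h1 : ∫⁻ y, edist x y ^ p ∂μ₂ = 0 := by
    have := nonpos_iff_eq_zero.1 h0
    rwa [ENNReal.rpow_eq_zero_iff_of_pos (by positivity)] at this
  rw [lintegral_eq_zero_iff (by fun_prop)] at h1
  have h2 : ∀ᵐ y ∂μ₂, y = x := by
    filter_upwards [h1] with y hy
    have : edist x y = 0 := by
      rwa [Pi.zero_apply, ENNReal.rpow_eq_zero_iff_of_pos hp0] at hy
    exact (edist_eq_zero.1 this).symm
  have key : ∀ τ : Measure (X₁ × X₂), IsCoupling τ μ₁ μ₂ → τ = μ₁.map (fun a => (a, x)) := by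
    intro τ hτ
    have h3 := h2
    rw [← hτ.2] at h3
    rw [← hτ.1, Measure.map_map (by fun_prop) measurable_fst]
    conv_lhs => rw [← Measure.map_id (μ := τ)]
    refine Measure.map_congr ?_
    filter_upwards [ae_of_ae_map measurable_snd.aemeasurable h3] with z hz
    simp [← hz]
  rw [key π hπ, key σ hσ]

lemma aux_coupling_prob {X₁ X₂ : Type*} [MeasurableSpace X₁] [MeasurableSpace X₂]
    {μ₁ : Measure X₁} {μ₂ : Measure X₂} [IsProbabilityMeasure μ₁]
    {ρ : Measure (X₁ × X₂)} (hρ : IsCoupling ρ μ₁ μ₂) : IsProbabilityMeasure ρ := by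
  constructor
  have h : ρ.map Prod.fst Set.univ = 1 := by rw [hρ.1]; simp
  rwa [Measure.map_apply measurable_fst MeasurableSet.univ, Set.preimage_univ] at h

lemma aux_integrable {X₁ X₂ : Type*} [MetricSpace X₁] [SecondCountableTopology X₁]
    [MeasurableSpace X₁] [BorelSpace X₁] [MetricSpace X₂] [SecondCountableTopology X₂]
    [MeasurableSpace X₂] [BorelSpace X₂] (p : ℝ) (hp : 1 ≤ p)
    (μ₁ : Measure X₁) (μ₂ : Measure X₂) [IsProbabilityMeasure μ₁] [IsProbabilityMeasure μ₂]
    (hm₁ : HasFiniteMoment p μ₁) (hm₂ : HasFiniteMoment p μ₂)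
    (C : ℝ) (hC : 0 < C)
    (c : X₁ × X₂ → ℝ) (hc : Continuous c) (hc0 : ∀ z, 0 ≤ c z)
    (L : ℝ) (hL : 0 ≤ L) (hA : CondA p L C c μ₁ μ₂)
    (ρ : Measure (X₁ × X₂)) (hρ : IsCoupling ρ μ₁ μ₂) :
    ∫⁻ z, ENNReal.ofReal (c z) ∂ρ ≠ ⊤ := by
  intro htop
  have hp0 : 0 < p := by linarith
  have hprob := aux_coupling_prob hρ
  obtain ⟨x₀, hx₀⟩ := hm₁
  obtain ⟨y₀, hy₀⟩ := hm₂
  have hx₀' : ∫⁻ z, edist z.1 x₀ ^ p ∂ρ ≠ ⊤ := by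
    rwa [← hρ.1, lintegral_map (by fun_prop) measurable_fst] at hx₀
  have hy₀' : ∫⁻ z, edist z.2 y₀ ^ p ∂ρ ≠ ⊤ := by
    rwa [← hρ.2, lintegral_map (by fun_prop) measurable_snd] at hy₀
  have hcm : Measurable c := hc.measurable
  set T : ℕ → X₁ × X₂ → X₁ × X₂ := fun K z => if c z ≤ K then z else (x₀, y₀) with hT
  have hTm : ∀ K, Measurable (T K) := fun K =>
    Measurable.ite (measurableSet_le hcm measurable_const) measurable_id measurable_const
  have hTev : ∀ z, ∀ᶠ K in atTop, T K z = z := by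
    intro z
    filter_upwards [eventually_ge_atTop ⌈c z⌉₊] with K hK
    simp only [hT]
    rw [if_pos ((Nat.le_ceil _).trans (by exact_mod_cast hK))]
  set F : ℕ → X₁ × X₂ → ℝ≥0∞ :=
    fun K z => edist z.1 (T K z).1 ^ p + edist z.2 (T K z).2 ^ p with hF
  have hFm : ∀ K, Measurable (F K) := by
    intro K
    have := hTm K
    simp only [hF]
    fun_prop
  have hlim : Tendsto (fun K => ∫⁻ z, F K z ∂ρ) atTop (𝓝 0) := by
    have := tendsto_lintegral_of_dominated_convergence (μ := ρ) (F := F) (f := fun _ => 0)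
      (fun z => edist z.1 x₀ ^ p + edist z.2 y₀ ^ p) hFm ?_ ?_ ?_
    · simpa using this
    · intro K
      refine Eventually.of_forall (fun z => ?_)
      simp only [hF, hT]
      split_ifs
      · simp [ENNReal.zero_rpow_of_pos hp0]
      · exact le_rfl
    · rw [lintegral_add_left (by fun_prop)]
      exact ENNReal.add_ne_top.2 ⟨hx₀', hy₀'⟩
    · refine Eventually.of_forall (fun z => ?_)
      refine tendsto_const_nhds.congr' ?_
      filter_upwards [hTev z] with K hK
      simp [hF, hK, ENNReal.zero_rpow_of_pos hp0]
  set η : ℝ≥0∞ := ENNReal.ofReal (min C 1) with hη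
  have hηpos : 0 < η ^ p := by
    refine ENNReal.rpow_pos ?_ ENNReal.ofReal_ne_top
    rw [hη, ENNReal.ofReal_pos]
    exact lt_min hC one_pos
  have hroot : ∀ a : ℝ≥0∞, a ≤ η ^ p → a ^ (1 / p) ≤ η := by
    intro a ha
    refine (ENNReal.rpow_le_rpow ha (by positivity)).trans (le_of_eq ?_)
    rw [← ENNReal.rpow_mul, mul_one_div_cancel hp0.ne', ENNReal.rpow_one]
  have hηC : η ≤ ENNReal.ofReal C := ENNReal.ofReal_le_ofReal (min_le_left _ _)
  have hη1 : η ≤ 1 := by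
    rw [hη]; simp
  have hev : ∀ᶠ K in atTop, ∫⁻ z, ENNReal.ofReal (c (T K z)) ∂ρ ≤ ENNReal.ofReal L := by
    filter_upwards [(tendsto_order.1 hlim).2 _ hηpos] with K hK
    have hTK := hTm K
    have hcint : Integrable (fun z => c (T K z)) ρ := by
      refine Integrable.of_bound (C := max K (c (x₀, y₀)))
        (hcm.comp hTK).aestronglyMeasurable (Eventually.of_forall (fun z => ?_))
      rw [Real.norm_of_nonneg (hc0 _)]
      simp only [hT]
      split_ifs with h
      · exact h.trans (le_max_left _ _)
      · exact le_max_right _ _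
    have hkey := hA (ρ.map (fun z => (T K z).1)) (ρ.map (fun z => (T K z).2))
      (Measure.isProbabilityMeasure_map (by fun_prop))
      (Measure.isProbabilityMeasure_map (by fun_prop)) ?_ ?_ ?_ ?_ ρ hρ (ρ.map (T K)) ?_
    · have hz : ∫ z, c z ∂ρ = 0 := by
        rw [integral_eq_lintegral_of_nonneg_ae (Eventually.of_forall hc0)
          hcm.aestronglyMeasurable, htop]
        rfl
      rw [hz, integral_map hTK.aemeasurable hcm.aestronglyMeasurable, zero_sub, abs_neg] at hkey
      rw [← ofReal_integral_eq_lintegral_ofReal hcint (Eventually.of_forall (fun z => hc0 _))]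
      refine ENNReal.ofReal_le_ofReal ((le_abs_self _).trans (hkey.trans ?_))
      have hW : WpProd p ρ (ρ.map (T K)) ≤ 1 := by
        refine (iInf₂_le (ρ.map (fun z => (z, T K z))) ⟨?h1, ?h2⟩).trans ?h3
        case h1 =>
          rw [Measure.map_map measurable_fst (by fun_prop)]
          exact Measure.map_id
        case h2 =>
          rw [Measure.map_map measurable_snd (by fun_prop)]
          rfl
        case h3 =>
          rw [lintegral_map (by fun_prop) (by fun_prop)]
          exact (hroot _ hK.le).trans hη1
      have : (WpProd p ρ (ρ.map (T K))).toReal ≤ 1 :=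
        ENNReal.toReal_le_of_le_ofReal zero_le_one (by simpa using hW)
      nlinarith
    · refine ⟨x₀, ne_top_of_le_ne_top hx₀' ?_⟩
      rw [lintegral_map (by fun_prop) (by fun_prop)]
      refine lintegral_mono (fun z => ?_)
      simp only [hT]
      split_ifs
      · exact le_rfl
      · simp [ENNReal.zero_rpow_of_pos hp0]
    · refine ⟨y₀, ne_top_of_le_ne_top hy₀' ?_⟩
      rw [lintegral_map (by fun_prop) (by fun_prop)]
      refine lintegral_mono (fun z => ?_)
      simp only [hT]
      split_ifs
      · exact le_rfl
      · simp [ENNReal.zero_rpow_of_pos hp0]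
    · refine (iInf₂_le (ρ.map (fun z => ((T K z).1, z.1))) ⟨?h1, ?h2⟩).trans ?h3
      case h1 =>
        rw [Measure.map_map measurable_fst (by fun_prop)]
        rfl
      case h2 =>
        rw [Measure.map_map measurable_snd (by fun_prop)]
        exact hρ.1
      case h3 =>
        rw [lintegral_map (by fun_prop) (by fun_prop)]
        refine (hroot _ (le_trans (lintegral_mono (fun z => ?_)) hK.le)).trans hηC
        simp only [hF]
        rw [edist_comm]
        exact le_self_add
    · refine (iInf₂_le (ρ.map (fun z => ((T K z).2, z.2))) ⟨?h1, ?h2⟩).trans ?h3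
      case h1 =>
        rw [Measure.map_map measurable_fst (by fun_prop)]
        rfl
      case h2 =>
        rw [Measure.map_map measurable_snd (by fun_prop)]
        exact hρ.2
      case h3 =>
        rw [lintegral_map (by fun_prop) (by fun_prop)]
        refine (hroot _ (le_trans (lintegral_mono (fun z => ?_)) hK.le)).trans hηC
        simp only [hF]
        rw [edist_comm]
        exact le_add_self
    · constructor
      · rw [Measure.map_map measurable_fst hTK]; rfl
      · rw [Measure.map_map measurable_snd hTK]; rfl
  have hfatou : ∫⁻ z, ENNReal.ofReal (c z) ∂ρ ≤ ENNReal.ofReal L := by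
    calc ∫⁻ z, ENNReal.ofReal (c z) ∂ρ
        = ∫⁻ z, liminf (fun K => ENNReal.ofReal (c (T K z))) atTop ∂ρ := by
          refine lintegral_congr (fun z => ?_)
          have : Tendsto (fun K => ENNReal.ofReal (c (T K z))) atTop
              (𝓝 (ENNReal.ofReal (c z))) := by
            refine tendsto_const_nhds.congr' ?_
            filter_upwards [hTev z] with K hK
            rw [hK]
          exact this.liminf_eq.symm
      _ ≤ liminf (fun K => ∫⁻ z, ENNReal.ofReal (c (T K z)) ∂ρ) atTop :=
          lintegral_liminf_le (fun K => (hcm.comp (hTm K)).ennreal_ofReal)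
      _ ≤ ENNReal.ofReal L := liminf_le_of_frequently_le' hev.frequently
  rw [htop] at hfatou
  exact ENNReal.ofReal_ne_top (top_le_iff.1 hfatou)

lemma aux_Wp_self {X : Type*} [MetricSpace X] [SecondCountableTopology X]
    [MeasurableSpace X] [BorelSpace X] (p : ℝ) (hp : 1 ≤ p) (μ : Measure X) :
    Wp p μ μ ≤ 0 := by
  have hp0 : 0 < p := by linarith
  have hm : Measurable (fun x : X => (x, x)) := by fun_prop
  refine (iInf₂_le (μ.map (fun x => (x, x))) ⟨?h1, ?h2⟩).trans ?h3
  case h1 =>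
    rw [Measure.map_map measurable_fst hm]; exact Measure.map_id
  case h2 =>
    rw [Measure.map_map measurable_snd hm]; exact Measure.map_id
  case h3 =>
    rw [lintegral_map (by fun_prop) hm]
    simp [ENNReal.zero_rpow_of_pos hp0, hp0]

/-- The main construction. -/
lemma aux_main {X₁ X₂ : Type*} [MetricSpace X₁] [SecondCountableTopology X₁]
    [MeasurableSpace X₁] [BorelSpace X₁] [MetricSpace X₂] [SecondCountableTopology X₂]
    [MeasurableSpace X₂] [BorelSpace X₂] (p : ℝ) (hp : 1 ≤ p)
    (μ₁ : Measure X₁) (μ₂ : Measure X₂) [IsProbabilityMeasure μ₁] [IsProbabilityMeasure μ₂]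
    (π : Measure (X₁ × X₂)) (hπ : IsCoupling π μ₁ μ₂)
    (ν : Measure X₂) (n : ℕ) (hν : SupportedOnAtMost n ν)
    (γ : Measure (X₂ × X₂)) (hγ : IsCoupling γ ν μ₂)
    (q : ℝ) (hq₁ : 1 < q) (hq₂ : q ≤ 2) :
    ∃ π' ρ : Measure (X₁ × X₂), IsCoupling π' μ₁ ν ∧ IsCoupling ρ μ₁ μ₂ ∧
      WpProd p π π' ≤ (∫⁻ z, edist z.1 z.2 ^ p ∂γ) ^ (1 / p) ∧
      WpProd p ρ π' ≤ (∫⁻ z, edist z.1 z.2 ^ p ∂γ) ^ (1 / p) ∧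
      tsallisDiv q ρ (μ₁.prod μ₂) ≤ ((n : ℝ≥0∞) ^ (q - 1) - 1) / ENNReal.ofReal (q - 1) := by
  obtain ⟨s, hs, hsν⟩ := hν
  obtain ⟨γs, hγ1, hγ2, hγ3⟩ := aux_decomp p ν μ₂ γ hγ s hsν
  obtain ⟨g, hgm, hgd, hg1⟩ := aux_density μ₂ s γs hγ1
  set πs : X₂ → Measure (X₁ × X₂) := fun j => π.withDensity (fun z => g j z.2) with hπs
  have hπsum : ∑ j ∈ s, πs j = π := by
    simp only [hπs]
    rw [← aux_withDensity_sum π s (fun j z => g j z.2) (fun j => (hgm j).comp measurable_snd)]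
    rw [← hπ.2] at hg1
    have hg2 : (fun z : X₁ × X₂ => ∑ j ∈ s, g j z.2) =ᵐ[π] 1 := by
      filter_upwards [ae_of_ae_map measurable_snd.aemeasurable hg1] with z hz
      exact hz
    rw [withDensity_congr_ae hg2]
    exact withDensity_one
  have hπsnd : ∀ j ∈ s, (πs j).map Prod.snd = γs j := by
    intro j hj
    rw [← hgd j hj]
    ext A hA
    rw [Measure.map_apply measurable_snd hA, withDensity_apply _ (measurable_snd hA),
      withDensity_apply _ hA, ← hπ.2, setLIntegral_map hA (hgm j) measurable_snd]
  set α : X₂ → Measure X₁ := fun j => (πs j).map Prod.fst with hα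
  have hαsum : ∑ j ∈ s, α j = μ₁ := by
    rw [← hπ.1, ← hπsum, Measure.map_finset_sum measurable_fst.aemeasurable]
  have hαγ : ∀ j ∈ s, α j Set.univ = γs j Set.univ := by
    intro j hj
    rw [← hπsnd j hj]
    simp only [hα]
    rw [Measure.map_apply measurable_fst MeasurableSet.univ,
      Measure.map_apply measurable_snd MeasurableSet.univ]
    rfl
  have hfinα : ∀ j ∈ s, IsFiniteMeasure (α j) := fun j hj =>
    isFiniteMeasure_of_le μ₁ (by
      rw [← hαsum]; exact Finset.single_le_sum (f := α) (fun i _ => Measure.zero_le _) hj)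
  have hfinγ : ∀ j ∈ s, IsFiniteMeasure (γs j) := fun j hj =>
    isFiniteMeasure_of_le μ₂ (by
      rw [← hγ1]; exact Finset.single_le_sum (f := γs) (fun i _ => Measure.zero_le _) hj)
  set ρs : X₂ → Measure (X₁ × X₂) := fun j => (α j Set.univ)⁻¹ • (α j).prod (γs j) with hρs
  have hρfst : ∀ j ∈ s, (ρs j).map Prod.fst = α j := by
    intro j hj
    have := hfinα j hj
    have := hfinγ j hj
    simp only [hρs]
    rw [Measure.map_smul, Measure.map_fst_prod, ← hαγ j hj, smul_smul]
    by_cases h : α j Set.univ = 0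
    · rw [Measure.measure_univ_eq_zero.1 h]; simp
    · rw [ENNReal.inv_mul_cancel h (measure_ne_top _ _), one_smul]
  have hρsnd : ∀ j ∈ s, (ρs j).map Prod.snd = γs j := by
    intro j hj
    have := hfinα j hj
    have := hfinγ j hj
    simp only [hρs]
    rw [Measure.map_smul, Measure.map_snd_prod, smul_smul]
    by_cases h : α j Set.univ = 0
    · have h' := h
      rw [hαγ j hj] at h'
      rw [Measure.measure_univ_eq_zero.1 h']; simp
    · rw [ENNReal.inv_mul_cancel h (measure_ne_top _ _), one_smul]
  have hρc : IsCoupling (∑ j ∈ s, ρs j) μ₁ μ₂ := by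
    constructor
    · rw [Measure.map_finset_sum measurable_fst.aemeasurable, Finset.sum_congr rfl hρfst, hαsum]
    · rw [Measure.map_finset_sum measurable_snd.aemeasurable, Finset.sum_congr rfl hρsnd, hγ1]
  refine ⟨∑ j ∈ s, (α j).map (fun x => (x, j)), ∑ j ∈ s, ρs j, ⟨?_, ?_⟩, hρc, ?_, ?_, ?_⟩
  · rw [Measure.map_finset_sum measurable_fst.aemeasurable, ← hαsum]
    refine Finset.sum_congr rfl (fun j _ => ?_)
    rw [Measure.map_map measurable_fst (by fun_prop)]
    exact Measure.map_id
  · rw [Measure.map_finset_sum measurable_snd.aemeasurable, ← hγ2]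
    refine Finset.sum_congr rfl (fun j hj => ?_)
    rw [Measure.map_map measurable_snd (by fun_prop), ← hαγ j hj]
    exact Measure.map_const _ _
  · have := aux_WpProd p hp s πs γs hπsnd
    rwa [hπsum, hγ3] at this
  · have := aux_WpProd p hp s ρs γs hρsnd
    rw [hγ3] at this
    rwa [Finset.sum_congr rfl
      (fun j hj => by rw [hρfst j hj] :
        ∀ j ∈ s, ((ρs j).map Prod.fst).map (fun x => (x, j)) = (α j).map (fun x => (x, j)))] at this
  · have := aux_coupling_prob hρc
    exact aux_entropy μ₁ μ₂ s n hs α γs hαsum hγ1 hαγ q hq₁ hq₂ _ rfl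

lemma aux_finite_moment {X : Type*} [MetricSpace X] [SecondCountableTopology X]
    [MeasurableSpace X] [BorelSpace X] (p : ℝ) (hp : 1 ≤ p) (n : ℕ) (ν : Measure X)
    [IsProbabilityMeasure ν] (hν : SupportedOnAtMost n ν) : HasFiniteMoment p ν := by
  obtain ⟨s, hs, hsν⟩ := hν
  have h2 : ∀ᵐ x ∂ν, x ∈ (s : Set X) := by rwa [ae_iff]
  obtain ⟨x, hx⟩ := h2.exists
  refine ⟨x, ?_⟩
  have hb : ∫⁻ y, edist y x ^ p ∂ν ≤ ∫⁻ _, ∑ j ∈ s, edist j x ^ p ∂ν := by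
    refine lintegral_mono_ae ?_
    filter_upwards [h2] with y hy
    exact Finset.single_le_sum (f := fun j => edist j x ^ p) (fun i _ => zero_le) hy
  refine ne_top_of_le_ne_top ?_ hb
  rw [lintegral_const, measure_univ, mul_one]
  refine ENNReal.sum_ne_top.2 (fun j _ => ?_)
  exact ENNReal.rpow_ne_top_of_nonneg (by linarith) (edist_ne_top _ _)

/-- Quantization bound for the Tsallis entropic regularized optimal transport. -/
theorem tsallis_quantization_bound
    {X₁ : Type*} [MetricSpace X₁] [CompleteSpace X₁] [TopologicalSpace.SeparableSpace X₁]
    [MeasurableSpace X₁] [BorelSpace X₁]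
    {X₂ : Type*} [MetricSpace X₂] [CompleteSpace X₂] [TopologicalSpace.SeparableSpace X₂]
    [MeasurableSpace X₂] [BorelSpace X₂]
    (p : ℝ) (hp : 1 ≤ p)
    (μ₁ : Measure X₁) (μ₂ : Measure X₂)
    [IsProbabilityMeasure μ₁] [IsProbabilityMeasure μ₂]
    (hm₁ : HasFiniteMoment p μ₁) (hm₂ : HasFiniteMoment p μ₂)
    (β C : ℝ) (hβ : 1 ≤ β) (hC : 0 ≤ C) (hquant : Quant p C β μ₂)
    (c : X₁ × X₂ → ℝ) (hc : Continuous c) (hc0 : ∀ z, 0 ≤ c z)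
    (L : ℝ) (hL : 0 ≤ L) (hA : CondA p L C c μ₁ μ₂)
    (q : ℝ) (hq₁ : 1 < q) (hq₂ : q ≤ 2) (ε : ℝ) (hε : 0 < ε)
    (n : ℕ) (hn : 1 ≤ n) :
    OTq q ε c μ₁ μ₂ - OT0 c μ₁ μ₂ ≤
      ENNReal.ofReal
        (2 * L * C * (n : ℝ) ^ (-(1 / β)) + ε * ((n : ℝ) ^ (q - 1) - 1) / (q - 1)) := by
  have := UniformSpace.secondCountable_of_separable X₁
  have := UniformSpace.secondCountable_of_separable X₂
  have hq0 : 0 < q - 1 := by linarith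
  have hn1 : (1 : ℝ) ≤ n := by exact_mod_cast hn
  set R : ℝ := C * (n : ℝ) ^ (-(1 / β)) with hR
  have hR0 : 0 ≤ R := by positivity
  have hRC : R ≤ C := by
    have : (n : ℝ) ^ (-(1 / β)) ≤ 1 := by
      refine Real.rpow_le_one_of_one_le_of_nonpos hn1 ?_
      have : 0 ≤ 1 / β := by positivity
      linarith
    nlinarith
  set E : ℝ := ε * ((n : ℝ) ^ (q - 1) - 1) / (q - 1) with hE
  have hE0 : 0 ≤ E := by
    have := Real.one_le_rpow hn1 hq0.le
    refine div_nonneg (mul_nonneg hε.le (by linarith)) hq0.le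
  have hEE : ENNReal.ofReal ε * (((n : ℝ≥0∞) ^ (q - 1) - 1) / ENNReal.ofReal (q - 1)) =
      ENNReal.ofReal E := by
    rw [hE, mul_div_assoc, ENNReal.ofReal_mul hε.le, ENNReal.ofReal_div_of_pos hq0,
      ENNReal.ofReal_sub ((n : ℝ) ^ (q - 1)) zero_le_one, ← ENNReal.ofReal_rpow_of_nonneg (by positivity) hq0.le]
    simp
  rw [tsub_le_iff_left, ← tsub_le_iff_right]
  refine le_iInf₂ (fun π hπ => ?_)
  rw [tsub_le_iff_right]
  by_cases hfin : ∫⁻ z, ENNReal.ofReal (c z) ∂π = ⊤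
  · rw [hfin]; simp
  have hfinall : ∀ σ : Measure (X₁ × X₂), IsCoupling σ μ₁ μ₂ →
      ∫⁻ z, ENNReal.ofReal (c z) ∂σ ≠ ⊤ := by
    intro σ hσ
    rcases hC.eq_or_lt with h | h
    · subst h
      rw [aux_dirac p hp μ₁ μ₂ β hquant π σ hπ hσ]
      exact hfin
    · exact aux_integrable p hp μ₁ μ₂ hm₁ hm₂ C h c hc hc0 L hL hA σ hσ
  have hofReal : ∀ σ : Measure (X₁ × X₂), IsCoupling σ μ₁ μ₂ →
      ∫⁻ z, ENNReal.ofReal (c z) ∂σ = ENNReal.ofReal (∫ z, c z ∂σ) := by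
    intro σ hσ
    rw [integral_eq_lintegral_of_nonneg_ae (Eventually.of_forall hc0)
      hc.measurable.aestronglyMeasurable, ENNReal.ofReal_toReal (hfinall σ hσ)]
  obtain ⟨μs, hμs⟩ := hquant
  obtain ⟨hP, hsupp, hW⟩ := hμs n hn
  have hstep : ∀ δ : ℝ, 0 < δ → OTq q ε c μ₁ μ₂ ≤ ENNReal.ofReal
      ((∫ z, c z ∂π) + (2 * L * (R + δ) + E)) := by
    intro δ hδ
    have hlt : Wp p (μs n) μ₂ < ENNReal.ofReal (R + δ) :=
      lt_of_le_of_lt hW ((ENNReal.ofReal_lt_ofReal_iff (by linarith)).2 (by linarith))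
    obtain ⟨γ, hγ, hγlt⟩ := by simpa only [Wp, iInf_lt_iff] using hlt
    obtain ⟨π', ρ, hπ', hρ, hW1, hW2, hD⟩ :=
      aux_main p hp μ₁ μ₂ π hπ (μs n) n hsupp γ hγ q hq₁ hq₂
    have hCond := fun τ hτ => hA μ₁ (μs n) inferInstance hP hm₁
      (aux_finite_moment p hp n _ hsupp)
      ((aux_Wp_self p hp μ₁).trans zero_le) (hW.trans (ENNReal.ofReal_le_ofReal hRC)) τ hτ π' hπ'
    have h1 := hCond π hπ
    have h2 := hCond ρ hρ
    have b1 : (WpProd p π π').toReal ≤ R + δ :=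
      ENNReal.toReal_le_of_le_ofReal (by linarith) (hW1.trans hγlt.le)
    have b2 : (WpProd p ρ π').toReal ≤ R + δ :=
      ENNReal.toReal_le_of_le_ofReal (by linarith) (hW2.trans hγlt.le)
    have c1 := mul_le_mul_of_nonneg_left b1 hL
    have c2 := mul_le_mul_of_nonneg_left b2 hL
    have d1 := abs_le.1 h1
    have d2 := abs_le.1 h2
    refine (iInf₂_le ρ hρ).trans ?_
    rw [hofReal ρ hρ]
    calc _ ≤ ENNReal.ofReal (∫ z, c z ∂ρ) + ENNReal.ofReal E := by
          rw [← hEE]; gcongr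
      _ = ENNReal.ofReal ((∫ z, c z ∂ρ) + E) :=
          (ENNReal.ofReal_add (integral_nonneg hc0) hE0).symm
      _ ≤ _ := ENNReal.ofReal_le_ofReal (by linarith [d1.1, d2.2])
  have hlim : Tendsto (fun δ : ℝ => ENNReal.ofReal ((∫ z, c z ∂π) + (2 * L * (R + δ) + E)))
      (𝓝[>] 0) (𝓝 (ENNReal.ofReal ((∫ z, c z ∂π) + (2 * L * (R + 0) + E)))) := by
    refine Tendsto.mono_left ?_ nhdsWithin_le_nhds
    refine Continuous.tendsto
      (f := fun δ : ℝ => ENNReal.ofReal ((∫ z, c z ∂π) + (2 * L * (R + δ) + E))) ?_ 0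
    exact ENNReal.continuous_ofReal.comp (by fun_prop)
  have hfinal := ge_of_tendsto hlim (eventually_mem_nhdsWithin.mono (fun δ hδ => hstep δ hδ))
  refine hfinal.trans (le_of_eq ?_)
  rw [hofReal π hπ, ← ENNReal.ofReal_add (integral_nonneg hc0) (by positivity)]
  congr 1
  rw [hR]
  ring

end
end
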